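/- Let X ⊂ P^{n+c} be a nondegenerate irreducible projective variety of codimension c ≥ 4 and degree d. If a₂(X) = C(c+1,2) − 3, then c + 2 ≤ d ≤ c + 4. -/

import Mathlib

/-!
Common framework: a projective variety `X ⊆ ℙ^N` over a field `k` is represented by its
affine cone `C ⊆ (ι → k)` (with `ι` the index type of homogeneous coordinates,
`Fintype.card ι = N + 1`).  All projective notions (vanishing ideal, `a₂`, Hilbert
function, dimension, degree, depth, base locus of quadrics, irreducible components,
scrolls and divisors on them, sectional genus, maximal sectional regularity) are
defined concretely below.
-/

open MvPolynomial

noncomputable section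

namespace PaperQuadrics

variable (k : Type) [Field k] (ι : Type) [Fintype ι] [DecidableEq ι]

/-- The vanishing ideal of a subset `C` of the affine cone `ι → k`. -/
def vanIdeal (C : Set (ι → k)) : Ideal (MvPolynomial ι k) :=
  ⨅ x ∈ C, RingHom.ker (MvPolynomial.eval x)

/-- The degree-`m` graded piece of an ideal of the polynomial ring. -/
def idealPiece (I : Ideal (MvPolynomial ι k)) (m : ℕ) : Submodule k (MvPolynomial ι k) :=
  Submodule.restrictScalars k I ⊓ homogeneousSubmodule ι k m

/-- The space of quadrics vanishing on `C`, i.e. `H⁰(ℙ^N, I_C(2))`. -/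
def quadrics (C : Set (ι → k)) : Submodule k (MvPolynomial ι k) :=
  idealPiece k ι (vanIdeal k ι C) 2

/-- `a₂(C) = h⁰(ℙ^N, I_C(2))`, the number of linearly independent quadrics through `C`. -/
def a2 (C : Set (ι → k)) : ℕ := Module.finrank k (quadrics k ι C)

/-- The Hilbert function of `R/I` in degree `m`. -/
def idealHilb (I : Ideal (MvPolynomial ι k)) (m : ℕ) : ℕ :=
  Module.finrank k (homogeneousSubmodule ι k m) - Module.finrank k (idealPiece k ι I m)

/-- The Hilbert function of the homogeneous coordinate ring of `C`. -/
def hilb (C : Set (ι → k)) (m : ℕ) : ℕ := idealHilb k ι (vanIdeal k ι C) m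

/-- `C ⊆ ι → k` is the affine cone of an irreducible projective variety:
it is a Zariski-closed cone whose vanishing ideal is prime. -/
structure IsProjVariety (C : Set (ι → k)) : Prop where
  zero_mem : (0 : ι → k) ∈ C
  smul_mem : ∀ x ∈ C, ∀ t : k, t • x ∈ C
  closed : C = {x | ∀ f ∈ vanIdeal k ι C, MvPolynomial.eval x f = 0}
  prime : (vanIdeal k ι C).IsPrime

/-- Nondegenerate: no nonzero linear form vanishes identically on `C`. -/
def Nondeg (C : Set (ι → k)) : Prop :=
  ∀ f ∈ homogeneousSubmodule ι k 1, (∀ x ∈ C, MvPolynomial.eval x f = 0) → f = 0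

/-- The projective variety with cone `C` has dimension `n`
(so the affine cone has Krull dimension `n + 1`). -/
def HasDim (C : Set (ι → k)) (n : ℕ) : Prop :=
  ringKrullDim (MvPolynomial ι k ⧸ vanIdeal k ι C) = (n + 1 : ℕ)

/-- `C` (of projective dimension `n`) has degree `d`:
the Hilbert function satisfies `hF(m) · n! / mⁿ → d`. -/
def HasDegree (C : Set (ι → k)) (n d : ℕ) : Prop :=
  Filter.Tendsto (fun m : ℕ => (hilb k ι C m : ℝ) * (Nat.factorial n : ℝ) / (m : ℝ) ^ n)
    Filter.atTop (nhds (d : ℝ))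

/-- `Q(C)`: the common zero set (base locus) of all quadrics through `C`. -/
def quadZero (C : Set (ι → k)) : Set (ι → k) :=
  {x | ∀ f ∈ quadrics k ι C, MvPolynomial.eval x f = 0}

/-- `fs` is a regular sequence on `R/I`. -/
def IsRegSeqOn (I : Ideal (MvPolynomial ι k)) (fs : List (MvPolynomial ι k)) : Prop :=
  (∀ i : Fin fs.length, ∀ g : MvPolynomial ι k,
      fs.get i * g ∈ I ⊔ Ideal.span {h | ∃ j : Fin fs.length, j < i ∧ fs.get j = h} →
      g ∈ I ⊔ Ideal.span {h | ∃ j : Fin fs.length, j < i ∧ fs.get j = h}) ∧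
  I ⊔ Ideal.span {h | ∃ j : Fin fs.length, fs.get j = h} ≠ ⊤

/-- Arithmetic depth of the homogeneous coordinate ring of `C`: the supremum of lengths of
regular sequences of elements of the irrelevant maximal ideal. -/
def arithDepth (C : Set (ι → k)) : ℕ :=
  sSup {l : ℕ | ∃ fs : List (MvPolynomial ι k), fs.length = l ∧
    (∀ f ∈ fs, MvPolynomial.coeff 0 f = 0) ∧ IsRegSeqOn k ι (vanIdeal k ι C) fs}

/-- `Z` is an irreducible Zariski-closed cone. -/
def IsIrredClosed (Z : Set (ι → k)) : Prop :=
  Z = {x | ∀ f ∈ vanIdeal k ι Z, MvPolynomial.eval x f = 0} ∧ (vanIdeal k ι Z).IsPrime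

/-- `Z` is an irreducible component of `Q`: an irreducible closed subset of `Q`, maximal
among the irreducible closed subsets of `Q`. -/
def IsComponentOf (Z Q : Set (ι → k)) : Prop :=
  IsIrredClosed k ι Z ∧ Z ⊆ Q ∧
    ∀ Z' : Set (ι → k), IsIrredClosed k ι Z' → Z ⊆ Z' → Z' ⊆ Q → Z' = Z

/-- `C` is smooth away from the cone vertex, of codimension `c`: at each nonzero point the
Jacobian of the vanishing ideal has rank `c` (valid criterion in characteristic `0`). -/
def IsSmoothOfCodim (C : Set (ι → k)) (c : ℕ) : Prop :=
  ∀ x ∈ C, x ≠ (0 : ι → k) →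
    Module.finrank k (Submodule.span k
      {v : ι → k | ∃ f ∈ vanIdeal k ι C,
        v = fun i => MvPolynomial.eval x (MvPolynomial.pderiv i f)}) = c

/-- The projective variety with affine cone `C` is a cone (in the projective sense):
there is a vertex point `[v]` such that `C` is stable under the join with `[v]`. -/
def IsConeVariety (C : Set (ι → k)) : Prop :=
  ∃ v ∈ C, v ≠ 0 ∧ ∀ x ∈ C, ∀ s t : k, s • x + t • v ∈ C

/-- `C` (an `n`-dimensional variety of degree `d`) has sectional genus `g`: a general linear
curve section (cut by `n - 1` general hyperplanes) has Hilbert polynomial `d·m + 1 - g`. -/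
def SectionalGenus (n : ℕ) (C : Set (ι → k)) (d g : ℕ) : Prop :=
  ∃ P : MvPolynomial (Fin (n - 1) × ι) k, P ≠ 0 ∧
    ∀ w : Fin (n - 1) → ι → k, MvPolynomial.eval (fun q => w q.1 q.2) P ≠ 0 →
      ∀ᶠ m in Filter.atTop,
        (hilb k ι (C ∩ {x | ∀ j, ∑ i, w j i * x i = 0}) m : ℤ) = d * m + 1 - g

/-- `C` (an `n`-dimensional variety of degree `c + 3`) is a variety of maximal sectional
regularity: there is an `n`-dimensional linear subspace `F(X) = ℙ(L)` such that
`X ∩ F(X)` is (scheme-theoretically) a hypersurface of degree `4` in `F(X) ≅ ℙⁿ`,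
detected by the Hilbert function of the ideal sum. -/
def IsVMSR (n : ℕ) (C : Set (ι → k)) : Prop :=
  ∃ L : Submodule k (ι → k), Module.finrank k L = n + 1 ∧
    ∀ᶠ m in Filter.atTop,
      idealHilb k ι (vanIdeal k ι C ⊔ vanIdeal k ι (L : Set (ι → k))) m =
        Nat.choose (m + n) n - Nat.choose (m - 4 + n) n

end PaperQuadrics

namespace PaperQuadrics

variable {k : Type} [Field k]

/-- The parametrization of the rational normal scroll `S(a₀, …, aₙ)` (so the scroll has
dimension `n + 1`): homogeneous coordinates are indexed by `(i, j)`, `0 ≤ j ≤ aᵢ`,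
and the point of parameters `(s : t) ∈ ℙ¹`, `λ` has coordinates `λᵢ sʲ t^{aᵢ - j}`. -/
def scrollParam (n : ℕ) (a : Fin (n + 1) → ℕ) (s t : k) (lam : Fin (n + 1) → k) :
    ((i : Fin (n + 1)) × Fin (a i + 1)) → k :=
  fun x => lam x.1 * s ^ (x.2 : ℕ) * t ^ (a x.1 - (x.2 : ℕ))

/-- The affine cone of the scroll `S(a₀, …, aₙ) ⊆ ℙ^{n+1+c-1}`, `c = Σ aᵢ`. -/
def scrollCone (n : ℕ) (a : Fin (n + 1) → ℕ) :
    Set (((i : Fin (n + 1)) × Fin (a i + 1)) → k) :=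
  {v | ∃ s t lam, v = scrollParam n a s t lam}

/-- Global sections of `O_Y(A·H + b·F)` on the scroll `Y = S(a₀, …, aₙ)`, realized as
bihomogeneous polynomials in `s, t` (the `ℙ¹`-coordinates) and `T₀, …, Tₙ` (the fiber
coordinates): each monomial has total `T`-degree `A` and `(s,t)`-degree `b + Σ mᵢ aᵢ`. -/
def sectionSpace (k : Type) [Field k] (n : ℕ) (a : Fin (n + 1) → ℕ) (A b : ℤ) :
    Submodule k (MvPolynomial (Fin 2 ⊕ Fin (n + 1)) k) where
  carrier := {F | ∀ m ∈ F.support,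
    ((∑ i, m (Sum.inr i) : ℕ) : ℤ) = A ∧
    ((m (Sum.inl 0) + m (Sum.inl 1) : ℕ) : ℤ)
      = b + ∑ i, (m (Sum.inr i) : ℤ) * (a i : ℤ)}
  add_mem' := by
    intro p q hp hq m hm
    rcases Finset.mem_union.mp (MvPolynomial.support_add hm) with h | h
    · exact hp m h
    · exact hq m h
  zero_mem' := by
    intro m hm
    simp at hm
  smul_mem' := by
    intro c p hp m hm
    exact hp m (MvPolynomial.support_smul hm)

/-- The affine cone of the effective divisor `X ≡ A·H + b·F` on the scroll cut out by a
section `F`: the points of the scroll whose parameters are zeros of `F`. -/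
def divisorCone (n : ℕ) (a : Fin (n + 1) → ℕ)
    (F : MvPolynomial (Fin 2 ⊕ Fin (n + 1)) k) :
    Set (((i : Fin (n + 1)) × Fin (a i + 1)) → k) :=
  {v | ∃ s t lam, v = scrollParam n a s t lam ∧
     MvPolynomial.eval (Sum.elim (fun j : Fin 2 => if j = 0 then s else t) lam) F = 0}

end PaperQuadrics

open PaperQuadrics

namespace QuadricBound

set_option linter.unusedSectionVars false

open scoped Polynomial

/-- The family `w` is linearly independent over the polynomial ring `E[x]`. -/
def PolyIndep (E : Type) {L ι : Type} [Field E] [Field L] [Algebra E L] (x : L) (w : ι → L) :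
    Prop :=
  ∀ (s : Finset ι) (p : ι → E[X]), ∑ i ∈ s, Polynomial.aeval x (p i) * w i = 0 → ∀ i ∈ s, p i = 0

section Pencil

variable {E L M : Type} [Field E] [Field L] [Field M] [Algebra E L] [Algebra E M] [Algebra L M]
  [Algebra L[X] M] [IsFractionRing L[X] M] [IsScalarTower L L[X] M] [IsScalarTower E L M]

/-- The substitution of `(S, x + S y)` in polynomials in two variables. -/
def pencilEval (E : Type) {L : Type} [Field E] [Field L] [Algebra E L] (x y : L) :
    E[X][X] →+* L[X] :=
  Polynomial.eval₂RingHom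
    (Polynomial.aeval (R := E) (Polynomial.C x + Polynomial.X * Polynomial.C y)).toRingHom
    Polynomial.X

lemma pencilEval_X (x y : L) : pencilEval E x y Polynomial.X = Polynomial.X := by
  simp [pencilEval]

lemma pencilEval_C (x y : L) (p : E[X]) : pencilEval E x y (Polynomial.C p) =
    Polynomial.aeval (Polynomial.C x + Polynomial.X * Polynomial.C y) p := by
  simp [pencilEval]

lemma coeff_zero_pencilEval (x y : L) (P : E[X][X]) :
    (pencilEval E x y P).coeff 0 = Polynomial.aeval x (P.coeff 0) := by
  have h := Polynomial.divX_mul_X_add P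
  rw [← h, map_add, map_mul, pencilEval_X, pencilEval_C]
  simp only [Polynomial.coeff_add, Polynomial.mul_coeff_zero, Polynomial.coeff_X_zero, mul_zero,
    Polynomial.coeff_C_zero, zero_add]
  rw [Polynomial.coeff_zero_eq_eval_zero, Polynomial.aeval_def, Polynomial.aeval_def,
    ← Polynomial.coe_evalRingHom, Polynomial.hom_eval₂]
  congr 1
  · ext; simp [Polynomial.algebraMap_apply]
  · simp

lemma PolyIndep.pencil {ι : Type} {x : L} (y : L) {w : ι → L} (hw : PolyIndep E x w)
    (s : Finset ι) (P : ι → E[X][X])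
    (h : ∑ i ∈ s, pencilEval E x y (P i) * Polynomial.C (w i) = 0) : ∀ i ∈ s, P i = 0 := by
  have key : ∀ (k : ℕ) (P : ι → E[X][X]),
      ∑ i ∈ s, pencilEval E x y (P i) * Polynomial.C (w i) = 0 →
      ∀ i ∈ s, ∀ j < k, (P i).coeff j = 0 := by
    intro k
    induction k with
    | zero => intro P _ i _ j hj; omega
    | succ k ih =>
      intro P h
      have h0 : ∀ i ∈ s, (P i).coeff 0 = 0 := by
        apply hw s
        have := congrArg (fun q => Polynomial.coeff q 0) h
        simpa [Polynomial.finsetSum_coeff, Polynomial.mul_coeff_zero, coeff_zero_pencilEval]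
          using this
      have h1 : ∑ i ∈ s, pencilEval E x y ((P i).divX) * Polynomial.C (w i) = 0 := by
        have : Polynomial.X * ∑ i ∈ s, pencilEval E x y ((P i).divX) * Polynomial.C (w i) = 0 := by
          rw [← h, Finset.mul_sum]
          refine Finset.sum_congr rfl fun i hi => ?_
          conv_rhs => rw [← Polynomial.divX_mul_X_add (P i), h0 i hi]
          rw [map_add, map_mul, pencilEval_X]
          simp
          ring
        exact (mul_eq_zero.mp this).resolve_left Polynomial.X_ne_zero
      intro i hi j hj
      cases j with
      | zero => exact h0 i hi
      | succ j =>
        have := ih _ h1 i hi j (by omega)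
        rwa [Polynomial.coeff_divX] at this
  intro i hi
  ext1 j
  simpa using key (j + 1) P h i hi j (by omega)

variable (M) in
/-- The generic parameter of a pencil. -/
def par (L : Type) [Field L] [Algebra L[X] M] : M := algebraMap L[X] M Polynomial.X

variable (E M) in
/-- The field generated by the generic parameter `s` and by `x + s y`. -/
abbrev pencilField (x y : L) : IntermediateField E M :=
  IntermediateField.adjoin E {par M L, algebraMap L M x + par M L * algebraMap L M y}

lemma par_mem (x y : L) : par M L ∈ pencilField E M x y :=
  IntermediateField.subset_adjoin _ _ (by simp)

lemma pencil_mem (x y : L) :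
    algebraMap L M x + par M L * algebraMap L M y ∈ pencilField E M x y :=
  IntermediateField.subset_adjoin _ _ (by simp)

lemma algebraMap_C (a : L) : algebraMap L[X] M (Polynomial.C a) = algebraMap L M a :=
  (IsScalarTower.algebraMap_apply L L[X] M a).symm

lemma algebraMap_pencilEval_mem (x y : L) (P : E[X][X]) :
    algebraMap L[X] M (pencilEval E x y P) ∈
      Algebra.adjoin E {par M L, algebraMap L M x + par M L * algebraMap L M y} := by
  induction P using Polynomial.induction_on' with
  | add p q hp hq => rw [map_add, map_add]; exact add_mem hp hq
  | monomial n a =>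
    rw [← Polynomial.C_mul_X_pow_eq_monomial, map_mul, map_pow, pencilEval_X, map_mul, map_pow]
    refine mul_mem ?_ (pow_mem (Algebra.subset_adjoin (by simp [par])) _)
    rw [pencilEval_C]
    induction a using Polynomial.induction_on' with
    | add p q hp hq => rw [map_add, map_add]; exact add_mem hp hq
    | monomial n a =>
      rw [Polynomial.aeval_monomial, map_mul, map_pow]
      refine mul_mem ?_ (pow_mem (Algebra.subset_adjoin ?_) _)
      · rw [Polynomial.algebraMap_apply, algebraMap_C, ← IsScalarTower.algebraMap_apply]
        exact Subalgebra.algebraMap_mem _ _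
      · right
        simp [par, algebraMap_C, mul_comm (algebraMap L M y)]

lemma exists_pencilEval_of_mem_adjoin (x y : L) (a : M)
    (ha : a ∈ Algebra.adjoin E {par M L, algebraMap L M x + par M L * algebraMap L M y}) :
    ∃ P : E[X][X], algebraMap L[X] M (pencilEval E x y P) = a := by
  induction ha using Algebra.adjoin_induction with
  | mem a ha =>
    rcases ha with rfl | rfl
    · exact ⟨Polynomial.X, by rw [pencilEval_X, par]⟩
    · exact ⟨Polynomial.C Polynomial.X, by
      simp [pencilEval_C, algebraMap_C, par, mul_comm (algebraMap L M y)]⟩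
  | algebraMap r =>
    exact ⟨Polynomial.C (Polynomial.C r), by
      simp [pencilEval_C, Polynomial.algebraMap_apply, algebraMap_C,
        ← IsScalarTower.algebraMap_apply]⟩
  | add a b _ _ ha hb =>
    obtain ⟨P, rfl⟩ := ha
    obtain ⟨Q, rfl⟩ := hb
    exact ⟨P + Q, by simp⟩
  | mul a b _ _ ha hb =>
    obtain ⟨P, rfl⟩ := ha
    obtain ⟨Q, rfl⟩ := hb
    exact ⟨P * Q, by simp⟩

lemma exists_pencil_quotient (x y : L) (g : M) (hg : g ∈ pencilField E M x y) :
    ∃ P Q : E[X][X], algebraMap L[X] M (pencilEval E x y Q) ≠ 0 ∧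
      g * algebraMap L[X] M (pencilEval E x y Q) = algebraMap L[X] M (pencilEval E x y P) := by
  obtain ⟨a, ha, b, hb, rfl⟩ := IntermediateField.mem_adjoin_iff_div.mp hg
  obtain ⟨P, rfl⟩ := exists_pencilEval_of_mem_adjoin x y a ha
  obtain ⟨Q, rfl⟩ := exists_pencilEval_of_mem_adjoin x y b hb
  by_cases h : algebraMap L[X] M (pencilEval E x y Q) = 0
  · exact ⟨0, 1, by simp, by simp [h]⟩
  · exact ⟨P, Q, h, by field_simp⟩

lemma PolyIndep.linearIndependent {ι : Type} {x : L} (y : L) {w : ι → L} (hw : PolyIndep E x w) :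
    LinearIndependent (pencilField E M x y) (fun i => algebraMap L M (w i)) := by
  classical
  rw [linearIndependent_iff']
  intro s g hg i hi
  choose P Q hQ hPQ using fun i => exists_pencil_quotient x y (g i : M) (g i).2
  have h0 : ∑ i ∈ s, pencilEval E x y (P i * ∏ j ∈ s.erase i, Q j) * Polynomial.C (w i) = 0 := by
    apply IsFractionRing.injective L[X] M
    rw [map_zero, map_sum]
    have : (∏ j ∈ s, algebraMap L[X] M (pencilEval E x y (Q j))) *
      ∑ i ∈ s, g i • algebraMap L M (w i) = 0 := by rw [hg, mul_zero]
    rw [← this, Finset.mul_sum]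
    refine Finset.sum_congr rfl fun i hi => ?_
    rw [map_mul, map_mul, map_mul, algebraMap_C, ← hPQ, ← Finset.mul_prod_erase s _ hi, map_prod,
      map_prod, IntermediateField.smul_def, smul_eq_mul]
    ring
  have h1 := hw.pencil y s _ h0 i hi
  have h2 := hPQ i
  rcases mul_eq_zero.mp h1 with h | h
  · rw [h, map_zero, map_zero] at h2
    exact Subtype.ext ((mul_eq_zero.mp h2).resolve_right (hQ i))
  · obtain ⟨j, hj, hj0⟩ := Finset.prod_eq_zero_iff.mp h
    exact absurd (by rw [hj0, map_zero, map_zero]) (hQ j)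

end Pencil

section Lattice

variable {E L : Type} [Field E] [Field L] [Algebra E L] {n r : ℕ}

/-- Combinations of the `z i` with coefficients polynomials in the `u j`. -/
def comb (E : Type) {L : Type} [Field E] [Field L] [Algebra E L] {n r : ℕ}
    (u : Fin n → L) (z : Fin r → L) : (Fin r → MvPolynomial (Fin n) E) →ₗ[E] L where
  toFun p := ∑ i, aeval u (p i) * z i
  map_add' p q := by simp [add_mul, Finset.sum_add_distrib]
  map_smul' c p := by simp [Finset.smul_sum]

lemma comb_apply (u : Fin n → L) (z : Fin r → L) (p : Fin r → MvPolynomial (Fin n) E) :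
    comb E u z p = ∑ i, aeval u (p i) * z i := rfl

/-- Combinations of the `z i` with coefficients polynomials of degree at most `D` in the `u j`. -/
def lat (E : Type) {L : Type} [Field E] [Field L] [Algebra E L] {n r : ℕ}
    (u : Fin n → L) (z : Fin r → L) (D : ℕ) : Submodule E L :=
  (Submodule.pi Set.univ fun _ : Fin r => restrictTotalDegree (Fin n) E D).map (comb E u z)

lemma mem_lat {u : Fin n → L} {z : Fin r → L} {D : ℕ} {a : L} :
    a ∈ lat E u z D ↔ ∃ p : Fin r → MvPolynomial (Fin n) E,
      (∀ i, (p i).totalDegree ≤ D) ∧ comb E u z p = a := by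
  simp [lat, Submodule.mem_map, Submodule.mem_pi, mem_restrictTotalDegree]

lemma lat_mono {u : Fin n → L} {z : Fin r → L} {D D' : ℕ} (h : D ≤ D') :
    lat E u z D ≤ lat E u z D' := by
  intro a ha
  obtain ⟨p, hp, rfl⟩ := mem_lat.mp ha
  exact mem_lat.mpr ⟨p, fun i => (hp i).trans h, rfl⟩

lemma comb_pow_mul (u : Fin n → L) (z : Fin r → L) (p : Fin r → MvPolynomial (Fin n) E)
    (i : Fin n) (j : ℕ) : comb E u z (fun k => X i ^ j * p k) = u i ^ j * comb E u z p := by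
  simp [comb_apply, Finset.mul_sum, mul_assoc]

lemma mem_lat_of_pow_mul_mem {u : Fin n → L} {z : Fin r → L}
    (h : Function.Injective (comb E u z)) {D D' j : ℕ} {i : Fin n} {a : L}
    (ha : a ∈ lat E u z D') (ha' : u i ^ j * a ∈ lat E u z (j + D)) : a ∈ lat E u z D := by
  obtain ⟨p, -, rfl⟩ := mem_lat.mp ha
  obtain ⟨q, hq, hqp⟩ := mem_lat.mp ha'
  rw [← comb_pow_mul] at hqp
  obtain rfl := h hqp
  refine mem_lat.mpr ⟨p, fun k => ?_, rfl⟩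
  by_cases hk : p k = 0
  · simp [hk]
  have := hq k
  rw [totalDegree_mul_of_isDomain (pow_ne_zero _ (X_ne_zero i)) hk, totalDegree_X_pow] at this
  omega

instance (D : ℕ) : Module.Finite E
    (Submodule.pi Set.univ fun _ : Fin r => restrictTotalDegree (Fin n) E D) := by
  let f : (Fin r → restrictTotalDegree (Fin n) E D) →ₗ[E]
    (Fin r → MvPolynomial (Fin n) E) := LinearMap.pi fun i =>
      (restrictTotalDegree (Fin n) E D).subtype ∘ₗ LinearMap.proj i
  have : (Submodule.pi Set.univ fun _ : Fin r => restrictTotalDegree (Fin n) E D) =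
      LinearMap.range f := by
    ext p
    simp only [Submodule.mem_pi, Set.mem_univ, true_implies, LinearMap.mem_range]
    exact ⟨fun h => ⟨fun i => ⟨p i, h i⟩, rfl⟩, by rintro ⟨q, rfl⟩ i; exact (q i).2⟩
  rw [this]
  infer_instance

instance (u : Fin n → L) (z : Fin r → L) (D : ℕ) : Module.Finite E (lat E u z D) := by
  unfold lat; infer_instance

/-- The data of a finite-dimensional space `V` of functions, a Noether normalization `u` of the
algebra it generates and a maximal independent family `z` over the polynomials in `u`. -/
structure Normalized (V : Submodule E L) (u : Fin n → L) (z : Fin r → L) : Prop where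
  one_mem : 1 ∈ V
  mem : ∀ i, u i ∈ V
  finite : Module.Finite E V
  indep : Function.Injective (comb E u z)
  bounded : ∃ q : L, q ≠ 0 ∧ ∃ D, ∀ m, ∀ θ ∈ V ^ m, q * θ ∈ lat E u z (m + D)

lemma pow_le_pow_of_one_mem {V : Submodule E L} (h : 1 ∈ V) {i j : ℕ} (hij : i ≤ j) :
    V ^ i ≤ V ^ j :=
  pow_le_pow_right₀ (Submodule.one_le.mpr h) hij

lemma Normalized.mul_mem_lat {V : Submodule E L} {u : Fin n → L} {z : Fin r → L}
    (h : Normalized V u z) {q : L} {D : ℕ} (hq : ∀ m, ∀ θ ∈ V ^ m, q * θ ∈ lat E u z (m + D))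
    {θ : L} {N m j : ℕ} {i : Fin n} (hθ : θ ∈ V ^ N) (hθ' : u i ^ j * θ ∈ V ^ (j + m)) :
    q * θ ∈ lat E u z (m + D) := by
  refine mem_lat_of_pow_mul_mem h.indep (hq N θ hθ) (i := i) (j := j) ?_
  have := hq _ _ hθ'
  rwa [add_assoc, mul_left_comm] at this

end Lattice

section Descent

variable {E L : Type} [Field E] [Field L] [Algebra E L] {n r : ℕ}

/-- The products of the `z i` with the monomials in all the `u j` but the first. -/
def monFamily (E : Type) {L : Type} [Field E] [Field L] [Algebra E L] {n r : ℕ}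
    (u : Fin (n + 1) → L) (z : Fin r → L) : (Σ _ : Fin r, (Fin n →₀ ℕ)) → L :=
  fun a => aeval (Fin.tail u) (monomial a.2 (1 : E)) * z a.1

lemma coeff_coeff_finSuccEquiv (q : E[X]) (m m' : Fin n →₀ ℕ) (j : ℕ) :
    coeff m' ((finSuccEquiv E n (Polynomial.aeval (X 0) q *
      rename Fin.succ (monomial m 1))).coeff j) = if m = m' then q.coeff j else 0 := by
  have h1 : finSuccEquiv E n (Polynomial.aeval (X 0) q) =
      q.map (algebraMap E (MvPolynomial (Fin n) E)) := by
    have := (Polynomial.aeval_algHom_apply (finSuccEquiv E n).toAlgHom (X 0) q).symm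
    change finSuccEquiv E n _ = Polynomial.aeval (finSuccEquiv E n (X 0)) q at this
    rw [this, finSuccEquiv_X_zero, Polynomial.aeval_X_left_eq_map]
  have h2 : ∀ p : MvPolynomial (Fin n) E,
      finSuccEquiv E n (rename Fin.succ p) = Polynomial.C p := by
    intro p
    have : ((finSuccEquiv E n).toAlgHom.comp (rename Fin.succ)) =
        Polynomial.CAlgHom := by
      ext i
      simp [finSuccEquiv_X_succ]
    exact DFunLike.congr_fun this p
  rw [map_mul, h1, h2, Polynomial.coeff_mul_C, Polynomial.coeff_map, algebraMap_eq, coeff_C_mul,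
    coeff_monomial]
  simp

lemma polyIndep_monFamily {u : Fin (n + 1) → L} {z : Fin r → L}
    (h : Function.Injective (comb E u z)) : PolyIndep E (u 0) (monFamily E u z) := by
  classical
  intro s p hp a ha
  let P : Fin r → MvPolynomial (Fin (n + 1)) E := fun i => ∑ a ∈ s, if a.1 = i then
    Polynomial.aeval (X 0) (p a) * rename Fin.succ (monomial a.2 1) else 0
  have hP : P = 0 := by
    apply h
    rw [map_zero, ← hp, comb_apply]
    simp only [P, map_sum, Finset.sum_mul]
    rw [Finset.sum_comm]
    refine Finset.sum_congr rfl fun b _ => ?_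
    rw [Finset.sum_eq_single b.1]
    · have : (u ∘ Fin.succ) = Fin.tail u := rfl
      rw [if_pos rfl, map_mul, monFamily, ← mul_assoc, aeval_rename, this,
        ← Polynomial.aeval_algHom_apply, aeval_X]
    · intro i _ hi
      rw [if_neg (Ne.symm hi), map_zero, zero_mul]
    · simp
  ext j
  have := congrArg (fun q => MvPolynomial.coeff a.2 (Polynomial.coeff (finSuccEquiv E n q) j))
    (congrFun hP a.1)
  simp only [P, map_sum, Pi.zero_apply, map_zero, Polynomial.coeff_zero, coeff_zero,
    Polynomial.finsetSum_coeff, coeff_sum] at this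
  rw [Finset.sum_eq_single a] at this
  · rw [if_pos rfl, coeff_coeff_finSuccEquiv, if_pos rfl] at this
    rw [this, Polynomial.coeff_zero]
  · intro b _ hb
    by_cases h1 : b.1 = a.1
    · rw [if_pos h1, coeff_coeff_finSuccEquiv, if_neg]
      intro h2
      exact hb (Sigma.ext h1 (heq_of_eq h2))
    · rw [if_neg h1]
      simp
  · exact fun h => absurd ha h

end Descent

section ExtSpan

variable {E L M : Type} [Field E] [Field L] [Field M] [Algebra E L] [Algebra E M] [Algebra L M]
  [IsScalarTower E L M]

/-- The span, over an extension `K` of `E`, of the image of a space of functions. -/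
def extSpan (K : IntermediateField E M) (A : Submodule E L) : Submodule K M :=
  Submodule.span K (algebraMap L M '' A)

variable (K : IntermediateField E M)

lemma mem_extSpan {A : Submodule E L} {a : L} (h : a ∈ A) : algebraMap L M a ∈ extSpan K A :=
  Submodule.subset_span ⟨a, h, rfl⟩

lemma extSpan_span (s : Set L) :
    extSpan K (Submodule.span E s) = Submodule.span K (algebraMap L M '' s) := by
  apply le_antisymm
  · refine Submodule.span_le.mpr ?_
    rintro _ ⟨a, ha, rfl⟩
    induction ha using Submodule.span_induction with
    | mem a ha => exact Submodule.subset_span ⟨a, ha, rfl⟩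
    | zero => simp
    | add a b _ _ ha hb => rw [map_add]; exact add_mem ha hb
    | smul c a _ ha =>
      have : algebraMap L M (c • a) = (algebraMap E K c) • algebraMap L M a := by
        rw [Algebra.smul_def, map_mul, ← IsScalarTower.algebraMap_apply,
          IntermediateField.smul_def, smul_eq_mul]
        rfl
      rw [this]
      exact Submodule.smul_mem _ _ ha
  · exact Submodule.span_mono (Set.image_mono Submodule.subset_span)

lemma extSpan_mul (A B : Submodule E L) : extSpan K (A * B) = extSpan K A * extSpan K B := by
  rw [Submodule.mul_eq_span_mul_set, extSpan_span, extSpan, extSpan, Submodule.span_mul_span,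
    Set.image_mul]

lemma extSpan_one : extSpan K (1 : Submodule E L) = 1 := by
  rw [Submodule.one_eq_span, extSpan_span, Submodule.one_eq_span, Set.image_singleton, map_one]

lemma extSpan_pow (A : Submodule E L) (m : ℕ) : extSpan K (A ^ m) = extSpan K A ^ m := by
  induction m with
  | zero => rw [pow_zero, pow_zero, extSpan_one]
  | succ m ih => rw [pow_succ, pow_succ, extSpan_mul, ih]

lemma finite_extSpan (A : Submodule E L) [h : Module.Finite E A] :
    Module.Finite K (extSpan K A) := by
  rw [Module.Finite.iff_fg] at h ⊢
  obtain ⟨s, hs⟩ := h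
  classical
  refine ⟨s.image (algebraMap L M), ?_⟩
  rw [← hs, extSpan_span, Finset.coe_image]

end ExtSpan

lemma totalDegree_map_le {R S σ : Type} [Field R] [Field S] (f : R →+* S) (p : MvPolynomial σ R) :
    (map f p).totalDegree ≤ p.totalDegree :=
  Finset.sup_mono (support_map_subset f p)

lemma totalDegree_aeval_le {R σ τ : Type} [Field R] (f : σ → MvPolynomial τ R)
    (hf : ∀ i, (f i).totalDegree ≤ 1) (p : MvPolynomial σ R) :
    (aeval f p).totalDegree ≤ p.totalDegree := by
  rw [aeval_def, eval₂_eq]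
  refine (totalDegree_finsetSum _ _).trans (Finset.sup_le fun d hd => ?_)
  refine (totalDegree_mul _ _).trans ?_
  rw [algebraMap_eq, totalDegree_C, zero_add]
  refine le_trans (totalDegree_finsetProd _ _) (le_trans (Finset.sum_le_sum (g := d) fun i _ => ?_)
    (le_totalDegree hd))
  refine (totalDegree_pow _ _).trans ?_
  simpa using Nat.mul_le_mul_left (d i) (hf i)

section Descent

variable {E L M : Type} [Field E] [Field L] [Field M] [Algebra E L] [Algebra E M] [Algebra L M]
  [Algebra L[X] M] [IsFractionRing L[X] M] [IsScalarTower L L[X] M] [IsScalarTower E L M]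
  {n r : ℕ}

lemma injective_comb_pencil {u : Fin (n + 1) → L} {z : Fin r → L}
    (h : Function.Injective (comb E u z)) (y : L) :
    Function.Injective (comb (pencilField E M (u 0) y) (fun i => algebraMap L M (Fin.tail u i))
      (fun i => algebraMap L M (z i))) := by
  have hli := (polyIndep_monFamily h).linearIndependent (M := M) y
  rw [← LinearMap.ker_eq_bot, LinearMap.ker_eq_bot']
  intro p hp
  have hsum : ∑ a ∈ Finset.univ.sigma (fun i => (p i).support),
      coeff a.2 (p a.1) • algebraMap L M (monFamily E u z a) = 0 := by
    rw [← hp, comb_apply, Finset.sum_sigma]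
    refine Finset.sum_congr rfl fun i _ => ?_
    rw [aeval_def, eval₂_eq, Finset.sum_mul]
    refine Finset.sum_congr rfl fun m _ => ?_
    rw [monFamily, Algebra.smul_def, map_mul, ← mul_assoc, aeval_monomial, map_one, one_mul,
      Finsupp.prod, map_prod]
    simp
  ext i m
  by_cases hm : m ∈ (p i).support
  · simpa using linearIndependent_iff'.mp hli _ _ hsum ⟨i, m⟩ (by simpa using hm)
  · simpa using hm

lemma algebraMap_mem_lat_pencil {u : Fin (n + 1) → L} {z : Fin r → L}
    (Y : MvPolynomial (Fin n) E) (hY : Y.totalDegree ≤ 1) {D : ℕ} {a : L}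
    (ha : a ∈ lat E u z D) :
    algebraMap L M a ∈ lat (pencilField E M (u 0) (aeval (Fin.tail u) Y))
      (fun i => algebraMap L M (Fin.tail u i)) (fun i => algebraMap L M (z i)) D := by
  obtain ⟨p, hp, rfl⟩ := mem_lat.mp ha
  set y := aeval (Fin.tail u) Y
  set K := pencilField E M (u 0) y
  let s : K := ⟨par M L, par_mem _ _⟩
  let v : K := ⟨_, pencil_mem (u 0) y⟩
  let f : Fin (n + 1) → MvPolynomial (Fin n) K :=
    Fin.cons (C v - C s * map (algebraMap E K) Y) X
  have hf : ∀ i, (f i).totalDegree ≤ 1 := by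
    refine Fin.cases ?_ fun i => ?_
    · simp only [f, Fin.cons_zero]
      refine (totalDegree_sub _ _).trans (max_le (by simp) ((totalDegree_mul _ _).trans ?_))
      simpa using (totalDegree_map_le (algebraMap E K) Y).trans hY
    · simp [f]
  refine mem_lat.mpr ⟨fun i => aeval f (map (algebraMap E K) (p i)),
    fun i => (totalDegree_aeval_le f hf _).trans ((totalDegree_map_le _ _).trans (hp i)), ?_⟩
  rw [comb_apply, comb_apply, map_sum]
  refine Finset.sum_congr rfl fun i _ => ?_
  rw [map_mul]
  congr 1
  have hmap : ∀ (q : MvPolynomial (Fin n) E),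
      aeval (fun i => algebraMap L M (Fin.tail u i)) (map (algebraMap E K) q) =
      algebraMap L M (aeval (Fin.tail u) q) := by
    intro q
    rw [aeval_map_algebraMap, ← aeval_algebraMap_apply]; rfl
  have hc : ((aeval fun i => algebraMap L M (Fin.tail u i)).comp (aeval f) :
      MvPolynomial (Fin (n + 1)) K →ₐ[K] M) = aeval (fun i => algebraMap L M (u i)) := by
    ext i
    refine Fin.cases ?_ (fun i => ?_) i
    · simp only [AlgHom.comp_apply, aeval_X, f, Fin.cons_zero, map_sub, map_mul, hmap]
      simp only [aeval_C, IntermediateField.algebraMap_apply, v, s]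
      simp [y]
    · simp [f, Fin.tail]
  have := DFunLike.congr_fun hc (map (algebraMap E K) (p i))
  rw [AlgHom.comp_apply] at this
  rw [this, aeval_map_algebraMap, ← aeval_algebraMap_apply]
  rfl

lemma Normalized.pencil {V : Submodule E L} {u : Fin (n + 1) → L} {z : Fin r → L}
    (h : Normalized V u z) (Y : MvPolynomial (Fin n) E) (hY : Y.totalDegree ≤ 1) :
    Normalized (extSpan (pencilField E M (u 0) (aeval (Fin.tail u) Y)) V)
      (fun i => algebraMap L M (Fin.tail u i)) (fun i => algebraMap L M (z i)) where
  one_mem := by simpa using mem_extSpan (pencilField E M (u 0) (aeval (Fin.tail u) Y)) h.one_mem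
  mem i := mem_extSpan _ (h.mem i.succ)
  finite := have := h.finite; finite_extSpan _ _
  indep := injective_comb_pencil h.indep _
  bounded := by
    obtain ⟨q, hq, D, hD⟩ := h.bounded
    refine ⟨algebraMap L M q, by simpa using hq, D, fun m θ hθ => ?_⟩
    rw [← extSpan_pow] at hθ
    induction hθ using Submodule.span_induction with
    | mem θ h =>
      obtain ⟨a, ha, rfl⟩ := h
      rw [← map_mul]
      exact algebraMap_mem_lat_pencil Y hY (hD m a ha)
    | zero => simp
    | add a b _ _ ha hb => rw [mul_add]; exact add_mem ha hb
    | smul c a _ ha => rw [mul_smul_comm]; exact Submodule.smul_mem _ _ ha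

end Descent

/-- `E` is algebraically closed in `L`. -/
def RelClosed (E L : Type) [Field E] [Field L] [Algebra E L] : Prop :=
  ∀ a : L, IsAlgebraic E a → a ∈ Set.range (algebraMap E L)

section Colon

variable {E L : Type} [Field E] [Field L] [Algebra E L] {n r : ℕ}

lemma aeval_mem_pow {V : Submodule E L} (h1 : 1 ∈ V) {x : L} (hx : x ∈ V) (p : E[X]) :
    Polynomial.aeval x p ∈ V ^ p.natDegree := by
  rw [Polynomial.aeval_eq_sum_range]
  refine Submodule.sum_mem _ fun i hi => Submodule.smul_mem _ _ ?_
  exact pow_le_pow_of_one_mem h1 (Nat.lt_succ_iff.mp (Finset.mem_range.mp hi))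
    (Submodule.pow_mem_pow _ hx i)

lemma polyIndep_of_colon {ι : Type} {V : Submodule E L} (h1 : 1 ∈ V) {x : L} (hx : x ∈ V)
    (hx0 : x ≠ 0) {j : ℕ}
    (hcolon : ∀ N, ∀ φ ∈ V ^ N, x * φ ∈ V ^ (j + 1) → φ ∈ V ^ j) {b : ι → L}
    (hb : ∀ i, b i ∈ V ^ (j + 1))
    (hind : ∀ (s : Finset ι) (c : ι → E) (φ : L), φ ∈ V ^ j → ∑ i ∈ s, c i • b i = x * φ →
      ∀ i ∈ s, c i = 0) : PolyIndep E x b := by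
  intro s
  have key : ∀ (k : ℕ) (p : ι → E[X]), ∑ i ∈ s, Polynomial.aeval x (p i) * b i = 0 →
      ∀ i ∈ s, ∀ l < k, (p i).coeff l = 0 := by
    intro k
    induction k with
    | zero => intro p _ i _ l hl; omega
    | succ k ih =>
      intro p h
      set φ := ∑ i ∈ s, Polynomial.aeval x (p i).divX * b i with hφ
      have hsplit : ∑ i ∈ s, (p i).coeff 0 • b i = x * (-φ) := by
        rw [← sub_eq_zero, mul_neg, sub_neg_eq_add, ← h, hφ, Finset.mul_sum,
          ← Finset.sum_add_distrib]
        refine Finset.sum_congr rfl fun i _ => ?_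
        conv_rhs => rw [← Polynomial.divX_mul_X_add (p i)]
        rw [map_add, map_mul, Polynomial.aeval_X, Polynomial.aeval_C, Algebra.smul_def]
        ring
      have hφV : -φ ∈ V ^ j := by
        have hmem : ∃ N, -φ ∈ V ^ N := by
          refine ⟨(s.sup fun i => (p i).divX.natDegree) + (j + 1), neg_mem ?_⟩
          refine Submodule.sum_mem _ fun i hi => ?_
          rw [pow_add]
          refine Submodule.mul_mem_mul (pow_le_pow_of_one_mem h1 ?_ (aeval_mem_pow h1 hx _)) (hb i)
          exact Finset.le_sup (f := fun i => (p i).divX.natDegree) hi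
        obtain ⟨N, hN⟩ := hmem
        refine hcolon N _ hN ?_
        rw [← hsplit]
        exact Submodule.sum_mem _ fun i _ => Submodule.smul_mem _ _ (hb i)
      have h0 := hind s _ _ hφV hsplit
      have hφ0 : φ = 0 := by
        rw [Finset.sum_eq_zero (fun i hi => by rw [h0 i hi, zero_smul])] at hsplit
        simpa [hx0] using hsplit.symm
      intro i hi l hl
      cases l with
      | zero => exact h0 i hi
      | succ l =>
        have := ih _ hφ0 i hi l (by omega)
        rwa [Polynomial.coeff_divX] at this
  intro p hp i hi
  ext1 l
  simpa using key (l + 1) p hp i hi l (by omega)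

lemma exists_polyIndep_of_colon {V : Submodule E L} [Module.Finite E V] (h1 : 1 ∈ V) {x : L}
    (hx : x ∈ V) (hx0 : x ≠ 0) {j : ℕ}
    (hcolon : ∀ N, ∀ φ ∈ V ^ N, x * φ ∈ V ^ (j + 1) → φ ∈ V ^ j) :
    ∃ (d : ℕ) (b : Fin d → L), PolyIndep E x b ∧ (∀ i, b i ∈ V ^ (j + 1)) ∧
      Module.finrank E ↥(V ^ (j + 1)) ≤ d + Module.finrank E ↥(V ^ j) := by
  have hfin : ∀ i, Module.Finite E ↥(V ^ i) := fun i => by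
    rw [Module.Finite.iff_fg]
    exact Submodule.FG.pow (Module.Finite.iff_fg.mp inferInstance) i
  have := hfin (j + 1)
  have := hfin j
  set A := (V ^ j).map (LinearMap.mulLeft E x) with hA
  have hAV : A ≤ V ^ (j + 1) := by
    rw [hA, Submodule.map_le_iff_le_comap]
    intro a ha
    rw [Submodule.mem_comap, LinearMap.mulLeft_apply, pow_succ']
    exact Submodule.mul_mem_mul hx ha
  obtain ⟨B', hB'⟩ := Submodule.exists_isCompl A
  set B := B' ⊓ V ^ (j + 1)
  have hsup : A ⊔ B = V ^ (j + 1) := by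
    rw [← sup_inf_assoc_of_le B' hAV, hB'.sup_eq_top, top_inf_eq]
  have hdisj : Disjoint A B := hB'.disjoint.mono_right inf_le_left
  have hBfin : Module.Finite E B := Submodule.finiteDimensional_of_le inf_le_right
  have hAfin : Module.Finite E A := Submodule.finiteDimensional_of_le hAV
  refine ⟨Module.finrank E B, fun i => (Module.finBasis E B i : L), ?_,
    fun i => (inf_le_right : B ≤ _) (Module.finBasis E B i).2, ?_⟩
  · refine polyIndep_of_colon h1 hx hx0 hcolon
      (fun i => (inf_le_right : B ≤ _) (Module.finBasis E B i).2) ?_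
    intro s c φ hφ hs
    have h0 : ∑ i ∈ s, c i • (Module.finBasis E B i : L) = 0 := by
      refine Submodule.disjoint_def.mp hdisj _ ?_ ?_
      · rw [hs]; exact ⟨φ, hφ, rfl⟩
      · exact Submodule.sum_mem _ fun i _ => Submodule.smul_mem _ _ (Module.finBasis E B i).2
    have h0' : ∑ i ∈ s, c i • Module.finBasis E B i = 0 := by
      apply Subtype.ext
      simpa using h0
    exact linearIndependent_iff'.mp (Module.finBasis E B).linearIndependent s c h0'
  · have h2 := Submodule.finrank_sup_add_finrank_inf_eq A B
    rw [hdisj.eq_bot, finrank_bot, hsup] at h2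
    have h3 : Module.finrank E A ≤ Module.finrank E ↥(V ^ j) := Submodule.finrank_map_le _ _
    omega

lemma Normalized.ne_zero {V : Submodule E L} {u : Fin n → L} {z : Fin r → L}
    (h : Normalized V u z) : 0 < r := by
  rcases Nat.eq_zero_or_pos r with rfl | hr
  · obtain ⟨q, hq, D, hD⟩ := h.bounded
    obtain ⟨p, -, hp⟩ := mem_lat.mp (hD 0 1 (by simp))
    simp [comb_apply] at hp
    exact absurd hp.symm hq
  · exact hr

lemma Normalized.algebraicIndependent {V : Submodule E L} {u : Fin n → L} {z : Fin r → L}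
    (h : Normalized V u z) : AlgebraicIndependent E u := by
  rw [algebraicIndependent_iff]
  intro p hp
  have : (fun _ : Fin r => p) = 0 := h.indep (by simp [comb_apply, hp])
  exact congrFun this ⟨0, h.ne_zero⟩

lemma Normalized.mem_one_of_mul_mem {V : Submodule E L} {u : Fin n → L} {z : Fin r → L}
    (h : Normalized V u z) (hcl : RelClosed E L) {i : Fin n} {N : ℕ} {φ : L} (hφ : φ ∈ V ^ N)
    (hφ' : u i * φ ∈ V) : φ ∈ (1 : Submodule E L) := by
  obtain ⟨q, hq, D, hD⟩ := h.bounded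
  have hmem : ∀ l, q * φ ^ l ∈ lat E u z D := by
    intro l
    have h1 : φ ^ l ∈ V ^ (N * l) := by rw [pow_mul]; exact Submodule.pow_mem_pow _ hφ l
    have h2 : u i ^ l * φ ^ l ∈ V ^ (l + 0) := by
      rw [← mul_pow]; exact Submodule.pow_mem_pow _ hφ' l
    simpa using h.mul_mem_lat hD h1 h2
  by_contra hcon
  have htr : Transcendental E φ := by
    intro halg
    obtain ⟨e, he⟩ := hcl φ halg
    exact hcon (Submodule.mem_one.mpr ⟨e, he⟩)
  have hli : LinearIndependent E (fun l : ℕ => φ ^ l) := by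
    have := (Polynomial.basisMonomials E).linearIndependent.map' (Polynomial.aeval φ).toLinearMap
      (LinearMap.ker_eq_bot.mpr (transcendental_iff_injective.mp htr))
    have heq : (fun l : ℕ => φ ^ l) =
        (Polynomial.aeval φ).toLinearMap ∘ Polynomial.basisMonomials E := by
      ext l
      simp [Polynomial.aeval_monomial]
    rw [heq]
    exact this
  have hli2 : LinearIndependent E (fun l : ℕ => (⟨q * φ ^ l, hmem l⟩ : lat E u z D)) := by
    apply LinearIndependent.of_comp (lat E u z D).subtype
    exact hli.map' (LinearMap.mulLeft E q)
      (LinearMap.ker_eq_bot.mpr (mul_right_injective₀ hq))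
  have := hli2.finite
  exact not_finite ℕ

end Colon

section Square

variable {E L M : Type} [Field E] [Field L] [Field M] [Algebra E L] [Algebra E M] [Algebra L M]
  [Algebra L[X] M] [IsFractionRing L[X] M] [IsScalarTower L L[X] M] [IsScalarTower E L M]

lemma coeff_mul_mem {A B : Submodule E L} {p q : L[X]} (hp : ∀ i, p.coeff i ∈ A)
    (hq : ∀ i, q.coeff i ∈ B) (i : ℕ) : (p * q).coeff i ∈ A * B := by
  rw [Polynomial.coeff_mul]
  exact Submodule.sum_mem _ fun k _ => Submodule.mul_mem_mul (hp _) (hq _)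

lemma coeff_linear_pow_mem {V : Submodule E L} {x y : L} (hx : x ∈ V) (hy : y ∈ V) (j i : ℕ) :
    ((Polynomial.C x + Polynomial.X * Polynomial.C y) ^ j).coeff i ∈ V ^ j := by
  induction j generalizing i with
  | zero =>
    rw [pow_zero, pow_zero, Polynomial.coeff_one]
    split_ifs
    · exact Submodule.one_le.mp le_rfl
    · exact zero_mem _
  | succ j ih =>
    rw [pow_succ, pow_succ]
    refine coeff_mul_mem ih (fun i => ?_) i
    rcases i with _ | _ | i
    · simpa using hx
    · simpa using hy
    · simp

lemma PolyIndep.of_transcendental {x : L} (hx : Transcendental E x) :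
    PolyIndep E x (fun _ : Unit => (1 : L)) := by
  intro s p h i hi
  have : s = {i} := by ext; simpa using hi
  rw [this, Finset.sum_singleton, mul_one] at h
  exact transcendental_iff.mp hx _ h

lemma pencilEval_injective {x : L} (hx : Transcendental E x) (y : L) :
    Function.Injective (pencilEval E x y) := by
  rw [injective_iff_map_eq_zero]
  intro P hP
  exact (PolyIndep.of_transcendental hx).pencil y {()} (fun _ => P) (by simp [hP]) () (by simp)

lemma sum_le_finrank_sq {ι : Type} [Fintype ι] {V : Submodule E L} [Module.Finite E V]
    (h1 : 1 ∈ V) {x y : L} (hx : x ∈ V) (hy : y ∈ V) (htr : Transcendental E x)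
    (w : ι → L) (δ : ι → ℕ) (hδ : ∀ i, δ i ≤ 2) (hw : ∀ i, w i ∈ V ^ (2 - δ i))
    (hli : LinearIndependent (pencilField E M x y) (fun i => algebraMap L M (w i))) :
    ∑ i, (δ i + 1) ≤ Module.finrank E ↥(V ^ 2) := by
  classical
  have hfin : Module.Finite E ↥(V ^ 2) := by
    rw [Module.Finite.iff_fg]
    exact Submodule.FG.pow (Module.Finite.iff_fg.mp inferInstance) 2
  have key : ∀ J : ℕ, (∑ i, (δ i + 1)) * (J + 1) ≤ (J + 3) * Module.finrank E ↥(V ^ 2) := by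
    intro J
    let τ : (Fin (J + 3) → ↥(V ^ 2)) →ₗ[E] L[X] := ∑ a : Fin (J + 3),
      ((Polynomial.monomial (a : ℕ)).restrictScalars E ∘ₗ (V ^ 2).subtype) ∘ₗ LinearMap.proj a
    have hτ : ∀ c, τ c = ∑ a : Fin (J + 3), Polynomial.monomial (a : ℕ) (c a : L) := fun c => by
      simp [τ]
    let F : ((Σ i, Fin (δ i + 1)) × Fin (J + 1)) → L[X] := fun t =>
      pencilEval E x y (Polynomial.monomial (t.2 : ℕ) (Polynomial.monomial (t.1.2 : ℕ) 1)) *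
        Polynomial.C (w t.1.1)
    have hFdef : ∀ t, F t = (Polynomial.C x + Polynomial.X * Polynomial.C y) ^ (t.1.2 : ℕ) *
        Polynomial.C (w t.1.1) * Polynomial.X ^ (t.2 : ℕ) := by
      intro t
      simp only [F]
      rw [← Polynomial.C_mul_X_pow_eq_monomial (n := (t.2 : ℕ)), map_mul, map_pow, pencilEval_X,
        pencilEval_C, Polynomial.aeval_monomial]
      simp only [map_one, one_mul]
      ring
    have hF : ∀ t, F t ∈ LinearMap.range τ := by
      intro t
      have hδt := hδ t.1.1
      have hjt := t.1.2.2
      have hat := t.2.2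
      have hcoef : ∀ a, (F t).coeff a ∈ V ^ 2 := by
        intro a
        rw [hFdef, Polynomial.coeff_mul_X_pow', Polynomial.coeff_mul_C]
        split_ifs
        · have h2 : V ^ 2 = V ^ (δ t.1.1) * V ^ (2 - δ t.1.1) := by
            rw [← pow_add]; congr 1; omega
          rw [h2]
          refine Submodule.mul_mem_mul ?_ (hw _)
          exact pow_le_pow_of_one_mem h1 (Nat.lt_succ_iff.mp hjt) (coeff_linear_pow_mem hx hy _ _)
        · exact zero_mem _
      have hdeg : (F t).natDegree < J + 3 := by
        rw [hFdef]
        have h1 : (Polynomial.C x + Polynomial.X * Polynomial.C y).natDegree ≤ 1 := by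
          compute_degree
        have h2 := Polynomial.natDegree_pow_le_of_le (t.1.2 : ℕ) h1
        have h3 := (Polynomial.natDegree_mul_C_le
          ((Polynomial.C x + Polynomial.X * Polynomial.C y) ^ (t.1.2 : ℕ)) (w t.1.1)).trans h2
        have h4 := Polynomial.natDegree_mul_le_of_le h3
          (Polynomial.natDegree_X_pow_le (R := L) (t.2 : ℕ))
        omega
      refine ⟨fun a => ⟨(F t).coeff a, hcoef a⟩, ?_⟩
      rw [hτ]
      conv_rhs => rw [Polynomial.as_sum_range' (F t) (J + 3) hdeg]
      rw [Finset.sum_range]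
    have hind : LinearIndependent E F := by
      rw [Fintype.linearIndependent_iff]
      intro g hg
      let P : ι → E[X][X] := fun i => ∑ j : Fin (δ i + 1), ∑ a : Fin (J + 1),
        Polynomial.monomial (a : ℕ) (Polynomial.monomial (j : ℕ) (g (⟨i, j⟩, a)))
      have hP : ∑ i, pencilEval E x y (P i) * Polynomial.C (w i) = 0 := by
        rw [← hg, Fintype.sum_prod_type, Fintype.sum_sigma]
        refine Finset.sum_congr rfl fun i _ => ?_
        simp only [P, map_sum, Finset.sum_mul]
        refine Finset.sum_congr rfl fun j _ => Finset.sum_congr rfl fun a _ => ?_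
        simp only [F]
        have h1 : (Polynomial.monomial (a : ℕ) (Polynomial.monomial (j : ℕ) (g (⟨i, j⟩, a)))) =
          Polynomial.C (Polynomial.C (g (⟨i, j⟩, a))) *
            Polynomial.monomial (a : ℕ) (Polynomial.monomial (j : ℕ) 1) := by
          rw [Polynomial.C_mul_monomial, Polynomial.C_mul_monomial, mul_one]
        rw [h1, map_mul, pencilEval_C, Polynomial.aeval_C, Algebra.smul_def, mul_assoc]
      have hz := Fintype.linearIndependent_iff.mp hli
        (fun i => ⟨algebraMap L[X] M (pencilEval E x y (P i)),
          IntermediateField.algebra_adjoin_le_adjoin _ _ (algebraMap_pencilEval_mem x y (P i))⟩) (by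
            have := congrArg (algebraMap L[X] M) hP
            rw [map_sum, map_zero] at this
            rw [← this]
            refine Finset.sum_congr rfl fun i _ => ?_
            rw [map_mul, algebraMap_C, IntermediateField.smul_def, smul_eq_mul])
      rintro ⟨⟨i, j⟩, a⟩
      have h0 : P i = 0 := by
        apply pencilEval_injective htr y
        rw [map_zero]
        apply IsFractionRing.injective L[X] M
        rw [map_zero]
        exact congrArg Subtype.val (hz i)
      have := congrArg (fun Q => (Polynomial.coeff Q (a : ℕ)).coeff (j : ℕ)) h0
      simpa [P, Polynomial.finsetSum_coeff, Polynomial.coeff_monomial, Fin.val_inj, ite_apply,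
        apply_ite] using this
    have hli' : LinearIndependent E (fun t => (⟨F t, hF t⟩ : LinearMap.range τ)) :=
      LinearIndependent.of_comp (LinearMap.range τ).subtype hind
    have h1 := hli'.fintype_card_le_finrank
    have h2 := LinearMap.finrank_range_le τ
    rw [Module.finrank_pi_fintype] at h2
    simp at h1 h2
    simp
    omega
  have := key (2 * Module.finrank E ↥(V ^ 2))
  by_contra! hcon
  nlinarith

lemma finrank_extSpan_sq_le {V : Submodule E L} [Module.Finite E V]
    (h1 : 1 ∈ V) {x y : L} (hx : x ∈ V) (hy : y ∈ V) (htr : Transcendental E x) :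
    Module.finrank (pencilField E M x y) ↥(extSpan (pencilField E M x y) V ^ 2) +
      Module.finrank (pencilField E M x y) (extSpan (pencilField E M x y) V) + 1 ≤
      Module.finrank E ↥(V ^ 2) := by
  classical
  set K := pencilField E M x y
  have hV : V ≤ V ^ 2 := by
    simpa using pow_le_pow_of_one_mem h1 (show 1 ≤ 2 by norm_num)
  have hfin : Module.Finite E ↥(V ^ 2) := by
    rw [Module.Finite.iff_fg]
    exact Submodule.FG.pow (Module.Finite.iff_fg.mp inferInstance) 2
  obtain ⟨b₁, hb₁V, hb₁, hb₁s, hb₁i⟩ := exists_linearIndepOn_id_extension (K := K)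
    (s := {(1 : M)}) (t := algebraMap L M '' V) (LinearIndepOn.singleton one_ne_zero)
    (by simpa using h1)
  obtain ⟨b₂, hb₂V, hb₂, hb₂s, hb₂i⟩ := exists_linearIndepOn_id_extension (K := K)
    (s := b₁) (t := algebraMap L M '' (V ^ 2 : Submodule E L)) hb₁i
    (hb₁V.trans (Set.image_mono hV))
  have e₁ : extSpan K V = Submodule.span K b₁ :=
    le_antisymm (Submodule.span_le.mpr hb₁s) (Submodule.span_mono hb₁V)
  have e₂ : extSpan K V ^ 2 = Submodule.span K b₂ := by
    rw [← extSpan_pow]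
    exact le_antisymm (Submodule.span_le.mpr hb₂s) (Submodule.span_mono hb₂V)
  have f₂ : b₂.Finite := by
    have : Module.Finite K (Submodule.span K b₂) := by
      rw [← e₂, ← extSpan_pow]; exact finite_extSpan K _
    have hli : LinearIndependent K
        (fun i : b₂ => (⟨i, Submodule.subset_span i.2⟩ : Submodule.span K b₂)) :=
      LinearIndependent.of_comp (Submodule.span K b₂).subtype hb₂i
    exact Set.finite_coe_iff.mp hli.finite
  have : Fintype b₂ := f₂.fintype
  have : Fintype b₁ := (f₂.subset hb₂).fintype
  rw [e₂, e₁, finrank_span_set_eq_card hb₁i, finrank_span_set_eq_card hb₂i]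
  choose w hw hwb using fun i : b₂ => hb₂V i.2
  have h1b : (1 : M) ∈ b₁ := hb₁ rfl
  have hle := sum_le_finrank_sq (M := M) h1 hx hy htr w
    (fun i => (if (i : M) ∈ b₁ then 1 else 0) + if (i : M) = 1 then 1 else 0)
    (fun i => by split_ifs <;> norm_num) (fun i => by
      by_cases hi1 : (i : M) = 1
      · have : w i = 1 := by
          apply (algebraMap L M).injective
          rw [hwb, hi1, map_one]
        simp [hi1, h1b, this]
      by_cases hi : (i : M) ∈ b₁
      · obtain ⟨a, ha, hai⟩ := hb₁V hi
        have : w i = a := by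
          apply (algebraMap L M).injective
          rw [hwb, hai]
        simpa [hi1, hi, this] using ha
      · simpa [hi1, hi] using hw i) (by
      simp only [hwb]
      exact hb₂i)
  refine le_trans (le_of_eq ?_) hle
  rw [Finset.sum_add_distrib, Finset.sum_add_distrib, Finset.sum_boole, Finset.sum_boole]
  have c1 : (Finset.univ.filter fun i : b₂ => (i : M) ∈ b₁).card = b₁.toFinset.card := by
    refine Finset.card_bij (fun i _ => i) (by simp) (fun _ _ _ _ h => Subtype.ext h) ?_
    intro a ha
    exact ⟨⟨a, hb₂ (by simpa using ha)⟩, by simpa using ha, rfl⟩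
  have c2 : (Finset.univ.filter fun i : b₂ => (i : M) = 1).card = 1 := by
    rw [Finset.card_eq_one]
    exact ⟨⟨1, hb₂ h1b⟩, by ext i; simp [Subtype.ext_iff]⟩
  rw [c1, c2, Set.toFinset_card, Set.toFinset_card]
  simp
  ring

end Square

section Etale

lemma formallyEtale_of_isAlgebraic (P Z : Type) [CommRing P] [IsDomain P] [CharZero P] [Field Z]
    [Algebra P Z] [FaithfulSMul P Z] [Algebra.IsAlgebraic P Z] : Algebra.FormallyEtale P Z := by
  let : Algebra (FractionRing P) Z := FractionRing.liftAlgebra P Z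
  have : IsScalarTower P (FractionRing P) Z := FractionRing.isScalarTower_liftAlgebra P Z
  have : Algebra.IsAlgebraic (FractionRing P) Z := Algebra.IsAlgebraic.extendScalars
    (IsFractionRing.injective P (FractionRing P))
  have : CharZero (FractionRing P) := charZero_of_injective_algebraMap
    (IsFractionRing.injective P (FractionRing P))
  have : Algebra.FormallyEtale P (FractionRing P) :=
    Algebra.FormallyEtale.of_isLocalization (nonZeroDivisors P)
  have : Algebra.FormallyEtale (FractionRing P) Z := Algebra.FormallyEtale.of_isSeparable _ _
  exact Algebra.FormallyEtale.comp P (FractionRing P) Z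

variable {E P Z N : Type} [CommRing E] [CommRing P] [CommRing Z] [Algebra E P] [Algebra E Z]
  [Algebra P Z] [IsScalarTower E P Z] [AddCommGroup N] [Module Z N] [Module P N] [Module E N]
  [IsScalarTower P Z N] [IsScalarTower E P N] [IsScalarTower E Z N]

lemma exists_derivation_extension [Algebra.FormallyEtale P Z] (d : Derivation E P N) :
    ∃ d' : Derivation E Z N, ∀ p, d' (algebraMap P Z p) = d p := by
  let f : Ω[Z⁄E] →ₗ[Z] N := (LinearMap.liftBaseChange Z d.liftKaehlerDifferential) ∘ₗ
    (KaehlerDifferential.tensorKaehlerEquivOfFormallyEtale E P Z).symm.toLinearMap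
  refine ⟨f.compDer (KaehlerDifferential.D E Z), fun p => ?_⟩
  simp [f, KaehlerDifferential.tensorKaehlerEquivOfFormallyEtale_symm_D_algebraMap]

lemma derivation_eq_of_restrict [Algebra.FormallyEtale P Z] (d₁ d₂ : Derivation E Z N)
    (h : ∀ p, d₁ (algebraMap P Z p) = d₂ (algebraMap P Z p)) : d₁ = d₂ := by
  let d : Derivation P Z N := Derivation.mk'
    { toFun := fun a => d₁ a - d₂ a
      map_add' := fun a b => by simp; abel
      map_smul' := fun p a => by
        rw [Algebra.smul_def, Derivation.leibniz, Derivation.leibniz, h, RingHom.id_apply,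
          algebraMap_smul, algebraMap_smul]
        rw [smul_sub]
        abel }
    (fun a b => by simp [smul_sub]; abel)
  have : d = 0 := by
    rw [← d.liftKaehlerDifferential_comp, Subsingleton.elim d.liftKaehlerDifferential 0]
    ext; simp
  ext a
  have := DFunLike.congr_fun this a
  exact sub_eq_zero.mp this

end Etale

lemma isAlgebraic_exchange {E Z : Type} [Field E] [Field Z] [Algebra E Z] {S : Set Z} {a b : Z}
    (hb : IsAlgebraic (Algebra.adjoin E (insert a S)) b)
    (hb' : ¬ IsAlgebraic (Algebra.adjoin E S) b) :
    IsAlgebraic (Algebra.adjoin E (insert b S)) a := by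
  have key : ∀ (T : Set Z) (c : Z), c ∈ (AlgebraicIndependent.matroid E Z).closure T ↔
      IsAlgebraic (Algebra.adjoin E T) c := by
    intro T c
    rw [AlgebraicIndependent.matroid_closure_eq]
    exact Iff.rfl
  rw [← key] at hb hb' ⊢
  exact (Matroid.closure_exchange ⟨hb, hb'⟩).1

section Partial

variable {E Z M : Type} [Field E] [CharZero E] [Field Z] [Field M] [Algebra E Z] [Algebra E M]
  [Algebra Z M] [IsScalarTower E Z M]

lemma exists_partial_derivation {s v : Z} {y : M} (D : Derivation E M M)
    (hind : AlgebraicIndependent E ![algebraMap Z M s, algebraMap Z M v])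
    (halg : ∀ θ : Z, IsAlgebraic (Algebra.adjoin E {algebraMap Z M s, algebraMap Z M v})
      (algebraMap Z M θ))
    (hs : D (algebraMap Z M s) = 1) (hv : D (algebraMap Z M v) = y) (hy : D y = 0)
    (hty : Transcendental Z y) :
    ∃ d : Derivation E Z Z, d s = 0 ∧ d v = 1 ∧
      ∀ m θ, D^[m] (algebraMap Z M θ) = 0 → d^[m] θ = 0 := by
  let : Algebra (MvPolynomial (Fin 2) E) Z := (aeval ![s, v] : _ →ₐ[E] Z).toAlgebra
  have hmap : ∀ p, algebraMap (MvPolynomial (Fin 2) E) Z p = aeval ![s, v] p := fun _ => rfl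
  have : IsScalarTower E (MvPolynomial (Fin 2) E) Z := IsScalarTower.of_algHom (aeval ![s, v])
  have hfun : ![algebraMap Z M s, algebraMap Z M v] = algebraMap Z M ∘ ![s, v] := by
    ext i
    fin_cases i <;> rfl
  have hmapM : ∀ p : MvPolynomial (Fin 2) E, aeval ![algebraMap Z M s, algebraMap Z M v] p =
      algebraMap Z M (aeval ![s, v] p) := by
    intro p
    rw [hfun]
    exact aeval_algebraMap_apply M ![s, v] p
  have : FaithfulSMul (MvPolynomial (Fin 2) E) Z := by
    rw [faithfulSMul_iff_algebraMap_injective]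
    intro p q hpq
    refine hind (?_ : aeval ![algebraMap Z M s, algebraMap Z M v] p = aeval _ q)
    rw [hmapM, hmapM]
    exact congrArg (algebraMap Z M) hpq
  have : Algebra.IsAlgebraic (MvPolynomial (Fin 2) E) Z := by
    refine ⟨fun a => ?_⟩
    have h1 := halg a
    rw [show ({algebraMap Z M s, algebraMap Z M v} : Set M) =
      Set.range ![algebraMap Z M s, algebraMap Z M v] by
        simp [Matrix.range_cons, Set.pair_comm]] at h1
    obtain ⟨p, hp, hpa⟩ := h1
    refine ⟨p.map (hind.aevalEquiv.symm : _ →+* MvPolynomial (Fin 2) E), ?_, ?_⟩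
    · rwa [Ne, Polynomial.map_eq_zero_iff hind.aevalEquiv.symm.injective]
    · apply (algebraMap Z M).injective
      rw [map_zero, Polynomial.aeval_def, Polynomial.eval₂_map, Polynomial.hom_eval₂, ← hpa,
        Polynomial.aeval_def]
      congr 1
      ext q
      have := hind.algebraMap_aevalEquiv (hind.aevalEquiv.symm q)
      rw [AlgEquiv.apply_symm_apply, hmapM] at this
      exact this.symm
  have := formallyEtale_of_isAlgebraic (MvPolynomial (Fin 2) E) Z
  obtain ⟨d₁, h₁⟩ := exists_derivation_extension (E := E) (P := MvPolynomial (Fin 2) E) (Z := Z)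
    (N := Z) (mkDerivation E ![1, 0])
  obtain ⟨d₂, h₂⟩ := exists_derivation_extension (E := E) (P := MvPolynomial (Fin 2) E) (Z := Z)
    (N := Z) (mkDerivation E ![0, 1])
  have hs1 : d₁ s = 1 := by simpa [hmap] using h₁ (X 0)
  have hv1 : d₁ v = 0 := by simpa [hmap] using h₁ (X 1)
  have hs2 : d₂ s = 0 := by simpa [hmap] using h₂ (X 0)
  have hv2 : d₂ v = 1 := by simpa [hmap] using h₂ (X 1)
  have hD : ∀ θ : Z, D (algebraMap Z M θ) =
      algebraMap Z M (d₁ θ) + algebraMap Z M (d₂ θ) * y := by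
    let : Module (MvPolynomial (Fin 2) E) M := Module.compHom M (algebraMap _ Z)
    have : IsScalarTower (MvPolynomial (Fin 2) E) Z M := ⟨fun p z m => by
      rw [Algebra.smul_def p z, mul_smul]; rfl⟩
    have : IsScalarTower E (MvPolynomial (Fin 2) E) M := ⟨fun p z m => by
      change algebraMap _ Z (p • z) • m = p • (algebraMap _ Z z • m)
      rw [Algebra.smul_def p z, map_mul, mul_smul, ← IsScalarTower.algebraMap_apply,
        algebraMap_smul]⟩
    have h := derivation_eq_of_restrict (P := MvPolynomial (Fin 2) E) (D.compAlgebraMap Z)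
      ((Algebra.linearMap Z M).compDer d₁ + y • (Algebra.linearMap Z M).compDer d₂) ?_
    · intro θ
      have := DFunLike.congr_fun h θ
      simpa [mul_comm y] using this
    · intro p
      refine Derivation.eqOn_adjoin (s := Set.range ![s, v]) ?_ ?_
      · rintro _ ⟨i, rfl⟩
        fin_cases i <;> simp [hs, hv, hs1, hv1, hs2, hv2]
      · rw [hmap, Algebra.adjoin_range_eq_range_aeval]
        exact ⟨p, rfl⟩
  refine ⟨d₂, hs2, hv2, fun m θ hm => ?_⟩
  have key : ∀ m, ∃ c : ℕ → Z, D^[m] (algebraMap Z M θ) =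
      ∑ i ∈ Finset.range (m + 1), algebraMap Z M (c i) * y ^ i ∧ c m = d₂^[m] θ := by
    intro m
    induction m with
    | zero => exact ⟨fun _ => θ, by simp, rfl⟩
    | succ m ih =>
      obtain ⟨c, hc, hcm⟩ := ih
      refine ⟨fun i => (if i ≤ m then d₁ (c i) else 0) + (if i = 0 then 0 else d₂ (c (i - 1))),
        ?_, ?_⟩
      · rw [Function.iterate_succ_apply', hc, map_sum]
        simp only [map_add, add_mul, Finset.sum_add_distrib]
        rw [Finset.sum_range_succ _ (m + 1), Finset.sum_range_succ' _ (m + 1)]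
        simp only [show ¬ m + 1 ≤ m by omega, if_false, map_zero, zero_mul,
          add_zero, if_true, Nat.add_eq_zero_iff, one_ne_zero, and_false, Nat.add_sub_cancel]
        rw [← Finset.sum_add_distrib]
        refine Finset.sum_congr rfl fun i hi => ?_
        rw [if_pos (by simpa [Nat.lt_succ_iff] using hi), Derivation.leibniz,
          Derivation.leibniz_pow, hy, hD]
        simp only [smul_eq_mul]
        ring
      · simp [Function.iterate_succ_apply', hcm]
  obtain ⟨c, hc, hcm⟩ := key m
  rw [hm] at hc
  have := transcendental_iff.mp hty (∑ i ∈ Finset.range (m + 1), Polynomial.monomial i (c i))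
    (by simp [Polynomial.aeval_monomial, ← hc])
  have := congrArg (fun q => Polynomial.coeff q m) this
  rw [← hcm]
  simpa [Polynomial.finsetSum_coeff, Polynomial.coeff_monomial] using this

lemma exists_sum_of_iterate_eq_zero (d : Derivation E Z Z) {v : Z} (hv : d v = 1) (m : ℕ) (θ : Z)
    (h : d^[m] θ = 0) : ∃ c : ℕ → Z, (∀ i, d (c i) = 0) ∧
      θ = ∑ i ∈ Finset.range m, c i * v ^ i := by
  have : CharZero Z := charZero_of_injective_algebraMap (algebraMap E Z).injective
  induction m generalizing θ with
  | zero => exact ⟨fun _ => 0, by simp, by simpa using h⟩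
  | succ m ih =>
    obtain ⟨c, hc, hcd⟩ := ih (d θ) (by rwa [Function.iterate_succ_apply] at h)
    refine ⟨fun i => match i with
      | 0 => θ - ∑ i ∈ Finset.range m, c i * ((i + 1 : ℕ) : Z)⁻¹ * v ^ (i + 1)
      | i + 1 => c i * ((i + 1 : ℕ) : Z)⁻¹, ?_, ?_⟩
    · have hnat : ∀ i : ℕ, d (((i + 1 : ℕ) : Z)⁻¹) = 0 := by
        intro i
        rw [Derivation.leibniz_inv]
        simp
      rintro (_ | i)
      · simp only [map_sub, map_sum]
        rw [hcd, sub_eq_zero]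
        refine Finset.sum_congr rfl fun i _ => ?_
        rw [Derivation.leibniz, Derivation.leibniz, hc, hnat, Derivation.leibniz_pow, hv]
        have : ((i + 1 : ℕ) : Z) ≠ 0 := Nat.cast_ne_zero.mpr (by omega)
        simp only [smul_eq_mul, mul_one, nsmul_eq_mul, Nat.add_sub_cancel]
        field_simp
        ring
      · simp only [Derivation.leibniz, hc, hnat]
        simp
    · rw [Finset.sum_range_succ']
      simp

/-- The field of constants of a derivation. -/
def constants (d : Derivation E Z Z) : IntermediateField E Z where
  carrier := {a | d a = 0}
  mul_mem' {a b} ha hb := by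
    rw [Set.mem_ofPred_eq] at *
    rw [Derivation.leibniz, ha, hb, smul_zero, smul_zero, add_zero]
  add_mem' {a b} ha hb := by
    rw [Set.mem_ofPred_eq] at *
    rw [map_add, ha, hb, add_zero]
  algebraMap_mem' r := d.map_algebraMap r
  inv_mem' a ha := by
    rw [Set.mem_ofPred_eq] at *
    rw [Derivation.leibniz_inv, ha, smul_zero]

lemma mem_constants_of_isAlgebraic {d : Derivation E Z Z} {S : Set Z}
    (hS : ∀ a ∈ S, d a = 0) {v : Z} (hv : IsAlgebraic (Algebra.adjoin E S) v) : d v = 0 := by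
  have hle : Algebra.adjoin E S ≤ (constants d).toSubalgebra := Algebra.adjoin_le hS
  have hv' : IsAlgebraic (constants d) v :=
    hv.ringHom_of_comp_eq (Subalgebra.inclusion hle) (RingHom.id Z)
      (Subalgebra.inclusion_injective hle) rfl
  let d' : Derivation (constants d) Z Z := Derivation.mk'
    { toFun := d
      map_add' := map_add d
      map_smul' := fun c a => by
        rw [Algebra.smul_def, Derivation.leibniz]
        have : d (algebraMap (constants d) Z c) = 0 := c.2
        rw [this, smul_zero, add_zero]
        rfl }
    (fun a b => d.leibniz a b)
  have h := d'.map_aeval (minpoly (constants d) v) v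
  rw [minpoly.aeval, map_zero] at h
  have hchar : CharZero (constants d) :=
    charZero_of_injective_algebraMap (algebraMap E (constants d)).injective
  have hsep := (minpoly.irreducible hv'.isIntegral).separable
  exact (smul_eq_zero.mp h.symm).resolve_left
    (hsep.aeval_derivative_ne_zero (minpoly.aeval _ _))

end Partial

section Pencil

variable {E L M : Type} [Field E] [Field L] [Field M] [Algebra E L] [Algebra E M] [Algebra L M]
  [Algebra L[X] M] [IsFractionRing L[X] M] [IsScalarTower L L[X] M] [IsScalarTower E L M]

lemma exists_derivation_par : ∃ D : Derivation E M M,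
    ∀ p : L[X], D (algebraMap L[X] M p) = algebraMap L[X] M p.derivative := by
  have : Algebra.FormallyEtale L[X] M :=
    Algebra.FormallyEtale.of_isLocalization (nonZeroDivisors L[X])
  obtain ⟨D, hD⟩ := exists_derivation_extension (E := L) (P := L[X]) (Z := M) (N := M)
    (Polynomial.mkDerivation L (1 : M))
  refine ⟨D.restrictScalars E, fun p => ?_⟩
  change D _ = _
  rw [hD, Polynomial.mkDerivation_apply, Algebra.smul_def, mul_one]

lemma algebraMap_polynomial_injective : Function.Injective (algebraMap L[X] M) :=
  IsFractionRing.injective L[X] M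

lemma algebraicIndependent_pencil {x : L} (hx : Transcendental E x) (y : L) :
    AlgebraicIndependent E ![par M L, algebraMap L M x + par M L * algebraMap L M y] := by
  let e := (Polynomial.Bivariate.equivMvPolynomial E).symm
  let σ : MvPolynomial (Fin 2) E ≃ₐ[E] MvPolynomial (Fin 2) E := renameEquiv E (Equiv.swap 0 1)
  have h : ∀ p, aeval ![par M L, algebraMap L M x + par M L * algebraMap L M y] p =
      algebraMap L[X] M (pencilEval E x y (e (σ p))) := by
    intro p
    induction p using MvPolynomial.induction_on with
    | C a =>
      simp [e, σ, pencilEval_C, algebraMap_C, Polynomial.algebraMap_apply,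
        ← IsScalarTower.algebraMap_apply]
    | add p q hp hq => simp only [map_add, hp, hq]
    | mul_X p i hp =>
      simp only [map_mul, hp]
      congr 1
      fin_cases i
      · simp [e, σ, pencilEval_X, par]
      · simp [e, σ, pencilEval_C, par, algebraMap_C, mul_comm (algebraMap L M y)]
  intro p q hpq
  have hpq' : aeval ![par M L, algebraMap L M x + par M L * algebraMap L M y] p =
    aeval ![par M L, algebraMap L M x + par M L * algebraMap L M y] q := hpq
  rw [h, h] at hpq'
  exact σ.injective (e.injective (pencilEval_injective hx y (algebraMap_polynomial_injective hpq')))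

lemma transcendental_algebraMap_pencil {x y : L} (h : PolyIndep E x (fun k : ℕ => y ^ k)) :
    Transcendental (pencilField E M x y) (algebraMap L M y) := by
  have := h.linearIndependent (M := M) y
  rw [transcendental_iff]
  intro p hp
  rw [Polynomial.aeval_eq_sum_range] at hp
  have h2 := linearIndependent_iff'.mp this (Finset.range (p.natDegree + 1)) p.coeff
    (by simpa using hp)
  ext1 i
  by_cases hi : i ≤ p.natDegree
  · exact h2 i (by simpa [Nat.lt_succ_iff] using hi)
  · rw [Polynomial.coeff_eq_zero_of_natDegree_lt (by omega), Polynomial.coeff_zero]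

lemma exists_ringHom_lift {P A R : Type} [CommRing P] [CommRing A] [CommRing R] {i : P →+* A}
    (hi : Function.Injective i) {j : R →+* A} (h : ∀ a, j a ∈ i.range) :
    ∃ φ : R →+* P, i.comp φ = j := by
  let e : P ≃+* i.range := RingEquiv.ofBijective i.rangeRestrict
    ⟨fun a b hab => hi (congrArg Subtype.val hab), i.rangeRestrict_surjective⟩
  refine ⟨(e.symm : i.range →+* P).comp (j.codRestrict i.range h), RingHom.ext fun a => ?_⟩
  have := e.apply_symm_apply (j.codRestrict i.range h a)
  exact congrArg Subtype.val this

lemma exists_polynomial_of_isAlgebraic {S : Set M} (hS : ∀ a ∈ Algebra.adjoin E S,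
    a ∈ Set.range (algebraMap L[X] M)) {θ : M} (hθ : IsAlgebraic (Algebra.adjoin E S) θ) :
    ∃ q ∈ Algebra.adjoin E S, q ≠ 0 ∧ ∃ p : L[X], algebraMap L[X] M p = q * θ ∧
      IsIntegral (Algebra.adjoin E S) (q * θ) := by
  obtain ⟨q, hq, hInt⟩ := hθ.exists_integral_multiple
  have hq' : q • θ = q * θ := rfl
  rw [hq'] at hInt
  refine ⟨q, q.2, by simpa using hq, ?_⟩
  have : IsIntegral L[X] ((q : M) * θ) := by
    obtain ⟨φ, hφ⟩ := exists_ringHom_lift (i := algebraMap L[X] M)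
      (j := algebraMap (Algebra.adjoin E S) M) algebraMap_polynomial_injective
      (fun a => hS a a.2)
    exact hInt.map_of_comp_eq φ (RingHom.id M) (by rw [hφ]; rfl)
  obtain ⟨p, hp⟩ := IsIntegrallyClosed.isIntegral_iff.mp this
  exact ⟨p, hp, hInt⟩

lemma RelClosed.mem_of_isAlgebraic_par (hcl : RelClosed E L) {K : IntermediateField E M}
    (hK : par M L ∈ K) {c : M} (hc : IsAlgebraic (Algebra.adjoin E {par M L}) c) : c ∈ K := by
  let i : E[X] →+* M := (algebraMap L[X] M).comp (Polynomial.mapRingHom (algebraMap E L))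
  have hi : Function.Injective i := algebraMap_polynomial_injective.comp
    (Polynomial.map_injective _ (algebraMap E L).injective)
  have hiv : ∀ P, i P = Polynomial.aeval (par M L) P := by
    intro P
    induction P using Polynomial.induction_on' with
    | add p q hp hq => rw [map_add, map_add, hp, hq]
    | monomial n a =>
      simp [i, par, ← Polynomial.C_mul_X_pow_eq_monomial, algebraMap_C,
        ← IsScalarTower.algebraMap_apply]
  have hrange : ∀ a ∈ Algebra.adjoin E {par M L}, a ∈ i.range := by
    intro a ha
    rw [Algebra.adjoin_singleton_eq_range_aeval] at ha
    obtain ⟨P, rfl⟩ := ha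
    exact ⟨P, hiv P⟩
  have hmem : ∀ a ∈ Algebra.adjoin E {par M L}, a ∈ K := fun a ha =>
    (Algebra.adjoin_le (S := K.toSubalgebra) (by simpa using hK)) ha
  obtain ⟨q, hq, hq0, p, hp, hInt⟩ := exists_polynomial_of_isAlgebraic (L := L)
    (fun a ha => by obtain ⟨P, hP⟩ := hrange a ha; exact ⟨_, hP⟩) hc
  obtain ⟨φ, hφ⟩ := exists_ringHom_lift (i := i)
    (j := algebraMap (Algebra.adjoin E {par M L}) M) hi (fun a => hrange a a.2)
  have hpint : (Polynomial.mapRingHom (algebraMap E L)).IsIntegralElem p := by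
    obtain ⟨f, hf, hf0⟩ := hInt
    refine ⟨f.map φ, hf.map φ, ?_⟩
    apply algebraMap_polynomial_injective (M := M)
    rw [Polynomial.eval₂_map, Polynomial.hom_eval₂, map_zero, hp, ← hf0, ← hφ]
    rfl
  let : Algebra E[X] L[X] := (Polynomial.mapRingHom (algebraMap E L)).toAlgebra
  have hpint := Polynomial.isIntegral_iff_isIntegral_coeff.mp hpint
  have hpK : algebraMap L[X] M p ∈ K := by
    rw [p.as_sum_range_C_mul_X_pow, map_sum]
    refine sum_mem fun n _ => ?_
    obtain ⟨e, he⟩ := hcl _ (hpint n).isAlgebraic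
    rw [map_mul, map_pow, algebraMap_C, ← he, ← IsScalarTower.algebraMap_apply]
    exact mul_mem (K.algebraMap_mem e) (pow_mem hK n)
  rw [hp] at hpK
  have := div_mem hpK (hmem q hq)
  rwa [mul_div_cancel_left₀ _ hq0] at this

lemma isAlgebraic_adjoin_of_map {Z : Type} [Field Z] [Algebra E Z] [Algebra Z M]
    [IsScalarTower E Z M] {S : Set Z} {v : Z}
    (h : IsAlgebraic (Algebra.adjoin E (algebraMap Z M '' S)) (algebraMap Z M v)) :
    IsAlgebraic (Algebra.adjoin E S) v := by
  have himg : ∀ a : Algebra.adjoin E (algebraMap Z M '' S),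
      (a : M) ∈ (Algebra.adjoin E S).map (IsScalarTower.toAlgHom E Z M) := by
    intro a
    rw [AlgHom.map_adjoin]
    exact a.2
  obtain ⟨φ, hφ⟩ := exists_ringHom_lift
    (i := (algebraMap Z M).comp (algebraMap (Algebra.adjoin E S) Z))
    (j := algebraMap (Algebra.adjoin E (algebraMap Z M '' S)) M)
    ((algebraMap Z M).injective.comp Subtype.val_injective) (fun a => by
      obtain ⟨b, hb, hba⟩ := himg a
      exact ⟨⟨b, hb⟩, hba⟩)
  obtain ⟨f, hf, hf0⟩ := h
  refine ⟨f.map φ, ?_, ?_⟩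
  · refine fun h0 => hf ((Polynomial.map_eq_zero_iff fun a b hab => ?_).mp h0)
    refine Subtype.ext ?_
    change algebraMap (Algebra.adjoin E (algebraMap Z M '' S)) M a =
      algebraMap (Algebra.adjoin E (algebraMap Z M '' S)) M b
    rw [← hφ, RingHom.comp_apply, hab]
    rfl
  · apply (algebraMap Z M).injective
    rw [map_zero, ← hf0, Polynomial.aeval_def, Polynomial.aeval_def, Polynomial.eval₂_map,
      Polynomial.hom_eval₂, ← hφ]
    rfl

lemma mem_pencilField_of_isAlgebraic [CharZero E] {Z : Type} [Field Z] [Algebra E Z] [Algebra Z M]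
    [IsScalarTower E Z M] (hcl : RelClosed E L) {x y : L} {s v : Z}
    (hx : Transcendental E x) (hs : algebraMap Z M s = par M L)
    (hv : algebraMap Z M v = algebraMap L M x + par M L * algebraMap L M y)
    (halg : ∀ θ : Z, IsAlgebraic (Algebra.adjoin E {algebraMap Z M s, algebraMap Z M v})
      (algebraMap Z M θ))
    (hy : Transcendental Z (algebraMap L M y)) (θ : Z) :
    algebraMap Z M θ ∈ pencilField E M x y := by
  obtain ⟨D, hD⟩ := exists_derivation_par (E := E) (L := L) (M := M)
  have hDL : ∀ a : L, D (algebraMap L M a) = 0 := fun a => by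
    rw [← algebraMap_C, hD]; simp
  have hDs : D (par M L) = 1 := by rw [par, hD]; simp
  have hind := algebraicIndependent_pencil (M := M) hx y
  rw [← hv, ← hs] at hind
  have hsK : algebraMap Z M s ∈ pencilField E M x y := hs ▸ par_mem x y
  have hvK : algebraMap Z M v ∈ pencilField E M x y := hv ▸ pencil_mem x y
  obtain ⟨d, hds, hdv, hdD⟩ := exists_partial_derivation D hind halg (hs ▸ hDs)
    (by rw [hv, map_add, Derivation.leibniz, hDL, hDL, hDs]; simp) (hDL y) hy
  have hconst : ∀ c : Z, d c = 0 → algebraMap Z M c ∈ pencilField E M x y := by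
    intro c hc
    refine hcl.mem_of_isAlgebraic_par (par_mem x y) ?_
    by_contra hcon
    rw [← hs] at hcon
    have h1 := halg c
    rw [Set.pair_comm] at h1
    have h2 := isAlgebraic_exchange h1 hcon
    have h3 : d v = 0 := by
      refine mem_constants_of_isAlgebraic (S := {c, s}) (by simp [hc, hds])
        (isAlgebraic_adjoin_of_map (M := M) ?_)
      rwa [Set.image_pair]
    rw [hdv] at h3
    exact one_ne_zero h3
  have hInt : ∀ (θ : Z) (p : L[X]), algebraMap L[X] M p = algebraMap Z M θ →
      algebraMap Z M θ ∈ pencilField E M x y := by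
    intro θ p hp
    have hiter : ∀ m (p : L[X]), D^[m] (algebraMap L[X] M p) =
        algebraMap L[X] M (Polynomial.derivative^[m] p) := by
      intro m
      induction m with
      | zero => simp
      | succ m ih => intro p; rw [Function.iterate_succ_apply, hD, ih, Function.iterate_succ_apply]
    have h0 := hdD (p.natDegree + 1) θ (by
      rw [← hp, hiter, Polynomial.iterate_derivative_eq_zero (Nat.lt_succ_self _), map_zero])
    obtain ⟨c, hc, hθ⟩ := exists_sum_of_iterate_eq_zero d hdv _ _ h0
    rw [hθ, map_sum]
    refine sum_mem fun i _ => ?_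
    rw [map_mul, map_pow]
    exact mul_mem (hconst _ (hc i)) (pow_mem hvK i)
  have hpol : ∀ a ∈ Algebra.adjoin E {algebraMap Z M s, algebraMap Z M v},
      a ∈ Set.range (algebraMap L[X] M) := by
    rw [hs, hv]
    intro a ha
    obtain ⟨P, hP⟩ := exists_pencilEval_of_mem_adjoin x y a ha
    exact ⟨_, hP⟩
  obtain ⟨q, hq, hq0, p, hp, -⟩ := exists_polynomial_of_isAlgebraic hpol (halg θ)
  have hqZ : q ∈ (IsScalarTower.toAlgHom E Z M).range :=
    (Algebra.adjoin_le (by rintro _ (rfl | rfl); exacts [⟨s, rfl⟩, ⟨v, rfl⟩])) hq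
  obtain ⟨q', hq'⟩ := hqZ
  have hqK : q ∈ pencilField E M x y :=
    (Algebra.adjoin_le (S := (pencilField E M x y).toSubalgebra)
      (by rintro _ (rfl | rfl); exacts [hsK, hvK])) hq
  have hq'' : algebraMap Z M q' = q := hq'
  have hm := hInt (q' * θ) p (by rw [hp, map_mul, hq''])
  rw [map_mul, hq''] at hm
  have := div_mem hm hqK
  rwa [mul_div_cancel_left₀ _ hq0] at this

lemma RelClosed.pencil [CharZero E] (hcl : RelClosed E L) {x y : L}
    (hx : Transcendental E x) (h : PolyIndep E x (fun k : ℕ => y ^ k)) :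
    RelClosed (pencilField E M x y) M := by
  suffices H : ∀ K : IntermediateField E M, K = pencilField E M x y → ∀ a : M,
      IsAlgebraic K a → a ∈ K by
    intro a ha
    exact ⟨⟨a, H _ rfl a ha⟩, rfl⟩
  intro K hK a ha
  have hy : Transcendental K (algebraMap L M y) := by
    rw [hK]; exact transcendental_algebraMap_pencil (M := M) h
  have : IsScalarTower E (algebraicClosure K M) M := IsScalarTower.of_algebraMap_eq fun _ => rfl
  have hsK : par M L ∈ K := hK ▸ par_mem x y
  have hvK : algebraMap L M x + par M L * algebraMap L M y ∈ K := hK ▸ pencil_mem x y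
  have halg : ∀ θ : M, IsAlgebraic K θ → IsAlgebraic (Algebra.adjoin E
      {par M L, algebraMap L M x + par M L * algebraMap L M y}) θ := by
    rw [hK]
    exact fun θ hθ => IntermediateField.isAlgebraic_adjoin_iff.mp hθ
  rw [hK]
  exact mem_pencilField_of_isAlgebraic (E := E) (Z := algebraicClosure K M)
    (s := ⟨par M L, (algebraicClosure K M).algebraMap_mem ⟨_, hsK⟩⟩)
    (v := ⟨_, (algebraicClosure K M).algebraMap_mem ⟨_, hvK⟩⟩) hcl hx rfl rfl
    (fun θ => halg θ (mem_algebraicClosure_iff.mp θ.2))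
    (hy.extendScalars (algebraicClosure K M)) ⟨a, mem_algebraicClosure_iff.mpr ha⟩

end Pencil

section Count

lemma finrank_restrictSupport {E σ : Type} [Field E] (s : Set (σ →₀ ℕ)) :
    Module.finrank E (restrictSupport E s) = Nat.card s :=
  Module.finrank_eq_nat_card_basis (basisRestrictSupport E s)

lemma finrank_homogeneousSubmodule {E : Type} [Field E] (n D : ℕ) :
    Module.finrank E (homogeneousSubmodule (Fin (n + 1)) E D) = (D + n).choose n := by
  have h : homogeneousSubmodule (Fin (n + 1)) E D =
      restrictSupport E {m : Fin (n + 1) →₀ ℕ | m.degree = D} := by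
    rw [homogeneousSubmodule_eq_finsupp_supported]; rfl
  rw [h, finrank_restrictSupport]
  have h2 : {m : Fin (n + 1) →₀ ℕ | m.degree = D} =
      (Finset.univ.finsuppAntidiag D : Finset (Fin (n + 1) →₀ ℕ)) := by
    ext m
    simp [Finsupp.degree_eq_sum]
  rw [h2, Nat.card_coe_set_eq, Set.ncard_coe_finset, Finset.card_finsuppAntidiag_nat_eq_choose]
  simp only [Finset.card_univ, Fintype.card_fin]
  rw [show n + 1 + D - 1 = D + n by omega, Nat.choose_symm_add]

lemma finrank_restrictTotalDegree {E : Type} [Field E] (n D : ℕ) :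
    Module.finrank E (restrictTotalDegree (Fin n) E D) = (D + n).choose n := by
  rw [← finrank_homogeneousSubmodule (E := E) n D]
  have h : homogeneousSubmodule (Fin (n + 1)) E D =
      restrictSupport E {m : Fin (n + 1) →₀ ℕ | m.degree = D} := by
    rw [homogeneousSubmodule_eq_finsupp_supported]; rfl
  rw [h, finrank_restrictSupport, restrictTotalDegree, finrank_restrictSupport]
  have hdeg : ∀ m : Fin n →₀ ℕ, (m.sum fun _ e => e) = m.degree := fun m => rfl
  refine Nat.card_congr
    { toFun := fun m => ⟨Finsupp.cons (D - m.1.degree) m.1, ?_⟩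
      invFun := fun m => ⟨Finsupp.tail m.1, ?_⟩
      left_inv := fun m => Subtype.ext (Finsupp.tail_cons _ _)
      right_inv := fun m => Subtype.ext ?_ }
  · have := m.2
    simp only [Set.mem_ofPred_eq, hdeg] at this
    simp only [Set.mem_ofPred_eq, Finsupp.degree_eq_sum, Fin.sum_univ_succ, Finsupp.cons_zero,
      Finsupp.cons_succ] at this ⊢
    omega
  · have := m.2
    simp only [Set.mem_ofPred_eq, hdeg] at this ⊢
    simp only [Finsupp.degree_eq_sum, Fin.sum_univ_succ, Finsupp.tail_apply] at this ⊢
    omega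
  · have := m.2
    simp only [Set.mem_ofPred_eq, Finsupp.degree_eq_sum, Fin.sum_univ_succ] at this
    ext i
    refine Fin.cases ?_ (fun i => ?_) i
    · simp only [Finsupp.cons_zero, Finsupp.degree_eq_sum, Finsupp.tail_apply]
      omega
    · rw [Finsupp.cons_succ, Finsupp.tail_apply]

variable {E L : Type} [Field E] [Field L] [Algebra E L] {n r : ℕ}

lemma finrank_lat {u : Fin n → L} {z : Fin r → L} (h : Function.Injective (comb E u z)) (D : ℕ) :
    Module.finrank E (lat E u z D) = r * (D + n).choose n := by
  let f : (Fin r → restrictTotalDegree (Fin n) E D) →ₗ[E] (Fin r → MvPolynomial (Fin n) E) :=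
    LinearMap.pi fun i => (restrictTotalDegree (Fin n) E D).subtype ∘ₗ LinearMap.proj i
  have hf : Function.Injective (comb E u z ∘ₗ f) :=
    h.comp fun p q hpq => funext fun i => Subtype.ext (congrFun hpq i)
  have hrange : lat E u z D = LinearMap.range (comb E u z ∘ₗ f) := by
    ext a
    rw [mem_lat]
    constructor
    · rintro ⟨p, hp, rfl⟩
      exact ⟨fun i => ⟨p i, (mem_restrictTotalDegree _ _ _).mpr (hp i)⟩, rfl⟩
    · rintro ⟨p, rfl⟩
      exact ⟨f p, fun i => (mem_restrictTotalDegree _ _ _).mp (p i).2, rfl⟩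
  rw [hrange, LinearMap.finrank_range_of_inj hf, Module.finrank_pi_fintype]
  simp [finrank_restrictTotalDegree]

end Count

section Linear

lemma Normalized.finrank_pow_le_of_isEmpty {E L : Type} [Field E] [Field L] [Algebra E L] {r : ℕ}
    {V : Submodule E L} {u : Fin 0 → L} {z : Fin r → L} (h : Normalized V u z) (m : ℕ) :
    Module.finrank E ↥(V ^ m) ≤ r := by
  obtain ⟨q, hq, D, hD⟩ := h.bounded
  have h1 : Module.finrank E (lat E u z (m + D)) = r := by simp [finrank_lat h.indep]
  rw [← h1]
  let f : ↥(V ^ m) →ₗ[E] lat E u z (m + D) :=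
    ((LinearMap.mulLeft E q).comp (V ^ m).subtype).codRestrict _ fun θ => hD m θ θ.2
  refine LinearMap.finrank_le_finrank_of_injective (f := f) fun a b hab => Subtype.ext ?_
  exact mul_left_cancel₀ hq (congrArg Subtype.val hab)

lemma Normalized.exists_pencil {E L M : Type} [Field E] [CharZero E] [Field L] [Field M]
    [Algebra E L] [Algebra E M] [Algebra L M]
    [Algebra L[X] M] [IsFractionRing L[X] M] [IsScalarTower L L[X] M] [IsScalarTower E L M]
    {n r : ℕ} {V : Submodule E L} {u : Fin (n + 1) → L} {z : Fin r → L} (h : Normalized V u z)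
    (hcl : RelClosed E L) :
    ∃ Y : MvPolynomial (Fin n) E, Y.totalDegree ≤ 1 ∧ aeval (Fin.tail u) Y ∈ V ∧
      (n ≠ 0 → RelClosed (pencilField E M (u 0) (aeval (Fin.tail u) Y)) M) := by
  rcases n with _ | n
  · exact ⟨0, by simp, by simp, by simp⟩
  refine ⟨X 0, by simp, by rw [aeval_X]; exact h.mem _, fun _ => ?_⟩
  refine hcl.pencil (h.algebraicIndependent.transcendental 0) ?_
  rw [aeval_X]
  intro s p hp i hi
  have hz := polyIndep_monFamily h.indep
  let a : ℕ ↪ (Σ _ : Fin r, (Fin (n + 1) →₀ ℕ)) :=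
    ⟨fun k => ⟨⟨0, h.ne_zero⟩, Finsupp.single 0 k⟩, fun k l hkl => by
      simpa using congrArg (fun b : (Σ _ : Fin r, (Fin (n + 1) →₀ ℕ)) => b.2 0) hkl⟩
  have := hz (s.map a) (fun b => p (b.2 0)) (by
    rw [Finset.sum_map]
    have : ∀ k, Polynomial.aeval (u 0) (p ((a k).2 0)) * monFamily E u z (a k) =
        Polynomial.aeval (u 0) (p k) * Fin.tail u 0 ^ k * z ⟨0, h.ne_zero⟩ := fun k => by
      have ha : a k = ⟨⟨0, h.ne_zero⟩, Finsupp.single 0 k⟩ := rfl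
      simp [ha, monFamily, aeval_monomial, mul_assoc]
    simp only [this]
    rw [← Finset.sum_mul, hp, zero_mul]) (a i) (Finset.mem_map_of_mem a hi)
  have ha : a i = ⟨⟨0, h.ne_zero⟩, Finsupp.single 0 i⟩ := rfl
  simpa [ha] using this

lemma finrank_extSpan_ge {E L M : Type} [Field E] [Field L] [Field M]
    [Algebra E L] [Algebra E M] [Algebra L M]
    [Algebra L[X] M] [IsFractionRing L[X] M] [IsScalarTower L L[X] M] [IsScalarTower E L M]
    {V : Submodule E L} [Module.Finite E V] (h1 : 1 ∈ V) {x : L} (hx : x ∈ V) (hx0 : x ≠ 0) (y : L)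
    {j : ℕ} (hcolon : ∀ N, ∀ φ ∈ V ^ N, x * φ ∈ V ^ (j + 1) → φ ∈ V ^ j) :
    Module.finrank E ↥(V ^ (j + 1)) ≤
      Module.finrank (pencilField E M x y) ↥(extSpan (pencilField E M x y) V ^ (j + 1)) +
        Module.finrank E ↥(V ^ j) := by
  obtain ⟨d, b, hb, hbV, hd⟩ := exists_polyIndep_of_colon h1 hx hx0 hcolon
  refine hd.trans (Nat.add_le_add_right ?_ _)
  have hfin : Module.Finite E ↥(V ^ (j + 1)) := by
    rw [Module.Finite.iff_fg]
    exact Submodule.FG.pow (Module.Finite.iff_fg.mp inferInstance) _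
  have := finite_extSpan (pencilField E M x y) (V ^ (j + 1))
  rw [← extSpan_pow]
  have hli := hb.linearIndependent (M := M) y
  have hli' : LinearIndependent (pencilField E M x y) (fun i => (⟨algebraMap L M (b i),
      mem_extSpan (pencilField E M x y) (hbV i)⟩ : extSpan (pencilField E M x y) (V ^ (j + 1)))) :=
    LinearIndependent.of_comp (Submodule.subtype _) hli
  simpa using hli'.fintype_card_le_finrank

lemma Normalized.finrank_le_finrank_extSpan {E L M : Type} [Field E] [Field L] [Field M]
    [Algebra E L] [Algebra E M] [Algebra L M]
    [Algebra L[X] M] [IsFractionRing L[X] M] [IsScalarTower L L[X] M] [IsScalarTower E L M]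
    {n r : ℕ} {V : Submodule E L} {u : Fin (n + 1) → L} {z : Fin r → L} (h : Normalized V u z)
    (hcl : RelClosed E L) (y : L) :
    Module.finrank E V ≤ Module.finrank (pencilField E M (u 0) y)
      (extSpan (pencilField E M (u 0) y) V) + 1 := by
  have := h.finite
  have := finrank_extSpan_ge (M := M) (j := 0) h.one_mem (h.mem 0)
    (h.algebraicIndependent.ne_zero 0) y (by
      intro N φ hφ hφ'
      rw [zero_add, pow_one] at hφ'
      simpa using h.mem_one_of_mul_mem hcl hφ hφ')
  rw [zero_add, pow_one, pow_one, pow_zero, Submodule.one_eq_span,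
    finrank_span_singleton one_ne_zero]
    at this
  exact this

theorem Normalized.finrank_le {E L : Type} [Field E] [CharZero E] [Field L] [Algebra E L] {n r : ℕ}
    {V : Submodule E L} {u : Fin n → L} {z : Fin r → L} (h : Normalized V u z)
    (hcl : n ≠ 0 → RelClosed E L) : Module.finrank E V ≤ r + n := by
  induction n generalizing E L with
  | zero =>
    have := h.finrank_pow_le_of_isEmpty 1
    rwa [pow_one] at this
  | succ n ih =>
    have hcl := hcl n.succ_ne_zero
    let M := FractionRing L[X]
    obtain ⟨Y, hY, hYV, hYcl⟩ := h.exists_pencil (M := M) hcl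
    have h1 := ih (h.pencil (M := M) Y hY) hYcl
    have h2 := h.finrank_le_finrank_extSpan (M := M) hcl (aeval (Fin.tail u) Y)
    omega

lemma Normalized.sup_span {E L : Type} [Field E] [Field L] [Algebra E L] {n r : ℕ}
    {V : Submodule E L} {u : Fin n → L} {z : Fin r → L} (h : Normalized V u z) {i : Fin n} {N : ℕ}
    {φ : L} (hφ : φ ∈ V ^ N) (hφ' : u i * φ ∈ V ^ 2) :
    Normalized (V ⊔ Submodule.span E {φ}) u z where
  one_mem := Submodule.mem_sup_left h.one_mem
  mem i := Submodule.mem_sup_left (h.mem i)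
  finite := by
    have := h.finite
    infer_instance
  indep := h.indep
  bounded := by
    obtain ⟨q, hq, D, hD⟩ := h.bounded
    refine ⟨q, hq, D, fun m θ hθ => ?_⟩
    have h1 : V ⊔ Submodule.span E {φ} ≤ V ^ (N + 1) := by
      refine sup_le ?_ ((Submodule.span_singleton_le_iff_mem _ _).mpr
        (pow_le_pow_of_one_mem h.one_mem N.le_succ hφ))
      simpa using pow_le_pow_of_one_mem h.one_mem (Nat.succ_le_succ (Nat.zero_le N))
    have h2 : Submodule.span E {u i} * (V ⊔ Submodule.span E {φ}) ≤ V ^ 2 := by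
      rw [Submodule.mul_sup, Submodule.span_mul_span, Set.singleton_mul_singleton]
      refine sup_le ?_ ((Submodule.span_singleton_le_iff_mem _ _).mpr hφ')
      rw [pow_two]
      exact mul_le_mul' ((Submodule.span_singleton_le_iff_mem _ _).mpr (h.mem i)) le_rfl
    refine h.mul_mem_lat hD (N := (N + 1) * m) (i := i) (j := m) ?_ ?_
    · rw [pow_mul]
      exact pow_le_pow_left' h1 m hθ
    · rw [← two_mul, pow_mul]
      refine pow_le_pow_left' h2 m ?_
      rw [mul_pow]
      exact Submodule.mul_mem_mul (Submodule.pow_mem_pow _ (Submodule.mem_span_singleton_self _) m)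
        hθ

theorem Normalized.finrank_sq_le {E L : Type} [Field E] [CharZero E] [Field L] [Algebra E L]
    {n r : ℕ} {V : Submodule E L} {u : Fin n → L} {z : Fin r → L} (h : Normalized V u z)
    (hcl : n ≠ 0 → RelClosed E L) (hV : Module.finrank E V = r + n) :
    Module.finrank E ↥(V ^ 2) ≤ ∑ i ∈ Finset.range n, (r + n - i) + r := by
  induction n generalizing E L with
  | zero => simpa using h.finrank_pow_le_of_isEmpty 2
  | succ n ih =>
    have hcl' := hcl
    have hcl := hcl n.succ_ne_zero
    let M := FractionRing L[X]
    obtain ⟨Y, hY, hYV, hYcl⟩ := h.exists_pencil (M := M) hcl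
    have hfin := h.finite
    have h1 := (h.pencil (M := M) Y hY).finrank_le hYcl
    have h2 := h.finrank_le_finrank_extSpan (M := M) hcl (aeval (Fin.tail u) Y)
    have h3 := ih (h.pencil (M := M) Y hY) hYcl (by omega)
    have h4 := finrank_extSpan_ge (M := M) (j := 1) h.one_mem (h.mem 0)
      (h.algebraicIndependent.ne_zero 0) (aeval (Fin.tail u) Y) (by
        intro N φ hφ hφ'
        rw [pow_one]
        by_contra hcon
        have h5 := h.sup_span hφ hφ'
        have h6 := h5.finrank_le hcl'
        have hfin' := h5.finite
        have h7 := Submodule.finrank_lt_finrank_of_lt (s := V)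
          (t := V ⊔ Submodule.span E {φ}) (lt_of_le_of_ne le_sup_left fun heq => hcon (by
            rw [heq]
            exact Submodule.mem_sup_right (Submodule.mem_span_singleton_self φ)))
        omega)
    rw [pow_one, one_add_one_eq_two] at h4
    rw [Finset.sum_range_succ']
    have h8 : ∀ i, r + (n + 1) - (i + 1) = r + n - i := fun i => by omega
    simp only [h8]
    omega

end Linear

section CauchyDavenport

variable {K M : Type} [Field K] [Field M] [Algebra K M] [FiniteDimensional K M]

lemma eq_top_of_mul_le (hgen : ∀ θ : M, θ ∉ (⊥ : IntermediateField K M) →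
      IntermediateField.adjoin K {θ} = ⊤) {A B : Submodule K M}
    (hA : A ≠ ⊥) (hB : 2 ≤ Module.finrank K B) (h : A * B ≤ A) : A = ⊤ := by
  obtain ⟨θ, hθB, hθ⟩ : ∃ θ ∈ B, θ ∉ (⊥ : IntermediateField K M) := by
    by_contra! hcon
    have hle : B ≤ Submodule.span K {(1 : M)} := fun θ hθ => by
      obtain ⟨c, hc⟩ := IntermediateField.mem_bot.mp (hcon θ hθ)
      rw [← hc, Algebra.algebraMap_eq_smul_one]
      exact Submodule.smul_mem _ _ (Submodule.mem_span_singleton_self _)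
    have := Submodule.finrank_mono hle
    rw [finrank_span_singleton one_ne_zero] at this
    omega
  obtain ⟨a, ha, ha0⟩ := Submodule.exists_mem_ne_zero_of_ne_bot hA
  have hstab : ∀ p : K[X], Polynomial.aeval θ p * a ∈ A := by
    intro p
    have hpow : ∀ i : ℕ, θ ^ i * a ∈ A := by
      intro i
      induction i with
      | zero => simpa using ha
      | succ i ih =>
        rw [pow_succ', mul_assoc, mul_comm]
        exact h (Submodule.mul_mem_mul ih hθB)
    rw [Polynomial.aeval_eq_sum_range, Finset.sum_mul]
    refine Submodule.sum_mem _ fun i _ => ?_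
    rw [smul_mul_assoc]
    exact Submodule.smul_mem _ _ (hpow i)
  rw [eq_top_iff]
  intro b _
  have hb : b / a ∈ IntermediateField.adjoin K {θ} := by rw [hgen θ hθ]; trivial
  rw [← IntermediateField.mem_toSubalgebra,
    IntermediateField.adjoin_simple_toSubalgebra_of_isAlgebraic (Algebra.IsAlgebraic.isAlgebraic θ),
    Algebra.adjoin_singleton_eq_range_aeval] at hb
  obtain ⟨p, hp⟩ := hb
  have := hstab p
  rwa [show Polynomial.aeval θ p = b / a from hp, div_mul_cancel₀ _ ha0] at this

theorem min_le_finrank_mul (hgen : ∀ θ : M, θ ∉ (⊥ : IntermediateField K M) →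
      IntermediateField.adjoin K {θ} = ⊤) (A B : Submodule K M) (hA : A ≠ ⊥) (h1 : 1 ∈ B) :
    min (Module.finrank K M) (Module.finrank K A + Module.finrank K B - 1) ≤
      Module.finrank K ↥(A * B) := by
  induction hb : Module.finrank K B using Nat.strong_induction_on generalizing A B with
  | _ b ih =>
  have hAB : A ≤ A * B := fun a ha => by simpa using Submodule.mul_mem_mul ha h1
  rcases Nat.lt_or_ge b 2 with hb2 | hb2
  · have := Submodule.finrank_mono hAB
    omega
  by_cases hcase : A * B ≤ A
  · have : A * B = ⊤ := top_le_iff.mp (eq_top_of_mul_le hgen hA (hb ▸ hb2) hcase ▸ hAB)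
    rw [this, finrank_top]
    exact min_le_left _ _
  obtain ⟨e, he, θ, hθ, heθ⟩ : ∃ e ∈ A, ∃ θ ∈ B, e * θ ∉ A := by
    by_contra! hcon
    exact hcase (Submodule.mul_le.mpr hcon)
  have he0 : e ≠ 0 := by rintro rfl; simp at heθ
  let m : M ≃ₗ[K] M := LinearEquiv.ofBijective (LinearMap.mulLeft K e)
    ⟨mul_right_injective₀ he0, fun a => ⟨e⁻¹ * a, by simp [he0]⟩⟩
  have hm : ∀ a, m a = e * a := fun a => rfl
  let B' := B ⊓ A.comap m.toLinearMap
  have hB' : B'.map m.toLinearMap = A ⊓ B.map m.toLinearMap := by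
    rw [Submodule.map_inf _ m.injective, Submodule.map_comap_eq_of_surjective m.surjective,
      inf_comm]
  have hdim := Submodule.finrank_sup_add_finrank_inf_eq A (B.map m.toLinearMap)
  rw [← hB', LinearEquiv.finrank_map_eq, LinearEquiv.finrank_map_eq] at hdim
  have hlt : Module.finrank K B' < b := by
    rw [← hb]
    refine Submodule.finrank_lt_finrank_of_lt (lt_of_le_of_ne inf_le_left fun h => heθ ?_)
    have : θ ∈ B' := h ▸ hθ
    exact this.2
  have hle : (A ⊔ B.map m.toLinearMap) * B' ≤ A * B := by
    rw [Submodule.sup_mul]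
    refine sup_le (mul_le_mul' le_rfl inf_le_left) (Submodule.mul_le.mpr ?_)
    rintro _ ⟨β, hβ, rfl⟩ γ ⟨-, hγ⟩
    change e * β * γ ∈ _
    rw [show e * β * γ = (e * γ) * β by ring]
    exact Submodule.mul_mem_mul hγ hβ
  have := ih _ hlt (A ⊔ B.map m.toLinearMap) B' (fun h => hA (by
    rw [eq_bot_iff, ← h]; exact le_sup_left)) ⟨h1, by change e * 1 ∈ A; simpa using he⟩ rfl
  have := this.trans (Submodule.finrank_mono hle)
  omega

end CauchyDavenport

section Algebraic

variable {E L : Type} [Field E] [Field L] [Algebra E L] {n r : ℕ}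

lemma Normalized.isIntegral {V : Submodule E L} {u : Fin n → L} {z : Fin r → L}
    (h : Normalized V u z) {θ : L} (hθ : θ ∈ V) :
    IsIntegral (Algebra.adjoin E (Set.range u)) θ := by
  obtain ⟨q, hq, D, hD⟩ := h.bounded
  let A := Algebra.adjoin E (Set.range u)
  have : IsNoetherianRing A := Algebra.FiniteType.isNoetherianRing E A
    (h := ⟨(Subalgebra.fg_top _).mpr ⟨(Set.finite_range u).toFinset, by simp [A]⟩⟩)
  let N : Submodule A L := Submodule.span A {a | ∃ m, ∃ φ ∈ V ^ m, a = q * φ}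
  have hN : N ≤ Submodule.span A (Set.range z) := by
    refine Submodule.span_le.mpr ?_
    rintro _ ⟨m, φ, hφ, rfl⟩
    obtain ⟨p, -, hp⟩ := mem_lat.mp (hD m φ hφ)
    rw [← hp, comb_apply]
    refine Submodule.sum_mem _ fun i _ => ?_
    have : aeval u (p i) ∈ A := by
      change _ ∈ Algebra.adjoin E (Set.range u)
      rw [Algebra.adjoin_range_eq_range_aeval]; exact ⟨_, rfl⟩
    exact Submodule.smul_mem _ (⟨_, this⟩ : A) (Submodule.subset_span ⟨i, rfl⟩)
  have hfg : (Submodule.span A (Set.range z)).FG := Submodule.fg_span (Set.finite_range z)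
  have hnoeth : IsNoetherian A (Submodule.span A (Set.range z)) :=
    isNoetherian_of_fg_of_noetherian _ hfg
  have hNfg : N.FG := isNoetherian_submodule.mp hnoeth N hN
  have hq1 : q ∈ N := Submodule.subset_span ⟨0, 1, by simp, by simp⟩
  refine isIntegral_of_smul_mem_submodule N (fun h => hq ?_) hNfg θ fun a ha => ?_
  · rwa [h, Submodule.mem_bot] at hq1
  · induction ha using Submodule.span_induction with
    | mem a ha =>
      obtain ⟨m, φ, hφ, rfl⟩ := ha
      refine Submodule.subset_span ⟨m + 1, φ * θ, ?_, ?_⟩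
      · rw [pow_succ]; exact Submodule.mul_mem_mul hφ hθ
      · rw [smul_eq_mul]; ring
    | zero => simp
    | add a b _ _ ha hb => rw [smul_add]; exact add_mem ha hb
    | smul c a _ ha => rw [smul_comm]; exact N.smul_mem c ha

end Algebraic

section Disjoint

variable {E L Ω : Type} [Field E] [Field L] [Field Ω] [Algebra E L] [Algebra E Ω]

lemma derivation_eq_zero [CharZero E] {N : Type} [AddCommGroup N] [Module L N] [Module E N]
    [IsScalarTower E L N] {x : L} (halg : ∀ a : L, IsAlgebraic (Algebra.adjoin E {x}) a)
    (d : Derivation E L N) (hd : d x = 0) : d = 0 := by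
  have : CharZero (Algebra.adjoin E {x}) := charZero_of_injective_algebraMap
    (algebraMap E (Algebra.adjoin E {x})).injective
  have : Algebra.IsAlgebraic (Algebra.adjoin E {x}) L := ⟨halg⟩
  have := formallyEtale_of_isAlgebraic (Algebra.adjoin E {x}) L
  refine derivation_eq_of_restrict (P := Algebra.adjoin E {x}) d 0 fun p => ?_
  have h : Set.EqOn d (0 : Derivation E L N) {x} := by
    rintro _ rfl
    simpa using hd
  exact Derivation.eqOn_adjoin h p.2

lemma exists_derivation_eq_one [CharZero E] {x : L} (hx : Transcendental E x)
    (halg : ∀ a : L, IsAlgebraic (Algebra.adjoin E {x}) a) : ∃ δ : Derivation E L L, δ x = 1 := by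
  let : Algebra E[X] L := (Polynomial.aeval x : E[X] →ₐ[E] L).toAlgebra
  have hmap : ∀ p, algebraMap E[X] L p = Polynomial.aeval x p := fun p => rfl
  have hinj : Function.Injective (algebraMap E[X] L) := transcendental_iff_injective.mp hx
  have : IsScalarTower E E[X] L := IsScalarTower.of_algebraMap_eq fun e => by simp [hmap]
  have : FaithfulSMul E[X] L := (faithfulSMul_iff_algebraMap_injective _ _).mpr hinj
  have : Algebra.IsAlgebraic E[X] L := ⟨fun a => by
    obtain ⟨φ, hφ⟩ := exists_ringHom_lift (i := algebraMap E[X] L)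
      (j := algebraMap (Algebra.adjoin E {x}) L) hinj (fun b => by
        have : ∀ c ∈ Algebra.adjoin E {x}, c ∈ (algebraMap E[X] L).range := fun c hc => by
          rw [Algebra.adjoin_singleton_eq_range_aeval] at hc
          exact hc
        exact this b b.2)
    refine (halg a).ringHom_of_comp_eq φ (RingHom.id L) (fun b c hbc => ?_) hφ
    refine Subtype.ext ?_
    change algebraMap (Algebra.adjoin E {x}) L b = algebraMap (Algebra.adjoin E {x}) L c
    rw [← hφ, RingHom.comp_apply, hbc]
    rfl⟩
  have := formallyEtale_of_isAlgebraic E[X] L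
  obtain ⟨δ, hδ⟩ := exists_derivation_extension (E := E) (P := E[X]) (Z := L)
    (Polynomial.mkDerivation E (1 : L))
  refine ⟨δ, ?_⟩
  have := hδ Polynomial.X
  rw [hmap, Polynomial.aeval_X] at this
  rw [this, Polynomial.mkDerivation_X]

lemma RelClosed.mem_range_of_derivation_eq_zero [CharZero E] (hcl : RelClosed E L) {x : L}
    (halg : ∀ a : L, IsAlgebraic (Algebra.adjoin E {x}) a) {δ : Derivation E L L} (hδ : δ x = 1)
    {c : L} (hc : δ c = 0) : c ∈ Set.range (algebraMap E L) := by
  refine hcl c ?_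
  by_contra hcon
  have h1 : ¬ IsAlgebraic (Algebra.adjoin E (∅ : Set L)) c := fun h => hcon (by
    rw [Algebra.adjoin_empty] at h
    exact (Subalgebra.isAlgebraic_bot_iff (algebraMap E L).injective).mp h)
  have h2 := isAlgebraic_exchange (S := ∅) (a := x) (b := c)
    (by rw [insert_empty_eq]; exact halg c) h1
  rw [insert_empty_eq] at h2
  have h3 : δ x = 0 := mem_constants_of_isAlgebraic (S := {c}) (by simpa using hc) h2
  rw [hδ] at h3
  exact one_ne_zero h3

lemma derivation_comp_eq [CharZero E] {x : L} (halg : ∀ a : L, IsAlgebraic (Algebra.adjoin E {x}) a)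
    (g : L →ₐ[E] Ω) (D : Derivation E Ω Ω) {δ : Derivation E L L} (hδ : δ x = 1) (b : L) :
    D (g b) = D (g x) * g (δ b) := by
  let : Algebra L Ω := g.toRingHom.toAlgebra
  have hmap : ∀ a, algebraMap L Ω a = g a := fun _ => rfl
  have : IsScalarTower E L Ω := IsScalarTower.of_algebraMap_eq fun e => (g.commutes e).symm
  have h := derivation_eq_zero halg (D.compAlgebraMap L -
    D (g x) • (Algebra.linearMap L Ω).compDer δ) (by simp [hmap, hδ])
  have := DFunLike.congr_fun h b
  simpa [hmap, sub_eq_zero] using this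

lemma eq_zero_of_sum_mul_eq_zero [Algebra L Ω] {g : L →+* Ω} {δ : Derivation E L L}
    (hδ : ∀ c, δ c = 0 → c ∈ Set.range (algebraMap E L)) {D : Ω →ₗ[L] Ω} {h : Ω} (hh : h ≠ 0)
    (hg : ∀ e : E, g (algebraMap E L e) = algebraMap L Ω (algebraMap E L e))
    (hD : ∀ b, D (g b) = h * g (δ b)) {ι : Type} {a : ι → L} (ha : LinearIndependent E a)
    (s : Finset ι) : ∀ b : ι → L, ∑ i ∈ s, algebraMap L Ω (a i) * g (b i) = 0 →
      ∀ i ∈ s, b i = 0 := by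
  classical
  induction s using Finset.induction_on with
  | empty => simp
  | insert j s hj ih =>
    intro b hb
    have hbj : b j = 0 := by
      by_contra hbj
      have h1 : algebraMap L Ω (a j) + ∑ i ∈ s, algebraMap L Ω (a i) * g (b i / b j) = 0 := by
        rw [Finset.sum_insert hj] at hb
        have hgj : g (b j) ≠ 0 := (map_ne_zero g).mpr hbj
        have : (algebraMap L Ω (a j) + ∑ i ∈ s, algebraMap L Ω (a i) * g (b i / b j)) * g (b j)
            = 0 := by
          rw [add_mul, Finset.sum_mul, ← hb]
          congr 1
          refine Finset.sum_congr rfl fun i _ => ?_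
          rw [mul_assoc, ← map_mul, div_mul_cancel₀ _ hbj]
        exact (mul_eq_zero.mp this).resolve_right hgj
      have hD1 : ∀ (c d : L), D (algebraMap L Ω c * g d) = h * (algebraMap L Ω c * g (δ d)) := by
        intro c d
        rw [← Algebra.smul_def, map_smul, hD, Algebra.smul_def]
        ring
      have h2 := congrArg D h1
      have hj0 := hD1 (a j) 1
      rw [map_one, mul_one, Derivation.map_one_eq_zero, map_zero, mul_zero, mul_zero] at hj0
      rw [map_add, map_sum, map_zero, hj0, zero_add] at h2
      simp only [hD1] at h2
      rw [← Finset.mul_sum] at h2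
      have h3 := ih (fun i => δ (b i / b j)) ((mul_eq_zero.mp h2).resolve_left hh)
      have h4 : ∀ i, ∃ e : E, i ∈ s → algebraMap E L e = b i / b j := fun i => by
        by_cases hi : i ∈ s
        · obtain ⟨e, he⟩ := hδ _ (h3 i hi)
          exact ⟨e, fun _ => he⟩
        · exact ⟨0, fun h => absurd h hi⟩
      choose e he using h4
      have h5 : a j + ∑ i ∈ s, e i • a i = 0 := by
        apply (algebraMap L Ω).injective
        rw [map_add, map_sum, map_zero, ← h1]
        congr 1
        refine Finset.sum_congr rfl fun i hi => ?_
        rw [← he i hi, hg, Algebra.smul_def, map_mul, mul_comm]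
      have h6 := linearIndependent_iff'.mp ha (insert j s) (fun i => if i = j then 1 else e i) (by
        rw [Finset.sum_insert hj, ← h5]
        simp only [if_true, one_smul]
        congr 1
        refine Finset.sum_congr rfl fun i hi => ?_
        rw [if_neg (ne_of_mem_of_not_mem hi hj)]) j (Finset.mem_insert_self _ _)
      simp at h6
    rw [Finset.sum_insert hj, hbj, map_zero, mul_zero, zero_add] at hb
    intro i hi
    rcases Finset.mem_insert.mp hi with rfl | hi
    · exact hbj
    · exact ih b hb i hi

open scoped TensorProduct in
lemma injective_productMap [Algebra L Ω] [IsScalarTower E L Ω] {g : L →ₐ[E] Ω}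
    {δ : Derivation E L L}
    (hδ : ∀ c, δ c = 0 → c ∈ Set.range (algebraMap E L)) {D : Ω →ₗ[L] Ω} {h : Ω} (hh : h ≠ 0)
    (hD : ∀ b, D (g b) = h * g (δ b)) :
    Function.Injective (Algebra.TensorProduct.productMap (IsScalarTower.toAlgHom E L Ω) g) := by
  rw [injective_iff_map_eq_zero]
  intro t ht
  let B := Module.Basis.ofVectorSpace E L
  obtain ⟨c, rfl⟩ := TensorProduct.eq_repr_basis_left B t
  rw [Finsupp.sum, map_sum] at ht
  have h0 := eq_zero_of_sum_mul_eq_zero (g := g.toRingHom) hδ hh (fun e => by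
    rw [← IsScalarTower.algebraMap_apply]; exact g.commutes e) hD B.linearIndependent c.support c ht
  exact Finset.sum_eq_zero fun i hi => by rw [h0 i hi]; exact TensorProduct.tmul_zero _ _

end Disjoint

section BaseChange

open scoped TensorProduct

section Conjugates

variable {E L M : Type} [Field E] [Field L] [Field M] [Algebra E L] [Algebra E M] [Algebra L M]
  [Algebra L[X] M] [IsFractionRing L[X] M] [IsScalarTower L L[X] M] [IsScalarTower E L M]
  {Ω : Type} [Field Ω] [Algebra M Ω] [Algebra E Ω] [Algebra L Ω] [IsScalarTower E M Ω]
  [IsScalarTower L M Ω] [IsScalarTower E L Ω]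

lemma algHom_ext_fractionField {F : Type} [Field F] {f g : M →+* F}
    (hL : ∀ a : L, f (algebraMap L M a) = g (algebraMap L M a)) (hs : f (par M L) = g (par M L)) :
    f = g := by
  refine IsLocalization.ringHom_ext (nonZeroDivisors L[X]) ?_
  refine Polynomial.ringHom_ext (fun a => ?_) hs
  simpa [algebraMap_C] using hL a

lemma map_algebraMap_polynomial {F : Type} [Field F] (f : M →+* F) (p : L[X]) :
    f (algebraMap L[X] M p) = p.eval₂ (f.comp (algebraMap L M)) (f (par M L)) := by
  have : f.comp (algebraMap L[X] M) =
      Polynomial.eval₂RingHom (f.comp (algebraMap L M)) (f (par M L)) := by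
    refine Polynomial.ringHom_ext (fun a => ?_) ?_
    · simp [algebraMap_C]
    · simp [par]
  exact DFunLike.congr_fun this p

lemma eval₂_eq_zero_iff_sum {T F : Type} [CommRing T] [Field F] (μ : T →+* F)
    (hμ : Function.Injective μ) (p : T[X]) {a b : T} {s : F} (hb : μ b ≠ 0)
    (hs : μ b * s = μ a) : p.eval₂ μ s = 0 ↔
      ∑ i ∈ Finset.range (p.natDegree + 1), p.coeff i * a ^ i * b ^ (p.natDegree - i) = 0 := by
  rw [← map_eq_zero_iff μ hμ, map_sum, Polynomial.eval₂_eq_sum_range]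
  have : ∑ i ∈ Finset.range (p.natDegree + 1), μ (p.coeff i * a ^ i * b ^ (p.natDegree - i)) =
      μ b ^ p.natDegree * ∑ i ∈ Finset.range (p.natDegree + 1), μ (p.coeff i) * s ^ i := by
    rw [Finset.mul_sum]
    refine Finset.sum_congr rfl fun i hi => ?_
    have hi : i ≤ p.natDegree := by simpa [Nat.lt_succ_iff] using hi
    rw [map_mul, map_mul, map_pow, map_pow, ← hs, mul_pow]
    have h : μ b ^ p.natDegree = μ b ^ i * μ b ^ (p.natDegree - i) := by
      rw [← pow_add, Nat.add_sub_cancel' hi]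
    rw [h]
    ring
  rw [this, mul_eq_zero]
  simp [hb]

lemma ne_of_fixes_pencil {x y : L} (hgen : IntermediateField.adjoin E {x, y} = ⊤)
    {g : M →ₐ[E] Ω} (hg : g ≠ IsScalarTower.toAlgHom E M Ω)
    (hs : g (par M L) = algebraMap M Ω (par M L))
    (hw : g (algebraMap L M x + par M L * algebraMap L M y) =
      algebraMap M Ω (algebraMap L M x + par M L * algebraMap L M y)) :
    g (algebraMap L M y) ≠ algebraMap M Ω (algebraMap L M y) := by
  intro hy
  have hx : g (algebraMap L M x) = algebraMap M Ω (algebraMap L M x) := by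
    simpa [hs, hy] using hw
  apply hg
  apply AlgHom.coe_ringHom_injective
  refine algHom_ext_fractionField (L := L) (fun a => ?_) hs
  let f₁ : L →ₐ[E] Ω := g.comp (IsScalarTower.toAlgHom E L M)
  let f₂ : L →ₐ[E] Ω := (IsScalarTower.toAlgHom E M Ω).comp (IsScalarTower.toAlgHom E L M)
  have ha : a ∈ IntermediateField.adjoin E {x, y} := hgen ▸ IntermediateField.mem_top
  change f₁ a = f₂ a
  induction ha using IntermediateField.adjoin_induction with
  | mem b hb =>
    rcases hb with rfl | rfl
    · exact hx
    · exact hy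
  | algebraMap b => simp only [AlgHom.commutes]
  | add b c _ _ hb hc => rw [map_add, map_add, hb, hc]
  | inv b _ hb => rw [map_inv₀, map_inv₀, hb]
  | mul b c _ _ hb hc => rw [map_mul, map_mul, hb, hc]

lemma injective_of_fixes_pencil [CharZero E] [Algebra.IsAlgebraic M Ω] (hcl : RelClosed E L)
    {x y : L} (hx : Transcendental E x) (halg : ∀ a : L, IsAlgebraic (Algebra.adjoin E {x}) a)
    (hgen : IntermediateField.adjoin E {x, y} = ⊤)
    {g : M →ₐ[E] Ω} (hg : g ≠ IsScalarTower.toAlgHom E M Ω)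
    (hs : g (par M L) = algebraMap M Ω (par M L))
    (hw : g (algebraMap L M x + par M L * algebraMap L M y) =
      algebraMap M Ω (algebraMap L M x + par M L * algebraMap L M y)) :
    Function.Injective (Algebra.TensorProduct.productMap (IsScalarTower.toAlgHom E L Ω)
      (g.comp (IsScalarTower.toAlgHom E L M))) := by
  have hy := ne_of_fixes_pencil hgen hg hs hw
  obtain ⟨δ, hδ⟩ := exists_derivation_eq_one hx halg
  obtain ⟨D₀, hD₀⟩ := exists_derivation_par (E := E) (L := L) (M := M)
  have : CharZero M := charZero_of_injective_algebraMap (algebraMap E M).injective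
  have := formallyEtale_of_isAlgebraic M Ω
  obtain ⟨D, hD⟩ := exists_derivation_extension (E := E) (P := M) (Z := Ω) (N := Ω)
    ((Algebra.linearMap M Ω).compDer D₀)
  have hDM : ∀ m : M, D (algebraMap M Ω m) = algebraMap M Ω (D₀ m) := hD
  have hDL : ∀ a : L, D (algebraMap L Ω a) = 0 := fun a => by
    rw [IsScalarTower.algebraMap_apply L M Ω, hDM, ← algebraMap_C (L := L) (M := M), hD₀]
    simp
  have hDs : D (algebraMap M Ω (par M L)) = 1 := by
    rw [hDM, par, hD₀]
    simp
  let gL : L →ₐ[E] Ω := g.comp (IsScalarTower.toAlgHom E L M)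
  have hcomp := derivation_comp_eq halg gL D hδ
  have hh : D (gL x) ≠ 0 := by
    intro h0
    have h1 : D (gL y) = 0 := by rw [hcomp, h0, zero_mul]
    have h2 := congrArg D hw
    rw [map_add g, map_mul g, map_add (algebraMap M Ω), map_mul (algebraMap M Ω), hs, map_add,
      map_add,
      Derivation.leibniz,
      Derivation.leibniz, hDs, ← IsScalarTower.algebraMap_apply L M Ω,
      ← IsScalarTower.algebraMap_apply L M Ω, hDL, hDL] at h2
    change D (gL x) + (_ • D (gL y) + gL y • 1) = _ at h2
    rw [h0, h1] at h2
    apply hy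
    rw [← IsScalarTower.algebraMap_apply L M Ω]
    change gL y = _
    simpa using h2
  let DL : Ω →ₗ[L] Ω :=
    { toFun := D
      map_add' := map_add D
      map_smul' := fun a b => by
        simp [Algebra.smul_def, hDL] }
  exact injective_productMap (δ := δ) (fun c hc => hcl.mem_range_of_derivation_eq_zero halg hδ hc)
    (D := DL) hh hcomp

/-- Whether a conjugate fixing the pencil field fixes a given element is decided by an identity
in the tensor square which does not depend on the conjugate. -/
lemma exists_fixes_iff [CharZero E] [Algebra.IsAlgebraic M Ω] (hcl : RelClosed E L)
    {x y : L} (hx : Transcendental E x) (halg : ∀ a : L, IsAlgebraic (Algebra.adjoin E {x}) a)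
    (hgen : IntermediateField.adjoin E {x, y} = ⊤) (θ : M) :
    ∃ p : Prop, ∀ g : M →ₐ[E] Ω, g ≠ IsScalarTower.toAlgHom E M Ω →
      g (par M L) = algebraMap M Ω (par M L) →
      g (algebraMap L M x + par M L * algebraMap L M y) =
        algebraMap M Ω (algebraMap L M x + par M L * algebraMap L M y) →
      (g θ = algebraMap M Ω θ ↔ p) := by
  obtain ⟨P, Q, hQ, rfl⟩ := IsFractionRing.div_surjective (A := L[X]) θ
  have hQ0 : algebraMap L[X] M Q ≠ 0 := by
    simpa using nonZeroDivisors.ne_zero hQ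
  let σ₁ : L →+* L ⊗[E] L := Algebra.TensorProduct.includeLeftRingHom
  let σ₂ : L →+* L ⊗[E] L := (Algebra.TensorProduct.includeRight : L →ₐ[E] L ⊗[E] L).toRingHom
  let F : (L ⊗[E] L)[X] := P.map σ₂ * Q.map σ₁ - P.map σ₁ * Q.map σ₂
  refine ⟨∑ i ∈ Finset.range (F.natDegree + 1), F.coeff i * (σ₁ x - σ₂ x) ^ i *
    (σ₂ y - σ₁ y) ^ (F.natDegree - i) = 0, fun g hg hs hw => ?_⟩
  have hinj := injective_of_fixes_pencil hcl hx halg hgen hg hs hw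
  set μ := Algebra.TensorProduct.productMap (IsScalarTower.toAlgHom E L Ω)
      (g.comp (IsScalarTower.toAlgHom E L M)) with hμ
  have hμ₁ : ∀ a, μ (σ₁ a) = algebraMap M Ω (algebraMap L M a) := fun a => by
    simp [hμ, σ₁, ← IsScalarTower.algebraMap_apply]
  have hμ₂ : ∀ a, μ (σ₂ a) = g (algebraMap L M a) := fun a => by
    simp [hμ, σ₂]
  have hb : μ.toRingHom (σ₂ y - σ₁ y) ≠ 0 := by
    change μ _ ≠ 0
    rw [map_sub, hμ₁, hμ₂, sub_ne_zero]
    exact ne_of_fixes_pencil hgen hg hs hw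
  have hs' : μ.toRingHom (σ₂ y - σ₁ y) * algebraMap M Ω (par M L) =
      μ.toRingHom (σ₁ x - σ₂ x) := by
    change μ _ * _ = μ _
    rw [map_sub, map_sub, hμ₁, hμ₂, hμ₁, hμ₂]
    rw [map_add, map_mul, map_add, map_mul, hs] at hw
    linear_combination hw
  rw [← eval₂_eq_zero_iff_sum μ.toRingHom hinj F hb hs']
  have e₁ : ∀ R : L[X], (R.map σ₁).eval₂ μ.toRingHom (algebraMap M Ω (par M L)) =
      algebraMap M Ω (algebraMap L[X] M R) := fun R => by
    rw [map_algebraMap_polynomial, Polynomial.eval₂_map]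
    congr 1
    ext a
    exact hμ₁ a
  have e₂ : ∀ R : L[X], (R.map σ₂).eval₂ μ.toRingHom (algebraMap M Ω (par M L)) =
      g (algebraMap L[X] M R) := fun R => by
    rw [← hs, ← AlgHom.coe_toRingHom, map_algebraMap_polynomial, Polynomial.eval₂_map]
    congr 1
    ext a
    exact hμ₂ a
  have hQ1 : algebraMap M Ω (algebraMap L[X] M Q) ≠ 0 := by simpa using hQ0
  have hQ2 : g (algebraMap L[X] M Q) ≠ 0 := by simpa using hQ0
  rw [map_div₀, map_div₀, div_eq_div_iff hQ2 hQ1, Polynomial.eval₂_sub, Polynomial.eval₂_mul,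
    Polynomial.eval₂_mul, e₁, e₁, e₂, e₂, sub_eq_zero]

end Conjugates

section Primitive

variable {E L M : Type} [Field E] [Field L] [Field M] [Algebra E L] [Algebra E M] [Algebra L M]
  [Algebra L[X] M] [IsFractionRing L[X] M] [IsScalarTower L L[X] M] [IsScalarTower E L M]

/-- A general pencil field has no proper intermediate field below the full field. -/
lemma adjoin_eq_top_of_notMem_bot [CharZero E] (hcl : RelClosed E L)
    {x y : L} (hx : Transcendental E x) (halg : ∀ a : L, IsAlgebraic (Algebra.adjoin E {x}) a)
    (hgen : IntermediateField.adjoin E {x, y} = ⊤) [FiniteDimensional (pencilField E M x y) M]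
    (θ : M) (hθ : θ ∉ (⊥ : IntermediateField (pencilField E M x y) M)) :
    IntermediateField.adjoin (pencilField E M x y) {θ} = ⊤ := by
  set K := pencilField E M x y with hK
  let Ω := AlgebraicClosure M
  have : CharZero K := charZero_of_injective_algebraMap (algebraMap E K).injective
  obtain ⟨p, hp⟩ := exists_fixes_iff (M := M) (Ω := Ω) hcl hx halg hgen θ
  let ι : M →ₐ[K] Ω := IsScalarTower.toAlgHom K M Ω
  have hp' : ∀ g : M →ₐ[K] Ω, g ≠ ι → (g θ = algebraMap M Ω θ ↔ p) := by
    intro g hg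
    have hfix : ∀ a ∈ K, g a = algebraMap M Ω a := fun a ha => g.commutes ⟨a, ha⟩
    refine hp (g.restrictScalars E) (fun h => hg ?_) (hfix _ (par_mem x y)) (hfix _ (pencil_mem x y))
    exact AlgHom.ext fun m => DFunLike.congr_fun h m
  have hsplit : ∀ m : M, ((minpoly K m).map (algebraMap K Ω)).Splits := fun m =>
    IsAlgClosed.splits _
  rw [Field.primitive_element_iff_algHom_eq_of_eval K Ω hsplit θ ι]
  intro g hg
  by_contra hne
  have hpt : p := (hp' g (Ne.symm hne)).mp hg.symm
  apply hθ
  have hall : ∀ f : M →ₐ[K] Ω, f θ = algebraMap M Ω θ := fun f => by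
    by_cases h : f = ι
    · rw [h]; rfl
    · exact (hp' f h).mpr hpt
  have hInt : IsIntegral K θ := IsIntegral.of_finite K θ
  have hroot : ∀ a ∈ (minpoly K θ).rootSet Ω, a = algebraMap M Ω θ := by
    intro a ha
    rw [← Algebra.IsAlgebraic.range_eval_eq_rootSet_minpoly_of_splits Ω hsplit θ] at ha
    obtain ⟨f, rfl⟩ := ha
    exact hall f
  have hcard := Polynomial.card_rootSet_eq_natDegree (K := Ω)
    (Algebra.IsSeparable.isSeparable K θ) (hsplit θ)
  have hle : Fintype.card ((minpoly K θ).rootSet Ω) ≤ 1 := by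
    rw [Fintype.card_le_one_iff_subsingleton]
    exact ⟨fun a b => Subtype.ext ((hroot _ a.2).trans (hroot _ b.2).symm)⟩
  rw [IntermediateField.mem_bot]
  refine (minpoly.natDegree_eq_one_iff (A := K)).mp (le_antisymm (hcard ▸ hle) ?_)
  exact minpoly.natDegree_pos hInt

end Primitive

end BaseChange

section Generation

variable {E L M : Type} [Field E] [Field L] [Field M] [Algebra E L] [Algebra E M] [Algebra L M]
  [Algebra L[X] M] [IsFractionRing L[X] M] [IsScalarTower L L[X] M] [IsScalarTower E L M]

lemma adjoin_image_eq_top {K : IntermediateField E M} (hK : par M L ∈ K) {S : Set L}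
    (hS : IntermediateField.adjoin E S = ⊤) :
    IntermediateField.adjoin K (algebraMap L M '' S) = ⊤ := by
  set N := IntermediateField.adjoin K (algebraMap L M '' S) with hN
  have hL : ∀ a : L, algebraMap L M a ∈ N := by
    intro a
    have ha : a ∈ IntermediateField.adjoin E S := hS ▸ IntermediateField.mem_top
    induction ha using IntermediateField.adjoin_induction with
    | mem b hb => exact IntermediateField.subset_adjoin _ _ ⟨b, hb, rfl⟩
    | algebraMap b =>
      rw [← IsScalarTower.algebraMap_apply E L M, IsScalarTower.algebraMap_apply E K M]
      exact N.algebraMap_mem _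
    | add b c _ _ hb hc => rw [map_add]; exact N.add_mem hb hc
    | inv b _ hb => rw [map_inv₀]; exact N.inv_mem hb
    | mul b c _ _ hb hc => rw [map_mul]; exact N.mul_mem hb hc
  have hs : par M L ∈ N := N.algebraMap_mem ⟨par M L, hK⟩
  have hp : ∀ p : L[X], algebraMap L[X] M p ∈ N := by
    intro p
    induction p using Polynomial.induction_on' with
    | add p q hp hq => rw [map_add]; exact N.add_mem hp hq
    | monomial k a =>
      rw [← Polynomial.C_mul_X_pow_eq_monomial, map_mul, map_pow, algebraMap_C]
      exact N.mul_mem (hL a) (pow_mem hs k)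
  rw [eq_top_iff]
  intro m _
  obtain ⟨p, q, -, rfl⟩ := IsFractionRing.div_surjective (A := L[X]) m
  exact N.div_mem (hp p) (hp q)

lemma adjoin_extSpan_eq_top {K : IntermediateField E M} (hK : par M L ∈ K) {V : Submodule E L}
    (hV : IntermediateField.adjoin E (V : Set L) = ⊤) :
    IntermediateField.adjoin K (extSpan K V : Set M) = ⊤ := by
  rw [eq_top_iff, ← adjoin_image_eq_top hK hV]
  refine IntermediateField.adjoin.mono _ _ _ ?_
  rintro _ ⟨a, ha, rfl⟩
  exact mem_extSpan K ha

lemma exists_finite_adjoin_eq_top {V : Submodule E L} [h : Module.Finite E V]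
    (hV : IntermediateField.adjoin E (V : Set L) = ⊤) :
    ∃ S : Set L, S.Finite ∧ S ⊆ V ∧ IntermediateField.adjoin E S = ⊤ := by
  obtain ⟨S, hS⟩ := Module.Finite.iff_fg.mp h
  refine ⟨S, S.finite_toSet, ?_, ?_⟩
  · rw [← hS]; exact Submodule.subset_span
  · rw [eq_top_iff, ← hV, IntermediateField.adjoin_le_iff, ← hS]
    intro a ha
    induction ha using Submodule.span_induction with
    | mem b hb => exact IntermediateField.subset_adjoin _ _ hb
    | zero => exact zero_mem _
    | add b c _ _ hb hc => exact add_mem hb hc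
    | smul e b _ hb => exact IntermediateField.smul_mem _ hb

lemma adjoin_eq_top_of_tower {F : IntermediateField E L} {S : Set L}
    (hS : IntermediateField.adjoin E S = ⊤) : IntermediateField.adjoin F S = ⊤ := by
  rw [← IntermediateField.restrictScalars_eq_top_iff (K := E), eq_top_iff, ← hS,
    IntermediateField.adjoin_le_iff]
  exact IntermediateField.subset_adjoin _ _

lemma finiteDimensional_of_adjoin_eq_top {S : Set L} (hfin : S.Finite)
    (hInt : ∀ a ∈ S, IsIntegral E a) (hS : IntermediateField.adjoin E S = ⊤) :
    FiniteDimensional E L := by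
  have := hfin.to_subtype
  have := IntermediateField.finiteDimensional_adjoin hInt
  rw [hS] at this
  exact Module.Finite.equiv (IntermediateField.topEquiv (F := E) (E := L)).toLinearEquiv

/-- Over an infinite base field, a generating space of functions on a curve contains an element
generating the function field over `E(x)`. -/
lemma exists_adjoin_pair_eq_top [CharZero E] {V : Submodule E L} [Module.Finite E V] {x : L}
    (hInt : ∀ θ ∈ V, IsIntegral (IntermediateField.adjoin E {x}) θ)
    (hV : IntermediateField.adjoin E (V : Set L) = ⊤) :
    ∃ y ∈ V, IntermediateField.adjoin E {x, y} = ⊤ := by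
  set F := IntermediateField.adjoin E {x}
  have : CharZero F := charZero_of_injective_algebraMap (algebraMap E F).injective
  obtain ⟨S, hfin, hSV, hS⟩ := exists_finite_adjoin_eq_top hV
  have : FiniteDimensional F L := finiteDimensional_of_adjoin_eq_top hfin
    (fun a ha => hInt a (hSV ha)) (adjoin_eq_top_of_tower hS)
  have := Field.finite_intermediateField_of_exists_primitive_element F L
    (Field.exists_primitive_element F L)
  by_contra! hcon
  let p : {N : IntermediateField F L // N ≠ ⊤} → Subspace E V := fun N =>
    (N.1.restrictScalars E).toSubalgebra.toSubmodule.comap V.subtype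
  have hcov : ⋃ i, (p i : Set V) = Set.univ := by
    rw [Set.eq_univ_iff_forall]
    intro y
    refine Set.mem_iUnion.mpr ⟨⟨IntermediateField.adjoin F {(y : L)}, fun h => ?_⟩, ?_⟩
    · refine hcon y y.2 ?_
      rw [← IntermediateField.adjoin_simple_adjoin_simple]
      exact (IntermediateField.restrictScalars_eq_top_iff (K := E)).mpr h
    · exact IntermediateField.mem_adjoin_simple_self F (y : L)
  obtain ⟨N, hN⟩ := Subspace.exists_eq_top_of_iUnion_eq_univ hcov
  refine N.2 ?_
  rw [← IntermediateField.restrictScalars_eq_top_iff (K := E), eq_top_iff, ← hV,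
    IntermediateField.adjoin_le_iff]
  intro a ha
  have : (⟨a, ha⟩ : V) ∈ p N := hN ▸ Submodule.mem_top
  exact this

lemma isIntegral_pencil_of_mem {x y : L} (hx : Transcendental E x)
    (hy : IsAlgebraic (Algebra.adjoin E {x}) y) :
    IsIntegral (pencilField E M x y) (algebraMap L M x) := by
  set x' := algebraMap L M x with hx'
  set y' := algebraMap L M y with hy'
  set w := x' + par M L * y' with hw
  have hind : AlgebraicIndependent E ![par M L, w] := algebraicIndependent_pencil hx y
  have h1 : ¬ IsAlgebraic (Algebra.adjoin E {par M L}) w := by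
    have := hind.transcendental_adjoin (s := {0}) (i := 1) (by simp)
    rw [Set.image_singleton] at this
    exact this
  have hle : Algebra.adjoin E {x'} ≤ Algebra.adjoin E {x', par M L} :=
    Algebra.adjoin_mono (by simp)
  have hy0 : IsAlgebraic (Algebra.adjoin E {x'}) y' := by
    let φ : Algebra.adjoin E {x} →ₐ[E] Algebra.adjoin E {x'} := AlgHom.codRestrict
      ((IsScalarTower.toAlgHom E L M).comp (Algebra.adjoin E {x}).val) _ (by
        rintro ⟨b, hb⟩
        have : Algebra.adjoin E {x} ≤
            (Algebra.adjoin E {x'}).comap (IsScalarTower.toAlgHom E L M) := by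
          rw [Algebra.adjoin_le_iff, Set.singleton_subset_iff]
          exact Algebra.subset_adjoin rfl
        exact this hb)
    refine hy.ringHom_of_comp_eq φ.toRingHom (algebraMap L M) ?_ rfl
    intro a b hab
    apply Subtype.ext
    apply (algebraMap L M).injective
    exact congrArg Subtype.val hab
  have hy1 : IsAlgebraic (Algebra.adjoin E {x', par M L}) y' := hy0.tower_top_of_subalgebra_le hle
  have h2 : IsAlgebraic (Algebra.adjoin E {x', par M L}) w := by
    have hgen : ∀ a ∈ ({x', par M L} : Set M),
        IsAlgebraic (Algebra.adjoin E {x', par M L}) a := fun a ha =>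
      isAlgebraic_algebraMap (⟨a, Algebra.subset_adjoin ha⟩ : Algebra.adjoin E {x', par M L})
    exact (hgen _ (by simp)).add ((hgen _ (by simp)).mul hy1)
  have h3 := isAlgebraic_exchange h2 h1
  have hK : Algebra.adjoin E {w, par M L} ≤ (pencilField E M x y).toSubalgebra := by
    rw [Algebra.adjoin_le_iff]
    rintro _ (rfl | rfl)
    · exact pencil_mem x y
    · exact par_mem x y
  have h4 : IsAlgebraic (pencilField E M x y).toSubalgebra x' := h3.tower_top_of_subalgebra_le hK
  exact IsAlgebraic.isIntegral h4

lemma finiteDimensional_pencil {V : Submodule E L} [Module.Finite E V] {x y : L}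
    (hInt : ∀ θ ∈ V, IsIntegral (Algebra.adjoin E {x}) θ) (hy : y ∈ V) (hx : Transcendental E x)
    (hV : IntermediateField.adjoin E (V : Set L) = ⊤) :
    FiniteDimensional (pencilField E M x y) M := by
  set K := pencilField E M x y
  obtain ⟨S, hfin, hSV, hS⟩ := exists_finite_adjoin_eq_top hV
  refine finiteDimensional_of_adjoin_eq_top (hfin.image (algebraMap L M)) ?_
    (adjoin_image_eq_top (par_mem x y) hS)
  rintro _ ⟨a, ha, rfl⟩
  have hxK : IsIntegral K (algebraMap L M x) := isIntegral_pencil_of_mem hx (hInt y hy).isAlgebraic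
  let A := integralClosure K M
  let φ : Algebra.adjoin E {x} →ₐ[E] A := AlgHom.codRestrict
    ((IsScalarTower.toAlgHom E L M).comp (Algebra.adjoin E {x}).val) (A.restrictScalars E) (by
      rintro ⟨b, hb⟩
      have : Algebra.adjoin E {x} ≤
          (A.restrictScalars E).comap (IsScalarTower.toAlgHom E L M) := by
        rw [Algebra.adjoin_le_iff, Set.singleton_subset_iff]
        exact hxK
      exact this hb)
  have h1 : IsIntegral A (algebraMap L M a) :=
    IsIntegral.map_of_comp_eq φ.toRingHom (algebraMap L M) rfl (hInt a (hSV ha))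
  exact isIntegral_trans _ h1

end Generation

section Lower

lemma Normalized.le_finrank_sq_of_curve {E L : Type} [Field E] [CharZero E] [Field L] [Algebra E L]
    {r : ℕ} {V : Submodule E L} {u : Fin 1 → L} {z : Fin r → L} (h : Normalized V u z)
    (hcl : RelClosed E L) (hV : IntermediateField.adjoin E (V : Set L) = ⊤) :
    Module.finrank E V + min r (2 * (Module.finrank E V - 1) - 1) ≤
      Module.finrank E (V ^ 2 : Submodule E L) := by
  let M := FractionRing L[X]
  have := h.finite
  have hx : Transcendental E (u 0) := h.algebraicIndependent.transcendental 0
  have hrange : Algebra.adjoin E (Set.range u) ≤ Algebra.adjoin E {u 0} :=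
    Algebra.adjoin_mono (by
      rintro _ ⟨i, rfl⟩
      rw [Fin.fin_one_eq_zero i]
      rfl)
  have hInt : ∀ θ ∈ V, IsIntegral (Algebra.adjoin E {u 0}) θ := fun θ hθ =>
    IsIntegral.map_of_comp_eq (Subalgebra.inclusion hrange).toRingHom (RingHom.id L) rfl
      (h.isIntegral hθ)
  have hInt' : ∀ θ ∈ V, IsIntegral (IntermediateField.adjoin E {u 0}) θ := fun θ hθ =>
    IsIntegral.map_of_comp_eq (Subalgebra.inclusion
      (IntermediateField.algebra_adjoin_le_adjoin E {u 0})).toRingHom (RingHom.id L) rfl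
      (hInt θ hθ)
  obtain ⟨y, hyV, hxy⟩ := exists_adjoin_pair_eq_top hInt' hV
  have halg : ∀ a : L, IsAlgebraic (Algebra.adjoin E {u 0}) a := by
    intro a
    have ha : a ∈ IntermediateField.adjoin E (V : Set L) := hV ▸ IntermediateField.mem_top
    induction ha using IntermediateField.adjoin_induction with
    | mem b hb => exact (hInt b hb).isAlgebraic
    | algebraMap b => exact isAlgebraic_algebraMap (algebraMap E (Algebra.adjoin E {u 0}) b)
    | add b c _ _ hb hc => exact hb.add hc
    | inv b _ hb => exact hb.inv
    | mul b c _ _ hb hc => exact hb.mul hc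
  set K := pencilField E M (u 0) y with hK
  have : FiniteDimensional K M := finiteDimensional_pencil hInt hyV hx hV
  have hprim := adjoin_eq_top_of_notMem_bot (M := M) hcl hx halg hxy
  have h1 : (1 : M) ∈ extSpan K V := by simpa using mem_extSpan K h.one_mem
  have hne : extSpan K V ≠ ⊥ := fun h0 => by
    rw [h0, Submodule.mem_bot] at h1
    exact one_ne_zero h1
  have hmin : min (Module.finrank K M)
      (Module.finrank K (extSpan K V) + Module.finrank K (extSpan K V) - 1) ≤
      Module.finrank K (extSpan K V ^ 2 : Submodule K M) := by
    rw [pow_two]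
    exact min_le_finrank_mul hprim _ _ hne h1
  have hsq := finrank_extSpan_sq_le (M := M) h.one_mem (h.mem 0) hyV hx
  have hge := h.finrank_le_finrank_extSpan (M := M) hcl y
  have hr : r ≤ Module.finrank K M := by
    have hli := (polyIndep_monFamily h.indep).linearIndependent (M := M) y
    have hinj : Function.Injective fun i : Fin r => (⟨i, 0⟩ : Σ _ : Fin r, (Fin 0 →₀ ℕ)) :=
      fun i j hij => congrArg Sigma.fst hij
    simpa using (hli.comp _ hinj).fintype_card_le_finrank
  have hsq' : Module.finrank K (extSpan K V ^ 2 : Submodule K M) +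
    Module.finrank K (extSpan K V) + 1 ≤ Module.finrank E (V ^ 2 : Submodule E L) := hsq
  have hge' : Module.finrank E V ≤ Module.finrank K (extSpan K V) + 1 := hge
  clear hsq hge
  have : min r (2 * (Module.finrank E V - 1) - 1) ≤ min (Module.finrank K M)
      (Module.finrank K (extSpan K V) + Module.finrank K (extSpan K V) - 1) := by
    refine min_le_min hr ?_
    omega
  omega

lemma Normalized.le_finrank_sq {E L : Type} [Field E] [CharZero E] [Field L] [Algebra E L]
    {n r : ℕ} {V : Submodule E L} {u : Fin (n + 1) → L} {z : Fin r → L} (h : Normalized V u z)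
    (hcl : RelClosed E L) (hV : IntermediateField.adjoin E (V : Set L) = ⊤) :
    ∑ i ∈ Finset.range (n + 1), (Module.finrank E V - i) +
      min r (2 * (Module.finrank E V - (n + 1)) - 1) ≤
      Module.finrank E (V ^ 2 : Submodule E L) := by
  induction n generalizing E L with
  | zero => simpa using h.le_finrank_sq_of_curve hcl hV
  | succ n ih =>
    let M := FractionRing L[X]
    have := h.finite
    have hx : Transcendental E (u 0) := h.algebraicIndependent.transcendental 0
    obtain ⟨Y, hY, hYV, hclK⟩ := h.exists_pencil (M := M) hcl
    set y := aeval (Fin.tail u) Y with hy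
    have hN := ih (h.pencil (M := M) Y hY) (hclK (Nat.succ_ne_zero n))
      (adjoin_extSpan_eq_top (par_mem (u 0) y) hV)
    have hsq := finrank_extSpan_sq_le (M := M) h.one_mem (h.mem 0) hYV hx
    have hge := h.finrank_le_finrank_extSpan (M := M) hcl y
    rw [← hy] at hN
    set K := pencilField E M (u 0) y
    have hsum : ∑ i ∈ Finset.range (n + 1), (Module.finrank E V - (i + 1)) ≤
        ∑ i ∈ Finset.range (n + 1), (Module.finrank K (extSpan K V) - i) :=
      Finset.sum_le_sum fun i _ => by omega
    have hmin : min r (2 * (Module.finrank E V - (n + 1 + 1)) - 1) ≤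
        min r (2 * (Module.finrank K (extSpan K V) - (n + 1)) - 1) :=
      min_le_min le_rfl (by omega)
    rw [Finset.sum_range_succ', Nat.sub_zero]
    omega

end Lower

section Reduction

variable {E L : Type} [Field E] [Field L] [Algebra E L]

lemma prod_pow_mem_pow {V : Submodule E L} {p : ℕ} {v : Fin p → L} (hv : ∀ i, v i ∈ V)
    (s : Fin p →₀ ℕ) : ∏ i, v i ^ s i ∈ V ^ s.degree := by
  rw [Finsupp.degree_eq_sum, ← Finset.prod_pow_eq_pow_sum]
  generalize (Finset.univ : Finset (Fin p)) = J
  classical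
  induction J using Finset.induction_on with
  | empty => simp
  | insert i J hi ih =>
    rw [Finset.prod_insert hi, Finset.prod_insert hi]
    exact Submodule.mul_mem_mul (Submodule.pow_mem_pow V (hv i) _) ih

lemma aeval_mem_pow_of_totalDegree_le {V : Submodule E L} (h1 : 1 ∈ V) {p : ℕ} {v : Fin p → L}
    (hv : ∀ i, v i ∈ V) {g : MvPolynomial (Fin p) E} {e : ℕ} (hg : g.totalDegree ≤ e) :
    aeval v g ∈ V ^ e := by
  rw [g.as_sum, map_sum]
  refine Submodule.sum_mem _ fun s hs => ?_
  rw [aeval_monomial, Finsupp.prod_fintype _ _ fun i => pow_zero _, ← Algebra.smul_def]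
  refine Submodule.smul_mem _ _ (pow_le_pow_of_one_mem h1 ?_ (prod_pow_mem_pow hv s))
  exact (le_totalDegree hs).trans hg

lemma aeval_sub_const_mem {V : Submodule E L} (h1 : 1 ∈ V) {p : ℕ} {v : Fin p → L}
    (hv : ∀ i, v i ∈ V) {g : MvPolynomial (Fin p) E} {e : ℕ} (hg : g.totalDegree ≤ e + 1) :
    aeval v g - algebraMap E L (constantCoeff g) ∈ Submodule.span E (Set.range v) * V ^ e := by
  have h : aeval v g - algebraMap E L (constantCoeff g) = ∑ s ∈ g.support,
      (aeval v (monomial s (g.coeff s)) -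
        algebraMap E L (constantCoeff (monomial s (g.coeff s)))) := by
    rw [Finset.sum_sub_distrib, ← map_sum, ← map_sum, ← map_sum, ← g.as_sum]
  rw [h]
  refine Submodule.sum_mem _ fun s hs => ?_
  have hsd : s.degree ≤ e + 1 := (le_totalDegree hs).trans hg
  by_cases h0 : s = 0
  · subst h0
    simp
  · obtain ⟨i, hi⟩ := Finsupp.ne_iff.mp h0
    have hle : Finsupp.single i 1 ≤ s := by
      rw [Finsupp.single_le_iff]
      exact Nat.one_le_iff_ne_zero.mpr hi
    obtain ⟨t, rfl⟩ := exists_add_of_le hle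
    have ht : t.degree ≤ e := by
      rw [map_add, Finsupp.degree_single] at hsd
      omega
    rw [constantCoeff_monomial, if_neg h0, map_zero, sub_zero, aeval_monomial,
      Finsupp.prod_fintype _ _ fun i => pow_zero _, ← Algebra.smul_def]
    refine Submodule.smul_mem _ _ ?_
    have : ∏ j, v j ^ ((Finsupp.single i 1 + t : Fin p →₀ ℕ) j) = v i * ∏ j, v j ^ t j := by
      simp only [Finsupp.add_apply, pow_add, Finset.prod_mul_distrib]
      congr 1
      rw [Finset.prod_eq_single i (fun j _ hj => by simp [Finsupp.single_eq_of_ne hj]) (by simp),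
        Finsupp.single_eq_same, pow_one]
    rw [this]
    exact Submodule.mul_mem_mul (Submodule.subset_span ⟨i, rfl⟩)
      (pow_le_pow_of_one_mem h1 ht (prod_pow_mem_pow hv t))

lemma pow_add_le_of_reduction {V T : Submodule E L} {m : ℕ} (h : V ^ (m + 1) ≤ T * V ^ m)
    (j : ℕ) : V ^ (m + j) ≤ T ^ j * V ^ m := by
  induction j with
  | zero => simp
  | succ j ih =>
    calc V ^ (m + (j + 1)) = V ^ (m + j) * V := by rw [← add_assoc, pow_succ]
      _ ≤ T ^ j * V ^ m * V := mul_le_mul' ih le_rfl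
      _ = T ^ j * V ^ (m + 1) := by rw [mul_assoc, ← pow_succ]
      _ ≤ T ^ j * (T * V ^ m) := mul_le_mul' le_rfl h
      _ = T ^ (j + 1) * V ^ m := by rw [← mul_assoc, ← pow_succ]

lemma one_sup_pow_le {V T : Submodule E L} (h1 : 1 ∈ V) (hT : T ≤ V) (j : ℕ) :
    (1 ⊔ T) ^ (j + 1) ≤ 1 ⊔ T * V ^ j := by
  have h1' : (1 : Submodule E L) ≤ V := Submodule.one_le.mpr h1
  induction j with
  | zero => simp
  | succ j ih =>
    rw [pow_succ]
    refine (mul_le_mul' ih le_rfl).trans ?_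
    rw [Submodule.sup_mul, Submodule.mul_sup, Submodule.mul_sup, one_mul, one_mul, mul_one]
    refine sup_le (sup_le le_sup_left (le_sup_of_le_right ?_)) (sup_le (le_sup_of_le_right ?_)
      (le_sup_of_le_right ?_))
    · exact le_mul_of_one_le_right' 
        (by simpa using pow_le_pow_of_one_mem h1 (Nat.zero_le (j + 1)))
    · exact mul_le_mul' le_rfl (pow_le_pow_of_one_mem h1 (Nat.le_succ j))
    · rw [mul_assoc, pow_succ]
      exact mul_le_mul' le_rfl (mul_le_mul' le_rfl hT)

lemma exists_reduction_of_relation [Infinite E] {V : Submodule E L} (h1 : 1 ∈ V) {p : ℕ}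
    {u : Fin p → L} (hu : ∀ i, u i ∈ V) {m : ℕ}
    (hm : V ^ (m + 1) ≤ (1 ⊔ Submodule.span E (Set.range u)) * V ^ m)
    (hdep : ¬ AlgebraicIndependent E u) :
    ∃ v : Fin p → L, (∀ i, v i ∈ V) ∧ ∃ m', V ^ (m' + 1) ≤
      Submodule.span E (Set.range v) * V ^ m' := by
  rw [algebraicIndependent_iff] at hdep
  push Not at hdep
  obtain ⟨g, hg, hg0⟩ := hdep
  obtain ⟨b, hb⟩ : ∃ b, eval b g ≠ 0 := by
    by_contra! hcon
    exact hg0 (MvPolynomial.funext fun b => by rw [hcon, map_zero])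
  let v : Fin p → L := fun i => u i - algebraMap E L (b i)
  have hv : ∀ i, v i ∈ V := fun i => Submodule.sub_mem _ (hu i) (by
    rw [Algebra.algebraMap_eq_smul_one]
    exact Submodule.smul_mem _ _ h1)
  let g' : MvPolynomial (Fin p) E := aeval (fun i => X i + C (b i)) g
  have hg' : aeval v g' = 0 := by
    rw [← hg]
    change aeval v (aeval _ g) = _
    rw [← AlgHom.comp_apply, comp_aeval]
    congr 2
    ext i
    simp [v]
  have hc : constantCoeff g' = eval b g := by
    have : (constantCoeff (R := E) (σ := Fin p)).comp
        (aeval (fun i => X i + C (b i)) : MvPolynomial (Fin p) E →ₐ[E] _).toRingHom = eval b := by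
      ext i
      · simp
      · simp
    exact DFunLike.congr_fun this g
  set T := Submodule.span E (Set.range v) with hT
  have hTV : T ≤ V := Submodule.span_le.mpr (by rintro _ ⟨i, rfl⟩; exact hv i)
  set e := g'.totalDegree
  have h1T : (1 : Submodule E L) ≤ T * V ^ e := by
    have := aeval_sub_const_mem h1 hv (Nat.le_succ e)
    rw [hg', hc, zero_sub, Submodule.neg_mem_iff, Algebra.algebraMap_eq_smul_one] at this
    rw [Submodule.one_le]
    exact (Submodule.smul_mem_iff _ hb).mp this
  have hspan : (1 : Submodule E L) ⊔ Submodule.span E (Set.range u) ≤ 1 ⊔ T := by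
    refine sup_le le_sup_left (Submodule.span_le.mpr ?_)
    rintro _ ⟨i, rfl⟩
    have : u i = algebraMap E L (b i) + v i := by simp [v]
    rw [this]
    exact Submodule.add_mem_sup (Submodule.algebraMap_mem _) (Submodule.subset_span ⟨i, rfl⟩)
  refine ⟨v, hv, m + e, ?_⟩
  calc V ^ (m + e + 1) ≤ (1 ⊔ Submodule.span E (Set.range u)) ^ (e + 1) * V ^ m :=
        pow_add_le_of_reduction hm (e + 1)
    _ ≤ (T * V ^ e) * V ^ m := mul_le_mul' ((pow_le_pow_left' hspan _).trans
        ((one_sup_pow_le h1 hTV e).trans (sup_le h1T le_rfl))) le_rfl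
    _ = T * V ^ (m + e) := by rw [mul_assoc, ← pow_add, add_comm e m]

lemma span_singleton_mul_pow (a : L) (V : Submodule E L) (m : ℕ) :
    (Submodule.span E {a} * V) ^ m = Submodule.span E {a ^ m} * V ^ m := by
  rw [mul_pow, Submodule.span_pow, Set.singleton_pow]

lemma finrank_span_singleton_mul {a : L} (ha : a ≠ 0) (V : Submodule E L) :
    Module.finrank E (Submodule.span E {a} * V : Submodule E L) = Module.finrank E V := by
  have : Submodule.span E {a} * V = V.map (LinearMap.mulLeft E a) := by
    ext x
    rw [Submodule.mem_span_singleton_mul]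
    simp
  rw [this]
  exact (Submodule.equivMapOfInjective _ (mul_right_injective₀ ha) V).finrank_eq.symm

lemma exists_one_sup_span_eq {S : Submodule E L} (h1 : 1 ∈ S) [Module.Finite E S] :
    ∃ (p : ℕ) (u : Fin p → L), 1 ⊔ Submodule.span E (Set.range u) = S ∧
      Module.finrank E S = p + 1 := by
  obtain ⟨K, hK⟩ := Submodule.exists_isCompl (1 : Submodule E L)
  have h1S : (1 : Submodule E L) ≤ S := Submodule.one_le.mpr h1
  have hsup : 1 ⊔ K ⊓ S = S := by
    rw [← sup_inf_assoc_of_le K h1S, hK.sup_eq_top, top_inf_eq]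
  have hinf : 1 ⊓ (K ⊓ S) = ⊥ := by rw [← inf_assoc, hK.inf_eq_bot, bot_inf_eq]
  have hfin : Module.Finite E (K ⊓ S : Submodule E L) :=
    Submodule.finiteDimensional_of_le inf_le_right
  have hfin1 : Module.Finite E (1 : Submodule E L) := Submodule.finiteDimensional_of_le h1S
  have hone : Module.finrank E (1 : Submodule E L) = 1 := by
    rw [Submodule.one_eq_span, finrank_span_singleton one_ne_zero]
  have hrank := Submodule.finrank_sup_add_finrank_inf_eq (1 : Submodule E L) (K ⊓ S)
  rw [hsup, hinf, finrank_bot, hone] at hrank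
  let b := Module.finBasis E (K ⊓ S : Submodule E L)
  refine ⟨_, fun i => (b i : L), ?_, by rw [add_comm, ← hrank, add_zero]⟩
  have : Set.range (fun i => (b i : L)) = (K ⊓ S).subtype '' Set.range b := by
    rw [← Set.range_comp]
    rfl
  rw [this, Submodule.span_image, b.span_eq, Submodule.map_top, Submodule.range_subtype, hsup]

/-- A finite-dimensional space of functions can be rescaled so that the algebra it generates is
finite over the polynomials in some algebraically independent members of the space. -/
lemma exists_reduction [Infinite E] {V : Submodule E L} (h1 : 1 ∈ V) [Module.Finite E V] :
    ∃ a : L, a ≠ 0 ∧ ∃ (p m : ℕ) (u : Fin p → L), 1 ∈ Submodule.span E {a} * V ∧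
      (∀ i, u i ∈ Submodule.span E {a} * V) ∧ AlgebraicIndependent E u ∧
      (Submodule.span E {a} * V) ^ (m + 1) ≤
        (1 ⊔ Submodule.span E (Set.range u)) * (Submodule.span E {a} * V) ^ m := by
  classical
  have hex : ∃ N, ∃ T ≤ V, Module.finrank E T = N ∧ ∃ m, V ^ (m + 1) ≤ T * V ^ m :=
    ⟨_, V, le_rfl, rfl, 0, by simp⟩
  obtain ⟨T, hTV, hTN, m, hm⟩ := Nat.find_spec hex
  have hmin := fun N (h : N < Nat.find hex) => Nat.find_min hex h
  have hTne : T ≠ ⊥ := by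
    rintro rfl
    have := pow_le_pow_of_one_mem h1 (Nat.zero_le (m + 1))
    rw [pow_zero] at this
    have := hm (this (Submodule.one_le.mp le_rfl))
    simp at this
  obtain ⟨t, htT, ht0⟩ := Submodule.exists_mem_ne_zero_of_ne_bot hTne
  have hTfin : Module.Finite E T := Submodule.finiteDimensional_of_le hTV
  have hinv : Submodule.span E {t⁻¹} * Submodule.span E {t} = (1 : Submodule E L) := by
    rw [Submodule.span_mul_span, Set.singleton_mul_singleton, inv_mul_cancel₀ ht0,
      ← Submodule.one_eq_span]
  set V1 := Submodule.span E {t⁻¹} * V with hV1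
  set T1 := Submodule.span E {t⁻¹} * T with hT1
  have h1T : 1 ∈ T1 := by
    rw [← inv_mul_cancel₀ ht0]
    exact Submodule.mul_mem_mul (Submodule.mem_span_singleton_self _) htT
  have hTV1 : T1 ≤ V1 := mul_le_mul' le_rfl hTV
  have hT1fin : Module.Finite E T1 := by
    have h := finrank_span_singleton_mul (inv_ne_zero ht0) T
    refine Module.finite_of_finrank_pos ?_
    rw [h]
    exact Submodule.one_le_finrank_iff.mpr hTne
  obtain ⟨p, u, hu, hp⟩ := exists_one_sup_span_eq h1T
  have huV : ∀ i, u i ∈ V1 := fun i => hTV1 (by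
    rw [← hu]
    exact Submodule.mem_sup_right (Submodule.subset_span ⟨i, rfl⟩))
  have hm1 : V1 ^ (m + 1) ≤ T1 * V1 ^ m := by
    rw [hV1, mul_pow, mul_pow, pow_succ', mul_mul_mul_comm]
    exact mul_le_mul' le_rfl hm
  rw [← hu] at hm1
  refine ⟨t⁻¹, inv_ne_zero ht0, p, m, u, hTV1 h1T, huV, ?_, hm1⟩
  by_contra hdep
  obtain ⟨v, hv, m', hm'⟩ := exists_reduction_of_relation (hTV1 h1T) huV hm1 hdep
  have hVV1 : V = Submodule.span E {t} * V1 := by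
    rw [hV1, ← mul_assoc, mul_comm (Submodule.span E {t}), hinv, one_mul]
  refine hmin (Module.finrank E (Submodule.span E {t} * Submodule.span E (Set.range v) :
    Submodule E L)) ?_ ⟨_, ?_, rfl, m', ?_⟩
  · rw [← hTN, finrank_span_singleton_mul ht0, ← finrank_span_singleton_mul (inv_ne_zero ht0) T,
      ← hT1, hp, Nat.lt_succ_iff]
    exact (finrank_range_le_card v).trans (Fintype.card_fin p).le
  · rw [hVV1]
    exact mul_le_mul' le_rfl (Submodule.span_le.mpr (by rintro _ ⟨i, rfl⟩; exact hv i))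
  · calc V ^ (m' + 1) = (Submodule.span E {t} * V1) ^ (m' + 1) := by rw [← hVV1]
      _ = Submodule.span E {t} ^ (m' + 1) * V1 ^ (m' + 1) := mul_pow _ _ _
      _ ≤ Submodule.span E {t} ^ (m' + 1) * (Submodule.span E (Set.range v) * V1 ^ m') :=
        mul_le_mul' le_rfl hm'
      _ = Submodule.span E {t} * Submodule.span E (Set.range v) *
          (Submodule.span E {t} * V1) ^ m' := by
        rw [pow_succ', mul_mul_mul_comm, ← mul_pow]
      _ = _ := by rw [← hVV1]

end Reduction

section Existence

variable {E L : Type} [Field E] [Field L] [Algebra E L] {p r : ℕ}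

lemma aeval_mul_mem_lat {u : Fin p → L} {z : Fin r → L} {D e : ℕ} {g : MvPolynomial (Fin p) E}
    (hg : g.totalDegree ≤ e) {x : L} (hx : x ∈ lat E u z D) :
    aeval u g * x ∈ lat E u z (e + D) := by
  obtain ⟨P, hP, rfl⟩ := mem_lat.mp hx
  refine mem_lat.mpr ⟨fun i => g * P i, fun i => ?_, ?_⟩
  · exact (totalDegree_mul _ _).trans (add_le_add hg (hP i))
  · simp only [comb_apply, map_mul, Finset.mul_sum, mul_assoc]

lemma mem_map_aeval_of_mem_pow {u : Fin p → L} {m : ℕ} {x : L}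
    (hx : x ∈ (1 ⊔ Submodule.span E (Set.range u)) ^ m) :
    ∃ g : MvPolynomial (Fin p) E, g.totalDegree ≤ m ∧ aeval u g = x := by
  have key : (1 ⊔ Submodule.span E (Set.range u)) ^ m ≤
      (restrictTotalDegree (Fin p) E m).map (aeval u : MvPolynomial (Fin p) E →ₐ[E] L).toLinearMap := by
    clear hx
    induction m with
    | zero =>
      rw [pow_zero, Submodule.one_le]
      exact ⟨1, by simp [mem_restrictTotalDegree], by simp⟩
    | succ m ih =>
      rw [pow_succ]
      have h1 : (1 ⊔ Submodule.span E (Set.range u)) ≤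
          (restrictTotalDegree (Fin p) E 1).map
            (aeval u : MvPolynomial (Fin p) E →ₐ[E] L).toLinearMap := by
        refine sup_le (Submodule.one_le.mpr ⟨1, by simp [mem_restrictTotalDegree], by simp⟩)
          (Submodule.span_le.mpr ?_)
        rintro _ ⟨i, rfl⟩
        exact ⟨X i, by simp [mem_restrictTotalDegree], by simp⟩
      refine (mul_le_mul' ih h1).trans (Submodule.mul_le.mpr ?_)
      rintro _ ⟨a, ha, rfl⟩ _ ⟨b, hb, rfl⟩
      refine ⟨a * b, ?_, by simp⟩
      rw [SetLike.mem_coe, mem_restrictTotalDegree] at *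
      exact (totalDegree_mul _ _).trans (add_le_add ha hb)
  obtain ⟨g, hg, rfl⟩ := key hx
  exact ⟨g, (mem_restrictTotalDegree _ _ _).mp hg, rfl⟩

lemma exists_aeval_mul_mem_lat {u : Fin p → L} (hu : AlgebraicIndependent E u) {z : Fin r → L}
    {x : L} (hx : x ∈ Submodule.span (IntermediateField.adjoin E (Set.range u)) (Set.range z)) :
    ∃ q : MvPolynomial (Fin p) E, q ≠ 0 ∧ ∃ D, aeval u q * x ∈ lat E u z D := by
  induction hx using Submodule.span_induction with
  | mem x hx =>
    obtain ⟨i, rfl⟩ := hx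
    refine ⟨1, one_ne_zero, 0, mem_lat.mpr ⟨Pi.single i 1, fun j => ?_, ?_⟩⟩
    · obtain rfl | h := eq_or_ne j i
      · simp
      · simp [Pi.single_eq_of_ne h]
    · rw [comb_apply, Finset.sum_eq_single i (fun j _ h => by simp [Pi.single_eq_of_ne h]) (by simp)]
      simp
  | zero => exact ⟨1, one_ne_zero, 0, by simp⟩
  | add x y _ _ hx hy =>
    obtain ⟨q, hq, D, hx⟩ := hx
    obtain ⟨q', hq', D', hy⟩ := hy
    refine ⟨q * q', mul_ne_zero hq hq', max (q'.totalDegree + D) (q.totalDegree + D'), ?_⟩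
    have h : aeval u (q * q') * (x + y) =
        aeval u q' * (aeval u q * x) + aeval u q * (aeval u q' * y) := by
      rw [map_mul]
      ring
    rw [h]
    exact Submodule.add_mem _ (lat_mono (le_max_left _ _) (aeval_mul_mem_lat le_rfl hx))
      (lat_mono (le_max_right _ _) (aeval_mul_mem_lat le_rfl hy))
  | smul c x _ hx =>
    obtain ⟨q, hq, D, hx⟩ := hx
    obtain ⟨a, b, hab⟩ := (IntermediateField.mem_adjoin_range_iff E u (c : L)).mp c.2
    by_cases hb : b = 0
    · refine ⟨1, one_ne_zero, 0, ?_⟩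
      rw [IntermediateField.smul_def, hab, hb]
      simp
    have hb' : aeval u b ≠ 0 := fun h => hb (hu (by rw [h, map_zero]))
    refine ⟨b * q, mul_ne_zero hb hq, a.totalDegree + D, ?_⟩
    have h : aeval u (b * q) * c • x = aeval u a * (aeval u q * x) := by
      rw [IntermediateField.smul_def, hab, map_mul, smul_eq_mul]
      field_simp
    rw [h]
    exact aeval_mul_mem_lat le_rfl hx

/-- Noether normalization of a finite-dimensional space of functions, relative to a reduction. -/
lemma exists_normalized {V : Submodule E L} (h1 : 1 ∈ V) (hfin : Module.Finite E V)
    {u : Fin p → L} (huV : ∀ i, u i ∈ V) (hu : AlgebraicIndependent E u) {m₀ : ℕ}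
    (hm : V ^ (m₀ + 1) ≤ (1 ⊔ Submodule.span E (Set.range u)) * V ^ m₀) :
    ∃ (r : ℕ) (z : Fin r → L), (∀ i, z i ∈ V ^ m₀) ∧ Normalized V u z := by
  classical
  obtain ⟨S, hS⟩ : (V ^ m₀).FG := Submodule.FG.pow (Module.Finite.iff_fg.mp hfin) m₀
  set F := IntermediateField.adjoin E (Set.range u) with hF
  obtain ⟨B, hBS, hB, hlin⟩ := exists_linearIndependent F (S : Set L)
  have : Finite B := S.finite_toSet.subset hBS
  obtain ⟨r, ⟨e⟩⟩ := Finite.exists_equiv_fin B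
  let z : Fin r → L := fun i => (e.symm i : L)
  have hz : LinearIndependent F z := hlin.comp _ e.symm.injective
  have hzr : Set.range z = B := by
    have : z = Subtype.val ∘ e.symm := rfl
    rw [this, e.symm.surjective.range_comp, Subtype.range_val]
  have hzV : ∀ i, z i ∈ V ^ m₀ := fun i => by
    rw [← hS]
    exact Submodule.subset_span (hBS (e.symm i).2)
  have hall : ∀ S' : Finset L, S' ⊆ S → ∃ q : MvPolynomial (Fin p) E, q ≠ 0 ∧ ∃ D, ∀ x ∈ S',
      aeval u q * x ∈ lat E u z D := by
    intro S' hS'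
    induction S' using Finset.induction_on with
    | empty => exact ⟨1, one_ne_zero, 0, by simp⟩
    | insert x S' hx ih =>
      obtain ⟨q, hq, D, h⟩ := ih ((Finset.subset_insert _ _).trans hS')
      obtain ⟨q', hq', D', h'⟩ := exists_aeval_mul_mem_lat hu (z := z) (x := x) (by
        rw [hzr, hB]
        exact Submodule.subset_span (hS' (Finset.mem_insert_self _ _)))
      refine ⟨q * q', mul_ne_zero hq hq', max (q'.totalDegree + D) (q.totalDegree + D'), ?_⟩
      intro y hy
      rcases Finset.mem_insert.mp hy with rfl | hy
      · rw [map_mul, mul_assoc]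
        exact lat_mono (le_max_right _ _) (aeval_mul_mem_lat le_rfl h')
      · rw [map_mul, mul_comm (aeval u q), mul_assoc]
        exact lat_mono (le_max_left _ _) (aeval_mul_mem_lat le_rfl (h y hy))
  obtain ⟨q, hq, D, hqS⟩ := hall S subset_rfl
  have hqV : ∀ x ∈ V ^ m₀, aeval u q * x ∈ lat E u z D := by
    intro x hx
    have : V ^ m₀ ≤ (lat E u z D).comap (LinearMap.mulLeft E (aeval u q)) := by
      rw [← hS]
      exact Submodule.span_le.mpr fun y hy => hqS y hy
    exact this hx
  refine ⟨r, z, hzV, h1, huV, hfin, ?_, aeval u q, fun h => hq (hu (by rw [h, map_zero])), D, ?_⟩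
  · rw [injective_iff_map_eq_zero]
    intro P hP
    rw [comb_apply] at hP
    have hmem : ∀ g : MvPolynomial (Fin p) E, aeval u g ∈ F := fun g =>
      IntermediateField.algebra_adjoin_le_adjoin E _ (by
        rw [Algebra.adjoin_range_eq_range_aeval]
        exact ⟨g, rfl⟩)
    have := Fintype.linearIndependent_iff.mp hz (fun i => ⟨aeval u (P i), hmem _⟩) hP
    ext1 i
    refine hu ?_
    rw [Pi.zero_apply, map_zero]
    exact congrArg Subtype.val (this i)
  · intro m θ hθ
    have hle : (1 ⊔ Submodule.span E (Set.range u)) ^ m * V ^ m₀ ≤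
        (lat E u z (m + D)).comap (LinearMap.mulLeft E (aeval u q)) := by
      refine Submodule.mul_le.mpr fun a ha b hb => ?_
      obtain ⟨g, hg, rfl⟩ := mem_map_aeval_of_mem_pow ha
      rw [Submodule.mem_comap, LinearMap.mulLeft_apply, mul_left_comm]
      exact aeval_mul_mem_lat hg (hqV b hb)
    exact hle (pow_add_le_of_reduction hm m
      (pow_le_pow_of_one_mem h1 (Nat.le_add_left m m₀) hθ))

lemma Normalized.finite_pow {V : Submodule E L} {u : Fin p → L} {z : Fin r → L}
    (h : Normalized V u z) (m : ℕ) : Module.Finite E (V ^ m : Submodule E L) :=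
  Module.Finite.iff_fg.mpr (Submodule.FG.pow (Module.Finite.iff_fg.mp h.finite) m)

lemma Normalized.le_finrank_pow {V : Submodule E L} {u : Fin p → L} {z : Fin r → L}
    (h : Normalized V u z) {m₀ : ℕ} (hz : ∀ i, z i ∈ V ^ m₀) (m : ℕ) :
    r * (m + p).choose p ≤ Module.finrank E (V ^ (m + m₀) : Submodule E L) := by
  have := h.finite_pow (m + m₀)
  rw [← finrank_lat h.indep m]
  refine Submodule.finrank_mono ?_
  intro x hx
  obtain ⟨P, hP, rfl⟩ := mem_lat.mp hx
  rw [comb_apply, pow_add]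
  exact Submodule.sum_mem _ fun i _ => Submodule.mul_mem_mul
    (aeval_mem_pow_of_totalDegree_le h.one_mem h.mem (hP i)) (hz i)

lemma Normalized.exists_finrank_pow_le {V : Submodule E L} {u : Fin p → L} {z : Fin r → L}
    (h : Normalized V u z) :
    ∃ D, ∀ m, Module.finrank E (V ^ m : Submodule E L) ≤ r * (m + D + p).choose p := by
  obtain ⟨q, hq, D, hD⟩ := h.bounded
  refine ⟨D, fun m => ?_⟩
  rw [← finrank_lat h.indep (m + D), ← finrank_span_singleton_mul hq (V ^ m)]
  have : Module.Finite E (lat E u z (m + D)) := inferInstance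
  refine Submodule.finrank_mono ?_
  intro x hx
  obtain ⟨y, hy, rfl⟩ := Submodule.mem_span_singleton_mul.mp hx
  exact hD m y hy

end Existence

section Dimension

lemma ringKrullDim_le_of_isIntegral (S A : Type) [CommRing S] [CommRing A] [Algebra S A]
    [Algebra.IsIntegral S A] : ringKrullDim A ≤ ringKrullDim S :=
  Order.krullDim_le_of_strictMono (PrimeSpectrum.comap (algebraMap S A)) fun I J h =>
    Ideal.IsIntegral.comap_lt_comap (I := I.asIdeal) (J := J.asIdeal) h

/-- The dimension of a standard graded domain is bounded by the number of generators of a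
reduction. -/
lemma ringKrullDim_le_of_reduction {E A : Type} [Field E] [CommRing A] [IsDomain A] [Algebra E A]
    {W : Submodule E A} (hfg : W.FG) (hne : W ≠ ⊥) (htop : Algebra.adjoin E (W : Set A) = ⊤)
    {q m : ℕ} {t : Fin q → A} (h : W ^ (m + 1) ≤ Submodule.span E (Set.range t) * W ^ m) :
    ringKrullDim A ≤ q := by
  let P := MvPolynomial (Fin q) E
  let _ : Algebra P A := (aeval t : P →ₐ[E] A).toAlgebra
  have : IsScalarTower E P A := IsScalarTower.of_algebraMap_eq fun x => by
    change _ = aeval t _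
    rw [AlgHom.commutes]
  obtain ⟨x₀, hx₀, hx₀'⟩ := Submodule.exists_mem_ne_zero_of_ne_bot hne
  obtain ⟨S, hS⟩ := Submodule.FG.pow hfg m
  let N : Submodule P A := Submodule.span P (S : Set A)
  have hN : ∀ x ∈ W ^ m, x ∈ N := fun x hx => by
    rw [← hS] at hx
    exact Submodule.span_le_restrictScalars E P (S : Set A) hx
  have hNne : N ≠ ⊥ := by
    intro h0
    have := hN _ (Submodule.pow_mem_pow W hx₀ m)
    rw [h0, Submodule.mem_bot] at this
    exact pow_ne_zero m hx₀' this
  have hWN : ∀ x ∈ W ^ (m + 1), x ∈ N := by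
    intro x hx
    have hle : Submodule.span E (Set.range t) * W ^ m ≤ N.restrictScalars E := by
      refine Submodule.mul_le.mpr fun a ha b hb => ?_
      have : Submodule.span E (Set.range t) ≤
          (N.restrictScalars E).comap (LinearMap.mulRight E b) := by
        refine Submodule.span_le.mpr ?_
        rintro _ ⟨i, rfl⟩
        have := N.smul_mem (X i : P) (hN b hb)
        rw [Algebra.smul_def] at this
        have h2 : algebraMap P A (X i) = t i := aeval_X t i
        rw [h2] at this
        exact this
      exact this ha
    exact hle (h hx)
  have hInt : ∀ x ∈ W, IsIntegral P x := by
    intro x hx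
    refine isIntegral_of_smul_mem_submodule N hNne ⟨S, rfl⟩ x fun y hy => ?_
    induction hy using Submodule.span_induction with
    | mem y hy =>
      refine hWN _ ?_
      rw [pow_succ', smul_eq_mul]
      exact Submodule.mul_mem_mul hx (by rw [← hS]; exact Submodule.subset_span hy)
    | zero => simp
    | add a b _ _ ha hb =>
      rw [smul_add]
      exact N.add_mem ha hb
    | smul c a _ ha =>
      rw [smul_comm]
      exact N.smul_mem c ha
  have : Algebra.IsIntegral P A := ⟨fun x => by
    have hle : Algebra.adjoin E (W : Set A) ≤ (integralClosure P A).restrictScalars E :=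
      Algebra.adjoin_le hInt
    have hx : x ∈ Algebra.adjoin E (W : Set A) := htop ▸ Algebra.mem_top
    exact hle hx⟩
  refine (ringKrullDim_le_of_isIntegral P A).trans ?_
  rw [MvPolynomial.ringKrullDim_of_isNoetherianRing, ringKrullDim_eq_zero_of_field]
  simp

end Dimension

section Asymptotics

open Filter Topology

lemma tendsto_choose_mul_factorial_div (a b p : ℕ) :
    Tendsto (fun m : ℕ => ((m + a - b).choose p : ℝ) * (p.factorial : ℝ) / (m : ℝ) ^ p) atTop
      (𝓝 1) := by
  have h : ∀ j : ℕ, Tendsto (fun m : ℕ => ((m + a - b - j : ℕ) : ℝ) / (m : ℝ)) atTop (𝓝 1) := by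
    intro j
    have h1 : Tendsto (fun m : ℕ => 1 + ((a : ℝ) - b - j) / (m : ℝ)) atTop (𝓝 (1 + 0)) :=
      tendsto_const_nhds.add (tendsto_const_div_atTop_nhds_zero_nat _)
    rw [add_zero] at h1
    refine h1.congr' ?_
    filter_upwards [eventually_ge_atTop (b + j + 1)] with m hm
    have : (m : ℝ) ≠ 0 := Nat.cast_ne_zero.mpr (by omega)
    rw [Nat.cast_sub (by omega), Nat.cast_sub (by omega)]
    push_cast
    field_simp
    ring
  have hprod : Tendsto (fun m : ℕ => ∏ j ∈ Finset.range p, ((m + a - b - j : ℕ) : ℝ) / (m : ℝ))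
      atTop
      (𝓝 (∏ j ∈ Finset.range p, 1)) := tendsto_finsetProd _ fun j _ => h j
  rw [Finset.prod_const_one] at hprod
  refine hprod.congr fun m => ?_
  rw [Finset.prod_div_distrib, Finset.prod_const, Finset.card_range, mul_comm, ← Nat.cast_mul,
    ← Nat.descFactorial_eq_factorial_mul_choose, Nat.descFactorial_eq_prod_range, Nat.cast_prod]

/-- A function squeezed between two shifts of `r` times the Hilbert function of a projective space
of dimension `p` determines both `p` and `r`. -/
lemma eq_of_hilbert_bounds {H : ℕ → ℕ} {p n r d m₀ D : ℕ} (hr : 0 < r) (hnp : n ≤ p)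
    (hlow : ∀ m, r * (m + p).choose p ≤ H (m + m₀))
    (hup : ∀ m, H m ≤ r * (m + D + p).choose p)
    (hlim : Tendsto (fun m : ℕ => (H m : ℝ) * (n.factorial : ℝ) / (m : ℝ) ^ n) atTop (𝓝 (d : ℝ))) :
    p = n ∧ r = d := by
  have hp : Tendsto (fun m : ℕ => (H m : ℝ) * (p.factorial : ℝ) / (m : ℝ) ^ p) atTop
      (𝓝 (r : ℝ)) := by
    have hlo := (tendsto_choose_mul_factorial_div p m₀ p).const_mul (r : ℝ)
    have hhi := (tendsto_choose_mul_factorial_div (D + p) 0 p).const_mul (r : ℝ)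
    rw [mul_one] at hlo hhi
    refine tendsto_of_tendsto_of_tendsto_of_le_of_le' hlo hhi ?_ ?_
    · filter_upwards [eventually_ge_atTop m₀] with m hm
      obtain ⟨j, rfl⟩ := Nat.exists_eq_add_of_le' hm
      have := hlow j
      rw [show j + m₀ + p - m₀ = j + p by omega, ← mul_div_assoc, ← mul_assoc]
      gcongr
      exact_mod_cast this
    · filter_upwards with m
      have := hup m
      rw [Nat.sub_zero, ← add_assoc, ← mul_div_assoc, ← mul_assoc]
      gcongr
      exact_mod_cast this
  obtain rfl | hlt := hnp.eq_or_lt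
  · exact ⟨rfl, by exact_mod_cast tendsto_nhds_unique hp hlim⟩
  · exfalso
    have hz : Tendsto (fun m : ℕ => ((p.factorial : ℝ) / n.factorial) *
        (((H m : ℝ) * (n.factorial : ℝ) / (m : ℝ) ^ n) * ((m : ℝ) ^ (p - n))⁻¹)) atTop
        (𝓝 (((p.factorial : ℝ) / n.factorial) * ((d : ℝ) * 0))) := by
      refine tendsto_const_nhds.mul (hlim.mul ?_)
      exact tendsto_inv_atTop_zero.comp ((tendsto_pow_atTop (by omega)).comp
        tendsto_natCast_atTop_atTop)
    rw [mul_zero, mul_zero] at hz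
    have heq : (r : ℝ) = 0 := by
      refine tendsto_nhds_unique hp (hz.congr' ?_)
      filter_upwards [eventually_ge_atTop 1] with m hm
      have h0 : (m : ℝ) ≠ 0 := by positivity
      obtain ⟨e, rfl⟩ := Nat.exists_eq_add_of_lt hlt
      rw [show n + e + 1 - n = e + 1 by omega, show n + e + 1 = n + (e + 1) by omega, pow_add]
      field_simp
      ring
    have : r = 0 := by exact_mod_cast heq
    omega

end Asymptotics

section Model

lemma relClosed_of_isAlgClosed (k L : Type) [Field k] [IsAlgClosed k] [Field L] [Algebra k L] :
    RelClosed k L := fun a ha => by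
  have hInt : IsIntegral k a := isAlgebraic_iff_isIntegral.mp ha
  exact minpoly.mem_range_of_degree_eq_one k a
    (IsAlgClosed.degree_eq_one_of_irreducible k (minpoly.irreducible hInt))

lemma exists_normalized_intermediateField {k K : Type} [Field k] [Field K] [Algebra k K]
    {V₁ : Submodule k K} (h1 : 1 ∈ V₁) (hfin : Module.Finite k V₁) {p m : ℕ} {u : Fin p → K}
    (hu : ∀ i, u i ∈ V₁) (hind : AlgebraicIndependent k u)
    (hm : V₁ ^ (m + 1) ≤ (1 ⊔ Submodule.span k (Set.range u)) * V₁ ^ m) :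
    ∃ (L : IntermediateField k K) (V : Submodule k L) (r : ℕ) (v : Fin p → L) (z : Fin r → L),
      Normalized V v z ∧ (∀ i, z i ∈ V ^ m) ∧ IntermediateField.adjoin k (V : Set L) = ⊤ ∧
      ∀ j, Module.finrank k (V ^ j : Submodule k L) = Module.finrank k (V₁ ^ j : Submodule k K) := by
  let L := IntermediateField.adjoin k (V₁ : Set K)
  have hVL : ∀ x ∈ V₁, x ∈ L := fun x hx => IntermediateField.subset_adjoin k _ hx
  let f := L.val
  have hf : Function.Injective f := f.injective
  let V : Submodule k L := V₁.comap f.toLinearMap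
  have hmap : V.map f.toLinearMap = V₁ := by
    refine le_antisymm (Submodule.map_comap_le _ _) fun x hx => ?_
    exact ⟨⟨x, hVL x hx⟩, hx, rfl⟩
  have hpow : ∀ j, (V ^ j).map f.toLinearMap = V₁ ^ j := fun j => by
    rw [Submodule.map_pow, hmap]
  have hrank : ∀ j, Module.finrank k (V ^ j : Submodule k L) =
      Module.finrank k (V₁ ^ j : Submodule k K) := fun j => by
    rw [← hpow j]
    exact (Submodule.equivMapOfInjective f.toLinearMap hf (V ^ j)).finrank_eq
  let v : Fin p → L := fun i => ⟨u i, hVL _ (hu i)⟩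
  have hV1 : (1 : L) ∈ V := h1
  have hVfin : Module.Finite k V := by
    have : Module.Finite k (V.map f.toLinearMap) := by rwa [hmap]
    exact Module.Finite.equiv (Submodule.equivMapOfInjective f.toLinearMap hf V).symm
  have hvind : AlgebraicIndependent k v := (f.algebraicIndependent_iff hf).mp hind
  have hm' : V ^ (m + 1) ≤ (1 ⊔ Submodule.span k (Set.range v)) * V ^ m := by
    rw [← Submodule.map_le_map_iff_of_injective (f := f.toLinearMap) hf, Submodule.map_mul, hpow,
      hpow, Submodule.map_sup, Submodule.map_one, Submodule.map_span, ← Set.range_comp]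
    exact hm
  obtain ⟨r, z, hz, hN⟩ := exists_normalized hV1 hVfin hu hvind hm'
  refine ⟨L, V, r, v, z, hN, hz, ?_, hrank⟩
  apply IntermediateField.lift_injective L
  rw [IntermediateField.lift_adjoin, IntermediateField.lift_top]
  congr 1
  exact congrArg (SetLike.coe) hmap

/-- A finite-dimensional space of functions has a normalized model with the same growth, whose
number of parameters is controlled by a reduction. -/
lemma exists_model {k K : Type} [Field k] [Infinite k] [Field K] [Algebra k K]
    {W : Submodule k K} (hne : W ≠ ⊥) (hfin : Module.Finite k W) :
    ∃ (L : IntermediateField k K) (V : Submodule k L) (p r m : ℕ) (v : Fin p → L) (z : Fin r → L),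
      Normalized V v z ∧ (∀ i, z i ∈ V ^ m) ∧ IntermediateField.adjoin k (V : Set L) = ⊤ ∧
      (∀ j, Module.finrank k (V ^ j : Submodule k L) = Module.finrank k (W ^ j : Submodule k K)) ∧
      ∃ t : Fin (p + 1) → K, (∀ i, t i ∈ W) ∧
        W ^ (m + 1) ≤ Submodule.span k (Set.range t) * W ^ m := by
  obtain ⟨w, hw, hw0⟩ := Submodule.exists_mem_ne_zero_of_ne_bot hne
  have hfin' : ∀ a : K, Module.Finite k (Submodule.span k {a} * W : Submodule k K) := fun a =>
    Module.Finite.iff_fg.mpr ((Submodule.fg_span_singleton a).mul (Module.Finite.iff_fg.mp hfin))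
  have h1 : 1 ∈ Submodule.span k {w⁻¹} * W := by
    rw [← inv_mul_cancel₀ hw0]
    exact Submodule.mul_mem_mul (Submodule.mem_span_singleton_self _) hw
  have := hfin' w⁻¹
  obtain ⟨a, ha, p, m, u, h1', hu, hind, hm⟩ := exists_reduction h1
  have hb : a * w⁻¹ ≠ 0 := mul_ne_zero ha (inv_ne_zero hw0)
  rw [← mul_assoc, Submodule.span_mul_span, Set.singleton_mul_singleton] at h1' hm
  simp only [← mul_assoc, Submodule.span_mul_span, Set.singleton_mul_singleton] at hu
  generalize a * w⁻¹ = b at *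
  have hbW : Submodule.span k {b⁻¹} * (Submodule.span k {b} * W) = W := by
    rw [← mul_assoc, Submodule.span_mul_span, Set.singleton_mul_singleton, inv_mul_cancel₀ hb,
      ← Submodule.one_eq_span, one_mul]
  obtain ⟨L, V, r, v, z, hN, hz, hadj, hrank⟩ :=
    exists_normalized_intermediateField h1' (hfin' b) hu hind hm
  refine ⟨L, V, p, r, m, v, z, hN, hz, hadj, fun j => ?_, Fin.cons b⁻¹ fun i => b⁻¹ * u i, ?_, ?_⟩
  · rw [hrank, span_singleton_mul_pow, finrank_span_singleton_mul (pow_ne_zero j hb)]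
  · intro i
    rw [← hbW]
    refine Fin.cases ?_ (fun i => ?_) i
    · simpa using Submodule.mul_mem_mul (Submodule.mem_span_singleton_self b⁻¹) h1'
    · exact Submodule.mul_mem_mul (Submodule.mem_span_singleton_self b⁻¹) (hu i)
  · have hspan : Submodule.span k {b⁻¹} * (1 ⊔ Submodule.span k (Set.range u)) ≤
        Submodule.span k (Set.range (Fin.cons b⁻¹ fun i => b⁻¹ * u i : Fin (p + 1) → K)) := by
      rw [Submodule.mul_sup, mul_one, Submodule.span_mul_span]
      refine sup_le (Submodule.span_mono ?_) (Submodule.span_mono ?_)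
      · rw [Set.singleton_subset_iff]
        exact ⟨0, rfl⟩
      · rw [Set.singleton_mul]
        rintro _ ⟨_, ⟨i, rfl⟩, rfl⟩
        exact ⟨i.succ, rfl⟩
    calc W ^ (m + 1) = Submodule.span k {b⁻¹} ^ (m + 1) * (Submodule.span k {b} * W) ^ (m + 1) := by
          rw [← mul_pow, hbW]
      _ ≤ Submodule.span k {b⁻¹} ^ (m + 1) *
          ((1 ⊔ Submodule.span k (Set.range u)) * (Submodule.span k {b} * W) ^ m) :=
        mul_le_mul' le_rfl hm
      _ = Submodule.span k {b⁻¹} * (1 ⊔ Submodule.span k (Set.range u)) * W ^ m := by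
        rw [pow_succ', mul_mul_mul_comm, ← mul_pow, hbW]
      _ ≤ _ := mul_le_mul' hspan le_rfl

end Model

section Numerics

lemma choose_two_eq_sum (N n : ℕ) (h : n ≤ N) :
    (N + 1).choose 2 = ∑ i ∈ Finset.range n, (N - i) + (N - n + 1).choose 2 := by
  induction n with
  | zero => simp
  | succ n ih =>
    obtain ⟨e, rfl⟩ := Nat.exists_eq_add_of_le h
    have h2 := Nat.choose_succ_succ' (e + 1) 1
    rw [Nat.choose_one_right] at h2
    rw [ih (by omega), Finset.sum_range_succ, show n + 1 + e - n = e + 1 by omega,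
      show n + 1 + e - (n + 1) = e by omega, h2, ← add_assoc]

lemma Normalized.finrank_le_one {k L : Type} [Field k] [IsAlgClosed k] [Field L] [Algebra k L]
    {r : ℕ} {V : Submodule k L} {u : Fin 0 → L} {z : Fin r → L} (h : Normalized V u z) :
    Module.finrank k V ≤ 1 := by
  have hle : V ≤ 1 := by
    intro x hx
    have hInt : Algebra.IsIntegral k (Algebra.adjoin k (Set.range u)) := ⟨fun y => by
      have hA : Algebra.adjoin k (Set.range u) = ⊥ := by
        rw [Set.range_eq_empty, Algebra.adjoin_empty]
      obtain ⟨c, hc⟩ := Algebra.mem_bot.mp (hA.le y.2)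
      have : y = algebraMap k _ c := Subtype.ext hc.symm
      rw [this]
      exact isIntegral_algebraMap⟩
    obtain ⟨c, rfl⟩ := relClosed_of_isAlgClosed k L x
      (isIntegral_trans (R := k) x (h.isIntegral hx)).isAlgebraic
    exact Submodule.algebraMap_mem c
  have hone : Module.finrank k (1 : Submodule k L) = 1 := by
    rw [Submodule.one_eq_span, finrank_span_singleton one_ne_zero]
  have : Module.Finite k (1 : Submodule k L) := Module.finite_of_finrank_pos (by omega)
  exact (Submodule.finrank_mono hle).trans hone.le

/-- The bounds on the rank of a normalization given by the first two values of the Hilbert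
function. -/
lemma Normalized.rank_bounds {k L : Type} [Field k] [IsAlgClosed k] [CharZero k] [Field L]
    [Algebra k L] {n r c : ℕ} {V : Submodule k L} {u : Fin n → L} {z : Fin r → L}
    (h : Normalized V u z) (hadj : IntermediateField.adjoin k (V : Set L) = ⊤) (hc : 4 ≤ c)
    (h1 : Module.finrank k V = n + c + 1)
    (h2 : Module.finrank k (V ^ 2 : Submodule k L) =
      (n + c + 2).choose 2 - ((c + 1).choose 2 - 3)) : c + 2 ≤ r ∧ r ≤ c + 4 := by
  have hcl := relClosed_of_isAlgClosed k L
  have hsum := choose_two_eq_sum (n + c + 1) n (by omega)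
  rw [show n + c + 1 - n + 1 = c + 1 + 1 by omega, Nat.choose_succ_succ' (c + 1) 1,
    Nat.choose_one_right, one_add_one_eq_two] at hsum
  have h3 : 3 ≤ (c + 1).choose 2 := by
    calc 3 ≤ (4 + 1).choose 2 := by decide
      _ ≤ _ := Nat.choose_le_choose 2 (by omega)
  rw [show n + c + 2 = n + c + 1 + 1 by omega, hsum] at h2
  have hle := h.finrank_le fun _ => hcl
  constructor
  · by_contra hcon
    have hr : r = c + 1 := by omega
    subst hr
    have := h.finrank_sq_le (fun _ => hcl) (by omega)
    rw [show c + 1 + n = n + c + 1 by omega] at this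
    omega
  · cases n with
    | zero =>
      have := h.finrank_le_one
      omega
    | succ n =>
      have := h.le_finrank_sq hcl hadj
      rw [h1, h2, show 2 * (n + 1 + c + 1 - (n + 1)) - 1 = 2 * c + 1 by omega] at this
      omega

end Numerics

section HilbertFunction

variable {k ι : Type} [Field k] [Fintype ι] [DecidableEq ι]

instance finite_homogeneousSubmodule (m : ℕ) : Module.Finite k (homogeneousSubmodule ι k m) :=
  Submodule.finiteDimensional_of_le (S₂ := restrictTotalDegree ι k m) fun f hf => by
    rw [mem_restrictTotalDegree]
    exact IsHomogeneous.totalDegree_le hf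

/-- The span of the coordinates in a quotient of the polynomial ring. -/
def coordSpan (I : Ideal (MvPolynomial ι k)) : Submodule k (MvPolynomial ι k ⧸ I) :=
  (homogeneousSubmodule ι k 1).map (Ideal.Quotient.mkₐ k I).toLinearMap

lemma finrank_coordSpan_pow (I : Ideal (MvPolynomial ι k)) (m : ℕ) :
    Module.finrank k (coordSpan I ^ m : Submodule k (MvPolynomial ι k ⧸ I)) = idealHilb k ι I m := by
  let f := (Ideal.Quotient.mkₐ k I).toLinearMap
  let H := homogeneousSubmodule ι k m
  have hmap : coordSpan I ^ m = H.map f := by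
    rw [coordSpan, ← Submodule.map_pow, homogeneousSubmodule_one_pow]
  have hker : (LinearMap.ker (f.domRestrict H)).map H.subtype = idealPiece k ι I m := by
    ext x
    simp only [idealPiece, Submodule.mem_map, Submodule.mem_inf, LinearMap.mem_ker,
      Submodule.restrictScalars_mem]
    constructor
    · rintro ⟨y, hy, rfl⟩
      exact ⟨Ideal.Quotient.eq_zero_iff_mem.mp hy, y.2⟩
    · rintro ⟨hx, hx'⟩
      exact ⟨⟨x, hx'⟩, Ideal.Quotient.eq_zero_iff_mem.mpr hx, rfl⟩
  have h := (f.domRestrict H).finrank_range_add_finrank_ker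
  rw [← Submodule.finrank_map_subtype_eq H (LinearMap.ker (f.domRestrict H)), hker,
    LinearMap.range_domRestrict] at h
  rw [hmap, idealHilb, ← h, Nat.add_sub_cancel]

lemma finrank_coordSpan (I : Ideal (MvPolynomial ι k)) :
    Module.finrank k (coordSpan I) = idealHilb k ι I 1 := by
  have h : coordSpan I ^ 1 = coordSpan I := pow_one _
  rw [← finrank_coordSpan_pow, h]

lemma fg_coordSpan (I : Ideal (MvPolynomial ι k)) : (coordSpan I).FG :=
  (Module.Finite.iff_fg.mp (finite_homogeneousSubmodule 1)).map _

lemma adjoin_coordSpan (I : Ideal (MvPolynomial ι k)) :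
    Algebra.adjoin k (coordSpan I : Set (MvPolynomial ι k ⧸ I)) = ⊤ := by
  rw [eq_top_iff]
  rintro x -
  obtain ⟨f, rfl⟩ := Ideal.Quotient.mkₐ_surjective k I x
  have h : f ∈ Algebra.adjoin k (Set.range (X : ι → MvPolynomial ι k)) := by
    rw [adjoin_range_X]
    exact Algebra.mem_top
  have h2 : Ideal.Quotient.mkₐ k I f ∈
      (Algebra.adjoin k (Set.range (X : ι → MvPolynomial ι k))).map (Ideal.Quotient.mkₐ k I) :=
    ⟨f, h, rfl⟩
  rw [AlgHom.map_adjoin] at h2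
  refine Algebra.adjoin_mono ?_ h2
  rintro _ ⟨_, ⟨i, rfl⟩, rfl⟩
  exact ⟨X i, isHomogeneous_X k i, rfl⟩

lemma hilb_one {C : Set (ι → k)} (hnd : Nondeg k ι C) :
    hilb k ι C 1 = Module.finrank k (homogeneousSubmodule ι k 1) := by
  have : idealPiece k ι (vanIdeal k ι C) 1 = ⊥ := by
    rw [eq_bot_iff]
    intro f hf
    refine hnd f hf.2 fun x hx => ?_
    have h : f ∈ vanIdeal k ι C := hf.1
    rw [vanIdeal, Ideal.mem_iInf] at h
    exact (Submodule.mem_iInf _).mp (h x) hx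
  rw [hilb, idealHilb, this, finrank_bot, Nat.sub_zero]

/-- A projective variety has a normalized model with the same Hilbert function, whose rank is the
degree of the variety. -/
lemma exists_model_of_isProjVariety [Infinite k] {n d : ℕ} {C : Set (ι → k)}
    (hV : IsProjVariety k ι C) (hdim : HasDim k ι C n) (hdeg : HasDegree k ι C n d)
    (hone : hilb k ι C 1 ≠ 0) :
    ∃ (L : Type) (_ : Field L) (_ : Algebra k L) (V : Submodule k L) (v : Fin n → L)
      (z : Fin d → L), Normalized V v z ∧ IntermediateField.adjoin k (V : Set L) = ⊤ ∧
      ∀ j, Module.finrank k (V ^ j : Submodule k L) = hilb k ι C j := by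
  let I := vanIdeal k ι C
  have hI : I.IsPrime := hV.prime
  let A := MvPolynomial ι k ⧸ I
  let K := FractionRing A
  let g : A →ₐ[k] K := IsScalarTower.toAlgHom k A K
  have hg : Function.Injective g.toLinearMap := IsFractionRing.injective A K
  have hpow : ∀ j, ((coordSpan I).map g.toLinearMap) ^ j = (coordSpan I ^ j).map g.toLinearMap :=
    fun j => (Submodule.map_pow _ _ _).symm
  have hrk : ∀ j, Module.finrank k (((coordSpan I).map g.toLinearMap) ^ j : Submodule k K) =
      hilb k ι C j := fun j => by
    rw [hpow, ← (Submodule.equivMapOfInjective g.toLinearMap hg (coordSpan I ^ j)).finrank_eq,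
      finrank_coordSpan_pow]
    rfl
  have hne : coordSpan I ≠ ⊥ := by
    intro h0
    have := finrank_coordSpan I
    rw [h0, finrank_bot] at this
    exact hone this.symm
  have hne' : (coordSpan I).map g.toLinearMap ≠ ⊥ := by
    rwa [Ne, (Submodule.map_injective_of_injective hg).eq_iff' (Submodule.map_bot _)]
  obtain ⟨L, V, p, r, m, v, z, hN, hz, hadj, hrank, t, ht, htm⟩ :=
    exists_model hne' (Module.Finite.iff_fg.mpr ((fg_coordSpan I).map _))
  choose s hs hst using ht
  have hsm : coordSpan I ^ (m + 1) ≤ Submodule.span k (Set.range s) * coordSpan I ^ m := by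
    rw [← Submodule.map_le_map_iff_of_injective (f := g.toLinearMap) hg, Submodule.map_mul, ← hpow,
      ← hpow, Submodule.map_span, ← Set.range_comp]
    have : g.toLinearMap ∘ s = t := funext hst
    rw [this]
    exact htm
  have hd := ringKrullDim_le_of_reduction (fg_coordSpan I) hne (adjoin_coordSpan I) hsm
  rw [HasDim] at hdim
  rw [hdim] at hd
  have hnp : n ≤ p := by
    have : n + 1 ≤ p + 1 := by exact_mod_cast hd
    omega
  obtain ⟨D, hD⟩ := hN.exists_finrank_pow_le
  obtain ⟨rfl, rfl⟩ := eq_of_hilbert_bounds (H := hilb k ι C) hN.ne_zero hnp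
    (fun j => by rw [← hrk, ← hrank]; exact hN.le_finrank_pow hz j)
    (fun j => by rw [← hrk, ← hrank]; exact hD j) hdeg
  exact ⟨L, inferInstance, inferInstance, V, v, z, hN, hadj, fun j => (hrank j).trans (hrk j)⟩

end HilbertFunction

end QuadricBound

/-- Corollary 3.2. If a nondegenerate irreducible projective variety
`X ⊆ ℙ^{n+c}`, `c ≥ 4`, of degree `d` satisfies `a₂(X) = C(c+1, 2) - 3`, then
`c + 2 ≤ d ≤ c + 4`. -/
theorem stmt_3 {k : Type} [Field k] [IsAlgClosed k] [CharZero k]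
    (n c d : ℕ) (hc : 4 ≤ c)
    (C : Set (Fin (n + c + 1) → k))
    (hV : IsProjVariety k (Fin (n + c + 1)) C)
    (hnd : Nondeg k (Fin (n + c + 1)) C)
    (hdim : HasDim k (Fin (n + c + 1)) C n)
    (hdeg : HasDegree k (Fin (n + c + 1)) C n d)
    (ha : a2 k (Fin (n + c + 1)) C = Nat.choose (c + 1) 2 - 3) :
    c + 2 ≤ d ∧ d ≤ c + 4 := by
  have h1 : hilb k (Fin (n + c + 1)) C 1 = n + c + 1 := by
    rw [QuadricBound.hilb_one hnd, QuadricBound.finrank_homogeneousSubmodule, add_comm 1,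
      Nat.choose_succ_self_right]
  have h2 : hilb k (Fin (n + c + 1)) C 2 = (n + c + 2).choose 2 - ((c + 1).choose 2 - 3) := by
    rw [← ha, a2, quadrics, hilb, idealHilb, QuadricBound.finrank_homogeneousSubmodule, add_comm 2,
      Nat.choose_symm_add]
  obtain ⟨L, _, _, V, v, z, hN, hadj, hrank⟩ :=
    QuadricBound.exists_model_of_isProjVariety hV hdim hdeg (by omega)
  exact hN.rank_bounds hadj hc (by rw [← h1, ← hrank, pow_one]) (by rw [hrank, h2])
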